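/- arXiv:2412.20385 — 3 statements merged into one kernel-verified Lean document; each statement's English description precedes it below -/
import Mathlib

section
/- Under Assumption 1, the mean-field variational inference problem min_{q ∈ Q} D_KL(q‖p) has a unique optimal solution q*. -/
open MeasureTheory ENNReal

noncomputable section

open scoped Classical in
/-- Kullback--Leibler divergence, valued in `EReal`: `∫ log(dq/dp) dq` if `q ≪ p` and
the integrand is `q`-integrable, and `+∞` otherwise. -/
def KL {E : Type*} [MeasurableSpace E] (q p : Measure E) : EReal :=
  if q ≪ p ∧ Integrable (fun x => Real.log ((q.rnDeriv p x).toReal)) q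
  then ((∫ x, Real.log ((q.rnDeriv p x).toReal) ∂q : ℝ) : EReal)
  else ⊤

/-- The target measure with density `e^{-V} / Z` where `Z = ∫ e^{-V}`. -/
def target {m : ℕ} (V : (Fin m → ℝ) → ℝ) : Measure (Fin m → ℝ) :=
  volume.withDensity fun x =>
    ENNReal.ofReal (Real.exp (-V x) / ∫ y, Real.exp (-V y))

/-- The mean-field family: product measures on ℝ^m whose marginals are absolutely
continuous probability measures on ℝ. -/
def meanField (m : ℕ) : Set (Measure (Fin m → ℝ)) :=
  {q | ∃ qi : Fin m → Measure ℝ,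
    (∀ i, IsProbabilityMeasure (qi i)) ∧ (∀ i, qi i ≪ volume) ∧ q = Measure.pi qi}

section VariationalInference

open Filter Topology

/-- The measure with density `f` with respect to the volume. -/
def densityMeasure {E : Type*} [MeasureSpace E] (f : E → ℝ) : Measure E :=
  volume.withDensity fun x => ENNReal.ofReal (f x)

/-- A probability density on `E`. -/
structure IsProbDensity {E : Type*} [MeasureSpace E] (f : E → ℝ) : Prop where
  measurable : Measurable f
  nonneg : ∀ x, 0 ≤ f x
  prob : IsProbabilityMeasure (densityMeasure f)

section Density

variable {E : Type*} [MeasureSpace E] {f : E → ℝ}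

lemma integral_densityMeasure (hf : Measurable f) (h0 : ∀ x, 0 ≤ f x) (g : E → ℝ) :
    ∫ x, g x ∂(densityMeasure f) = ∫ x, f x * g x := by
  unfold densityMeasure
  rw [integral_withDensity_eq_integral_toReal_smul (by fun_prop) (by simp)]
  simp [ENNReal.toReal_ofReal, h0]

lemma integrable_densityMeasure_iff (hf : Measurable f) (h0 : ∀ x, 0 ≤ f x) (g : E → ℝ) :
    Integrable g (densityMeasure f) ↔ Integrable (fun x => f x * g x) := by
  unfold densityMeasure
  rw [integrable_withDensity_iff_integrable_smul' (by fun_prop) (by simp)]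
  simp [ENNReal.toReal_ofReal, h0]

lemma ae_pos_densityMeasure (hf : Measurable f) : ∀ᵐ x ∂(densityMeasure f), 0 < f x := by
  unfold densityMeasure
  rw [ae_withDensity_iff (by fun_prop)]
  exact ae_of_all _ fun x hx => by simpa using hx

lemma IsProbDensity.integrable (hf : IsProbDensity f) : Integrable f := by
  have := hf.prob
  have h := (integrable_densityMeasure_iff hf.measurable hf.nonneg (fun _ => 1)).1
    (integrable_const 1)
  simpa using h

lemma IsProbDensity.integral_eq_one (hf : IsProbDensity f) : ∫ x, f x = 1 := by
  have := hf.prob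
  have h := integral_densityMeasure hf.measurable hf.nonneg (fun _ => 1)
  simpa using h.symm

lemma isProbDensity_of_integral_eq_one (hf : Measurable f) (h0 : ∀ x, 0 ≤ f x)
    (h1 : ∫ x, f x = 1) : IsProbDensity f := by
  refine ⟨hf, h0, ⟨?_⟩⟩
  have hi : Integrable f := by
    by_contra h
    rw [integral_undef h] at h1
    exact zero_ne_one h1
  rw [densityMeasure, withDensity_apply _ MeasurableSet.univ, Measure.restrict_univ,
    ← ofReal_integral_eq_lintegral_ofReal hi (ae_of_all _ h0), h1, ENNReal.ofReal_one]

lemma densityMeasure_congr {g : E → ℝ} (h : f =ᵐ[volume] g) :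
    densityMeasure f = densityMeasure g :=
  withDensity_congr_ae (h.mono fun x hx => by simp [hx])

lemma exists_isProbDensity [SigmaFinite (volume : Measure E)] (q : Measure E)
    [hq : IsProbabilityMeasure q] (h : q ≪ volume) :
    ∃ f : E → ℝ, IsProbDensity f ∧ q = densityMeasure f := by
  have key : q = densityMeasure fun x => (q.rnDeriv volume x).toReal := by
    conv_lhs => rw [← Measure.withDensity_rnDeriv_eq q volume h]
    refine withDensity_congr_ae ?_
    filter_upwards [q.rnDeriv_lt_top volume] with x hx
    rw [ENNReal.ofReal_toReal hx.ne]
  refine ⟨_, ⟨(q.measurable_rnDeriv volume).ennreal_toReal, fun x => ENNReal.toReal_nonneg, ?_⟩,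
    key⟩
  rwa [← key]

/-- The Kullback--Leibler divergence between two measures given by densities. -/
lemma KL_densityMeasure [SigmaFinite (volume : Measure E)] (hf : IsProbDensity f) {W : E → ℝ}
    (hW : Measurable W) (g : E → ℝ)
    (hg : ∀ᵐ x ∂(densityMeasure f), g x = Real.log (f x) + W x) :
    (Integrable g (densityMeasure f) →
      KL (densityMeasure f) (densityMeasure fun x => Real.exp (-W x))
        = ((∫ x, g x ∂(densityMeasure f) : ℝ) : EReal)) ∧
    (¬ Integrable g (densityMeasure f) →
      KL (densityMeasure f) (densityMeasure fun x => Real.exp (-W x)) = ⊤) := by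
  have hf1 := hf.measurable
  set q := densityMeasure f with hq
  set p := densityMeasure fun x => Real.exp (-W x) with hp
  have hqp : q = p.withDensity fun x => ENNReal.ofReal (f x * Real.exp (W x)) := by
    rw [hq, hp, densityMeasure, densityMeasure, ← withDensity_mul _ (by fun_prop) (by fun_prop)]
    refine congrArg _ (funext fun x => ?_)
    rw [Pi.mul_apply, ← ENNReal.ofReal_mul (Real.exp_pos _).le, mul_comm, mul_assoc, ← Real.exp_add]
    simp
  have hac : q ≪ p := by rw [hqp]; exact withDensity_absolutelyContinuous _ _
  have : SigmaFinite p := by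
    rw [hp]; exact SigmaFinite.withDensity_ofReal _
  have hrn : q.rnDeriv p =ᵐ[q] fun x => ENNReal.ofReal (f x * Real.exp (W x)) := by
    have h := Measure.rnDeriv_withDensity p
      (f := fun x => ENNReal.ofReal (f x * Real.exp (W x))) (by fun_prop)
    rw [← hqp] at h
    exact hac.ae_eq h
  have hlog : (fun x => Real.log ((q.rnDeriv p x).toReal)) =ᵐ[q] g := by
    filter_upwards [hrn, hg, ae_pos_densityMeasure hf1] with x h1 h2 h3
    rw [h1, h2, ENNReal.toReal_ofReal (by positivity), Real.log_mul h3.ne' (Real.exp_ne_zero _),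
      Real.log_exp]
  unfold KL
  constructor
  · intro h
    rw [if_pos ⟨hac, (integrable_congr hlog).2 h⟩, integral_congr_ae hlog]
  · intro h
    rw [if_neg fun h' => h ((integrable_congr hlog).1 h'.2)]

lemma young_entropy {a w : ℝ} (ha : 0 ≤ a) (g : ℝ) :
    g * a ≤ a * (Real.log a + w) - a + Real.exp (g - w) := by
  rcases ha.eq_or_lt with rfl | ha
  · simp [Real.exp_nonneg]
  have h := Real.add_one_le_exp (g - w - Real.log a)
  rw [Real.exp_sub, Real.exp_log ha, le_div_iff₀ ha] at h
  nlinarith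

lemma eq_exp_neg_of_entropy_eq_zero {a w : ℝ} (ha : 0 ≤ a)
    (h : a * (Real.log a + w) - a + Real.exp (-w) = 0) : a = Real.exp (-w) := by
  rcases ha.eq_or_lt with rfl | ha
  · simp [Real.exp_ne_zero] at h
  by_contra hne
  have h1 : -w - Real.log a ≠ 0 := by
    intro h0
    apply hne
    rw [← Real.exp_log ha]
    congr 1; linarith
  have h2 := Real.add_one_lt_exp h1
  rw [Real.exp_sub, Real.exp_log ha, lt_div_iff₀ ha] at h2
  nlinarith

/-- An entropy bound on the integral of a nonnegative function. -/
lemma integral_le_of_entropy (hf : IsProbDensity f) {W g ψ : E → ℝ}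
    (hψ : ∀ᵐ x ∂(densityMeasure f), ψ x = Real.log (f x) + W x)
    (hi : Integrable ψ (densityMeasure f)) (hg : Measurable g) (hg0 : ∀ x, 0 ≤ g x)
    (he : Integrable fun x => Real.exp (g x - W x)) :
    Integrable g (densityMeasure f) ∧
      ∫ x, g x ∂(densityMeasure f) ≤
        ∫ x, ψ x ∂(densityMeasure f) - 1 + ∫ x, Real.exp (g x - W x) := by
  have hf1 := hf.measurable
  have hfψ : ∀ᵐ x : E, f x * ψ x = f x * (Real.log (f x) + W x) := by
    unfold densityMeasure at hψ
    rw [ae_withDensity_iff (by fun_prop)] at hψ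
    filter_upwards [hψ] with x hx
    rcases (hf.nonneg x).eq_or_lt with h | h
    · simp [← h]
    · rw [hx (by simpa using h)]
  have hi' := (integrable_densityMeasure_iff hf1 hf.nonneg ψ).1 hi
  have hle : ∀ᵐ x : E, f x * g x ≤ f x * ψ x - f x + Real.exp (g x - W x) := by
    filter_upwards [hfψ] with x hx
    rw [hx, mul_comm]
    exact young_entropy (hf.nonneg x) _
  have hbd : Integrable fun x => f x * ψ x - f x + Real.exp (g x - W x) :=
    (hi'.sub hf.integrable).add he
  have hgi : Integrable fun x => f x * g x := by
    refine hbd.mono' (by fun_prop) ?_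
    filter_upwards [hle] with x hx
    rwa [Real.norm_of_nonneg (mul_nonneg (hf.nonneg x) (hg0 x))]
  refine ⟨(integrable_densityMeasure_iff hf1 hf.nonneg g).2 hgi, ?_⟩
  rw [integral_densityMeasure hf1 hf.nonneg, integral_densityMeasure hf1 hf.nonneg]
  calc ∫ x, f x * g x ≤ ∫ x, (f x * ψ x - f x + Real.exp (g x - W x)) :=
        integral_mono_ae hgi hbd hle
    _ = _ := by
      have h := integral_add (hi'.sub hf.integrable) he
      simp only [Pi.sub_apply] at h
      rw [h, integral_sub hi' hf.integrable, hf.integral_eq_one]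

/-- A density whose log-ratio is bounded above by an integrable function has integrable
log-ratio. -/
lemma integrable_of_le_of_entropy (hf : IsProbDensity f) {W g ψ : E → ℝ} (hW : Measurable W)
    (hψ : ∀ᵐ x ∂(densityMeasure f), ψ x = Real.log (f x) + W x)
    (he : Integrable fun x => Real.exp (-W x))
    (hg : Integrable g (densityMeasure f)) (hle : ∀ᵐ x ∂(densityMeasure f), ψ x ≤ g x) :
    Integrable ψ (densityMeasure f) := by
  have hf1 := hf.measurable
  have hm : AEStronglyMeasurable ψ (densityMeasure f) :=
    (AEMeasurable.aestronglyMeasurable (f := fun x => Real.log (f x) + W x) (by fun_prop)).congr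
      (hψ.mono fun x hx => hx.symm)
  have hneg : Integrable (fun x => max (-(Real.log (f x) + W x)) 0) (densityMeasure f) := by
    rw [integrable_densityMeasure_iff hf1 hf.nonneg]
    refine he.mono' (by fun_prop) (ae_of_all _ fun x => ?_)
    rw [Real.norm_of_nonneg (mul_nonneg (hf.nonneg x) (le_max_right _ _))]
    have h := young_entropy (w := W x) (hf.nonneg x) 0
    have h0 := hf.nonneg x
    rw [zero_sub] at h
    rcases max_cases (-(Real.log (f x) + W x)) 0 with h' | h' <;> rw [h'.1]
    · linarith
    · simpa using (Real.exp_pos _).le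
  refine (hg.norm.add hneg).mono' hm ?_
  filter_upwards [hψ, hle] with x h1 h2
  rw [Pi.add_apply, Real.norm_eq_abs, Real.norm_eq_abs, ← h1, abs_le]
  have := le_max_left (-ψ x) 0
  have := le_max_right (-ψ x) 0
  have := le_abs_self (g x)
  have := abs_nonneg (g x)
  constructor <;> linarith

end Density

section Pi

variable {m : ℕ}

lemma isProbDensity_pi {f : Fin m → ℝ → ℝ} (hf : ∀ i, IsProbDensity (f i)) :
    Measure.pi (fun i => densityMeasure (f i)) =
      densityMeasure (fun x : Fin m → ℝ => ∏ i, f i (x i)) ∧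
    IsProbDensity (fun x : Fin m → ℝ => ∏ i, f i (x i)) := by
  have hm : Measurable fun x : Fin m → ℝ => ∏ i, f i (x i) :=
    Finset.measurable_prod _ fun i _ => (hf i).measurable.comp (measurable_pi_apply i)
  have h0 : ∀ x : Fin m → ℝ, 0 ≤ ∏ i, f i (x i) := fun x =>
    Finset.prod_nonneg fun i _ => (hf i).nonneg _
  have hprob : ∀ i, IsProbabilityMeasure (densityMeasure (f i)) := fun i => (hf i).prob
  constructor
  · refine Measure.pi_eq fun s hs => ?_
    have h1 : ∀ i, densityMeasure (f i) (s i) =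
        ENNReal.ofReal (∫ t, (s i).indicator (f i) t) := fun i => by
      rw [densityMeasure, withDensity_apply _ (hs i), integral_indicator (hs i),
        ofReal_integral_eq_lintegral_ofReal (hf i).integrable.integrableOn
          (ae_of_all _ (hf i).nonneg)]
    have h_int : Integrable fun x : Fin m → ℝ => ∏ i, f i (x i) :=
      Integrable.fintype_prod fun i => (hf i).integrable
    rw [densityMeasure, withDensity_apply _ (MeasurableSet.univ_pi hs),
      ← ofReal_integral_eq_lintegral_ofReal h_int.integrableOn (ae_of_all _ h0),
      ← integral_indicator (MeasurableSet.univ_pi hs)]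
    simp_rw [h1]
    rw [← ENNReal.ofReal_prod_of_nonneg fun i _ => integral_nonneg fun t =>
      Set.indicator_nonneg (fun t _ => (hf i).nonneg t) t,
      ← integral_fintype_prod_volume_eq_prod]
    congr 2
    funext x
    by_cases hx : x ∈ Set.univ.pi s
    · rw [Set.indicator_of_mem hx]
      exact Finset.prod_congr rfl fun i _ => (Set.indicator_of_mem (hx i trivial) _).symm
    · rw [Set.indicator_of_notMem hx]
      simp only [Set.mem_pi, Set.mem_univ, true_imp_iff, not_forall] at hx
      obtain ⟨i, hi⟩ := hx
      exact (Finset.prod_eq_zero (Finset.mem_univ i) (Set.indicator_of_notMem hi _)).symm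
  · refine isProbDensity_of_integral_eq_one hm h0 ?_
    rw [integral_fintype_prod_volume_eq_prod]
    exact Finset.prod_eq_one fun i _ => (hf i).integral_eq_one

/-- Resampling one coordinate of a product probability measure. -/
lemma measurePreserving_update {μ : Fin m → Measure ℝ} [∀ i, IsProbabilityMeasure (μ i)]
    (i : Fin m) (ν : Measure ℝ) [IsProbabilityMeasure ν] :
    MeasurePreserving (fun z : (Fin m → ℝ) × ℝ => Function.update z.1 i z.2)
      ((Measure.pi μ).prod ν) (Measure.pi (Function.update μ i ν)) := by
  have hm : Measurable fun z : (Fin m → ℝ) × ℝ => Function.update z.1 i z.2 := by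
    refine measurable_pi_lambda _ fun j => ?_
    by_cases hj : j = i
    · subst hj; simpa using measurable_snd
    · simp only [Function.update_of_ne hj]
      fun_prop
  have hprob : ∀ j, IsProbabilityMeasure (Function.update μ i ν j) := fun j => by
    by_cases hj : j = i
    · subst hj; simpa
    · simp only [Function.update_of_ne hj]
      infer_instance
  refine ⟨hm, (Measure.pi_eq fun s hs => ?_).symm⟩
  rw [Measure.map_apply hm (MeasurableSet.univ_pi hs)]
  have : (fun z : (Fin m → ℝ) × ℝ => Function.update z.1 i z.2) ⁻¹' Set.univ.pi s =
      (Set.univ.pi (Function.update s i Set.univ)) ×ˢ s i := by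
    ext z
    simp only [Set.mem_preimage, Set.mem_pi, Set.mem_univ, true_imp_iff, Set.mem_prod]
    constructor
    · intro h
      refine ⟨fun j => ?_, by simpa using h i⟩
      by_cases hj : j = i
      · subst hj; simp
      · simpa [hj] using h j
    · rintro ⟨h1, h2⟩ j
      by_cases hj : j = i
      · subst hj; simpa using h2
      · simpa [hj] using h1 j
  rw [this, Measure.prod_prod, Measure.pi_pi, ← Finset.mul_prod_erase _ _ (Finset.mem_univ i),
    ← Finset.mul_prod_erase _ (fun j => Function.update μ i ν j (s j)) (Finset.mem_univ i)]
  simp only [Function.update_self, measure_univ, one_mul]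
  rw [mul_comm]
  congr 1
  refine Finset.prod_congr rfl fun j hj => ?_
  simp [Finset.ne_of_mem_erase hj]

end Pi

section Transport

lemma map_densityMeasure_of_hasDerivAt {a h S S' : ℝ → ℝ} (hS : ∀ x, HasDerivAt S (S' x) x)
    (hpos : ∀ x, 0 < S' x) (hsurj : Function.Surjective S) (heq : ∀ x, S' x * h (S x) = a x) :
    (densityMeasure a).map S = densityMeasure h := by
  have hmono : StrictMono S := strictMono_of_deriv_pos fun x => by
    rw [(hS x).deriv]; exact hpos x
  have hm : Measurable S :=
    (continuous_iff_continuousAt.2 fun x => (hS x).continuousAt).measurable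
  ext E hE
  rw [Measure.map_apply hm hE, densityMeasure, densityMeasure, withDensity_apply _ (hm hE),
    withDensity_apply _ hE]
  conv_rhs => rw [← Set.image_preimage_eq E hsurj]
  rw [lintegral_image_eq_lintegral_abs_deriv_mul (hm hE)
    (fun x _ => (hS x).hasDerivWithinAt) hmono.injective.injOn]
  refine lintegral_congr fun x => ?_
  rw [abs_of_pos (hpos x), ← ENNReal.ofReal_mul (hpos x).le, heq]

lemma hasDerivAt_cdf_densityMeasure {a : ℝ → ℝ} (ha : IsProbDensity a) (hc : Continuous a)
    (x : ℝ) : HasDerivAt (ProbabilityTheory.cdf (densityMeasure a)) (a x) x := by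
  have := ha.prob
  have hval : ∀ y, ProbabilityTheory.cdf (densityMeasure a) y = ∫ t in Set.Iic y, a t := by
    intro y
    rw [ProbabilityTheory.cdf_eq_real, measureReal_def, densityMeasure,
      withDensity_apply _ measurableSet_Iic,
      ← ofReal_integral_eq_lintegral_ofReal ha.integrable.integrableOn (ae_of_all _ ha.nonneg),
      ENNReal.toReal_ofReal (integral_nonneg ha.nonneg)]
  have h2 : (ProbabilityTheory.cdf (densityMeasure a) : ℝ → ℝ) =
      fun y => (∫ t in Set.Iic (0 : ℝ), a t) + ∫ t in (0 : ℝ)..y, a t := by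
    funext y
    rw [hval, ← intervalIntegral.integral_Iic_sub_Iic ha.integrable.integrableOn
      ha.integrable.integrableOn]
    ring
  rw [h2]
  exact (hc.integral_hasStrictDerivAt 0 x).hasDerivAt.const_add _

/-- Monotone transport between two positive continuous densities, together with the density of
the midpoint of the displacement. -/
lemma exists_transport {a b : ℝ → ℝ} (ha : IsProbDensity a) (hb : IsProbDensity b)
    (hac : Continuous a) (hbc : Continuous b) (ha0 : ∀ x, 0 < a x) (hb0 : ∀ x, 0 < b x) :
    ∃ T h : ℝ → ℝ, Measurable T ∧ IsProbDensity h ∧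
      (densityMeasure a).map T = densityMeasure b ∧
      (densityMeasure a).map (fun x => (x + T x) / 2) = densityMeasure h ∧
      ∀ x, Real.log (h ((x + T x) / 2)) ≤ (Real.log (a x) + Real.log (b (T x))) / 2 := by
  have hpa := ha.prob
  have hpb := hb.prob
  have key : ∀ {f : ℝ → ℝ}, IsProbDensity f → Continuous f → (∀ x, 0 < f x) →
      StrictMono (ProbabilityTheory.cdf (densityMeasure f)) ∧
      (∀ x, ProbabilityTheory.cdf (densityMeasure f) x ∈ Set.Ioo (0 : ℝ) 1) ∧
      ∀ u ∈ Set.Ioo (0 : ℝ) 1, ∃ x, ProbabilityTheory.cdf (densityMeasure f) x = u := by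
    intro f hf hfc hf0
    have hd := hasDerivAt_cdf_densityMeasure hf hfc
    have hmono : StrictMono (ProbabilityTheory.cdf (densityMeasure f)) :=
      strictMono_of_deriv_pos fun x => by rw [(hd x).deriv]; exact hf0 x
    refine ⟨hmono, fun x => ⟨?_, ?_⟩, fun u hu => ?_⟩
    · exact (ProbabilityTheory.cdf_nonneg _ (x - 1)).trans_lt (hmono (by linarith))
    · exact (hmono (show x < x + 1 by linarith)).trans_le (ProbabilityTheory.cdf_le_one _ _)
    · have hcont : Continuous (ProbabilityTheory.cdf (densityMeasure f)) :=
        continuous_iff_continuousAt.2 fun x => (hd x).continuousAt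
      obtain ⟨y, hy⟩ := ((ProbabilityTheory.tendsto_cdf_atBot (densityMeasure f)).eventually
        (gt_mem_nhds hu.1)).exists
      obtain ⟨z, hz⟩ := ((ProbabilityTheory.tendsto_cdf_atTop (densityMeasure f)).eventually
        (lt_mem_nhds hu.2)).exists
      exact mem_range_of_exists_le_of_exists_ge hcont ⟨y, hy.le⟩ ⟨z, hz.le⟩
  obtain ⟨hAm, hA1, hAs⟩ := key ha hac ha0
  obtain ⟨hBm, hB1, hBs⟩ := key hb hbc hb0
  set A := ProbabilityTheory.cdf (densityMeasure a)
  set B := ProbabilityTheory.cdf (densityMeasure b)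
  choose T hT using fun x => hBs (A x) (hA1 x)
  have hTm : StrictMono T := fun x y hxy => by
    rw [← hBm.lt_iff_lt, hT, hT]; exact hAm hxy
  have hTs : Function.Surjective T := fun y => by
    obtain ⟨x, hx⟩ := hAs (B y) (hB1 y)
    exact ⟨x, hBm.injective (by rw [hT, hx])⟩
  have hTc : Continuous T := hTm.monotone.continuous_of_surjective hTs
  have hTd : ∀ x, HasDerivAt T (a x / b (T x)) x := by
    intro x
    have hs : HasStrictDerivAt B (b (T x)) (T x) :=
      hasStrictDerivAt_of_hasDerivAt_of_continuousAt
        (Eventually.of_forall (hasDerivAt_cdf_densityMeasure hb hbc)) hbc.continuousAt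
    have hinv := (hs.to_localInverse (hb0 (T x)).ne').hasDerivAt
    rw [hT x] at hinv
    have hcomp := hinv.comp x (hasDerivAt_cdf_densityMeasure ha hac x)
    rw [div_eq_inv_mul]
    refine hcomp.congr_of_eventuallyEq ?_
    have hev := (hs.hasStrictFDerivAt_equiv (hb0 (T x)).ne').eventually_left_inverse
    filter_upwards [hTc.continuousAt.eventually hev] with y hy
    rw [hT y] at hy
    exact hy.symm
  have hT'0 : ∀ x, 0 < a x / b (T x) := fun x => div_pos (ha0 x) (hb0 _)
  set S : ℝ → ℝ := fun x => (x + T x) / 2 with hS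
  have hSd : ∀ x, HasDerivAt S ((1 + a x / b (T x)) / 2) x := fun x =>
    ((hasDerivAt_id x).add (hTd x)).div_const 2
  have hS'0 : ∀ x, 0 < (1 + a x / b (T x)) / 2 := fun x => by linarith [hT'0 x]
  have hSm : StrictMono S := fun x y hxy => by
    have := hTm hxy
    simp only [hS]; linarith
  have hSc : Continuous S := by fun_prop
  have hSs : Function.Surjective S := by
    refine fun y => mem_range_of_exists_le_of_exists_ge hSc ?_ ?_
    · obtain ⟨z, hz⟩ := hTs y
      refine ⟨min y z, ?_⟩
      have h1 := hTm.monotone (min_le_right y z)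
      have h2 := min_le_left y z
      simp only [hS]; linarith
    · obtain ⟨z, hz⟩ := hTs y
      refine ⟨max y z, ?_⟩
      have h1 := hTm.monotone (le_max_right y z)
      have h2 := le_max_left y z
      simp only [hS]; linarith
  set R := (hSm.orderIsoOfSurjective S hSs).symm with hR
  have hRS : ∀ x, R (S x) = x := fun x =>
    (hSm.orderIsoOfSurjective S hSs).symm_apply_apply x
  have hRc : Continuous R := R.continuous
  set h : ℝ → ℝ := fun y => a (R y) / ((1 + a (R y) / b (T (R y))) / 2) with hh
  have hhS : ∀ x, h (S x) = a x / ((1 + a x / b (T x)) / 2) := fun x => by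
    simp only [hh, hRS]
  have hmapS : (densityMeasure a).map S = densityMeasure h := by
    refine map_densityMeasure_of_hasDerivAt hSd hS'0 hSs fun x => ?_
    rw [hhS, mul_div_cancel₀ _ (hS'0 x).ne']
  have hhm : Measurable h := by
    have hTm := hTc.measurable
    have hRm := hRc.measurable
    have := ha.measurable
    have := hb.measurable
    fun_prop
  refine ⟨T, h, hTc.measurable, ⟨hhm, fun y => ?_, ?_⟩, ?_, hmapS, fun x => ?_⟩
  · exact (div_pos (ha0 _) (hS'0 _)).le
  · rw [← hmapS]; exact Measure.isProbabilityMeasure_map hSc.aemeasurable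
  · refine map_densityMeasure_of_hasDerivAt hTd hT'0 hTs fun x => ?_
    rw [div_mul_cancel₀ _ (hb0 _).ne']
  · change Real.log (h (S x)) ≤ _
    have hpos : 0 < h (S x) := by rw [hhS]; exact div_pos (ha0 _) (hS'0 _)
    have hsq : h (S x) ^ 2 ≤ a x * b (T x) := by
      rw [hhS]
      have h1 := ha0 x
      have h2 := hb0 (T x)
      have h3 : a x / ((1 + a x / b (T x)) / 2) = 2 * a x * b (T x) / (a x + b (T x)) := by
        field_simp
        ring
      rw [h3, div_pow, div_le_iff₀ (by positivity)]
      nlinarith [mul_nonneg (mul_pos h1 h2).le (sq_nonneg (a x - b (T x)))]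
    have hl := Real.log_le_log (by positivity) hsq
    rw [Real.log_pow, Real.log_mul (ha0 _).ne' (hb0 _).ne'] at hl
    push_cast at hl
    linarith

end Transport

/-- Quadratic growth, locally Lipschitz bounds and midpoint strong convexity of a potential. -/
structure IsPotential {m : ℕ} (W : (Fin m → ℝ) → ℝ) (α c C : ℝ) : Prop where
  α_pos : 0 < α
  c_pos : 0 < c
  C_nonneg : 0 ≤ C
  lower : ∀ x, c * ∑ i, x i ^ 2 - C ≤ W x
  lip : ∀ x y, |W x - W y| ≤ C * (1 + ‖x‖ + ‖y‖) * ‖x - y‖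
  mid : ∀ x y, W (fun i => (x i + y i) / 2) ≤ (W x + W y) / 2 - α / 8 * ∑ i, (x i - y i) ^ 2

section Hessian

variable {m : ℕ} {V : (Fin m → ℝ) → ℝ} {α L : ℝ}

lemma norm_sq_le_sum_sq (x : Fin m → ℝ) : ‖x‖ ^ 2 ≤ ∑ i, x i ^ 2 := by
  have h0 : 0 ≤ ∑ i, x i ^ 2 := Finset.sum_nonneg fun i _ => sq_nonneg _
  rw [← Real.le_sqrt (norm_nonneg _) h0, pi_norm_le_iff_of_nonneg (Real.sqrt_nonneg _)]
  intro i
  rw [Real.le_sqrt (norm_nonneg _) h0, Real.norm_eq_abs, sq_abs]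
  exact Finset.single_le_sum (f := fun i => x i ^ 2) (fun i _ => sq_nonneg _) (Finset.mem_univ i)

lemma sum_sq_le_norm_sq (x : Fin m → ℝ) : ∑ i, x i ^ 2 ≤ m * ‖x‖ ^ 2 := by
  calc ∑ i, x i ^ 2 ≤ ∑ _i : Fin m, ‖x‖ ^ 2 := Finset.sum_le_sum fun i _ => by
        rw [← sq_abs]
        exact pow_le_pow_left₀ (abs_nonneg _) (norm_le_pi_norm x i) 2
    _ = _ := by simp

lemma first_order_strong_convexity (hV : ContDiff ℝ 2 V)
    (hHess : ∀ x v : Fin m → ℝ, α * ∑ i, v i ^ 2 ≤ fderiv ℝ (fderiv ℝ V) x v v)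
    (x v : Fin m → ℝ) :
    V x + fderiv ℝ V x v + α / 2 * ∑ i, v i ^ 2 ≤ V (x + v) := by
  set k := α * ∑ i, v i ^ 2 with hk
  have hd1 : Differentiable ℝ V := hV.differentiable (by norm_num)
  have hd2 : Differentiable ℝ (fderiv ℝ V) :=
    (hV.fderiv_right (m := 1) (by norm_num)).differentiable (by norm_num)
  have hline : ∀ t : ℝ, HasDerivAt (fun t : ℝ => x + t • v) v t := fun t => by
    simpa using ((hasDerivAt_id t).smul_const v).const_add x
  have h1 : ∀ t : ℝ, HasDerivAt (fun t : ℝ => V (x + t • v)) (fderiv ℝ V (x + t • v) v) t :=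
    fun t => (hd1 _).hasFDerivAt.comp_hasDerivAt t (hline t)
  have h2 : ∀ t : ℝ, HasDerivAt (fun t : ℝ => fderiv ℝ V (x + t • v) v)
      (fderiv ℝ (fderiv ℝ V) (x + t • v) v v) t := fun t => by
    have h := ((hd2 _).hasFDerivAt.comp_hasDerivAt t (hline t)).clm_apply (hasDerivAt_const t v)
    simpa using h
  have hm1 : Monotone fun t : ℝ => fderiv ℝ V (x + t • v) v - k * t := by
    refine monotone_of_hasDerivAt_nonneg (f' := fun t => _ - k * 1)
      (fun t => (h2 t).sub ((hasDerivAt_id t).const_mul k)) fun t => ?_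
    have := hHess (x + t • v) v
    simp only [Pi.zero_apply]
    linarith
  have h3 : ∀ t : ℝ, HasDerivAt
      (fun t : ℝ => V (x + t • v) - fderiv ℝ V x v * t - k / 2 * t ^ 2)
      (fderiv ℝ V (x + t • v) v - fderiv ℝ V x v * 1 - k / 2 * (2 * t)) t := fun t => by
    have := ((h1 t).sub ((hasDerivAt_id t).const_mul (fderiv ℝ V x v))).sub
      ((hasDerivAt_pow 2 t).const_mul (k / 2))
    exact this.congr_deriv (by simp)
  have hm2 : MonotoneOn (fun t : ℝ => V (x + t • v) - fderiv ℝ V x v * t - k / 2 * t ^ 2)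
      (Set.Ici 0) := by
    refine monotoneOn_of_deriv_nonneg (convex_Ici 0)
      (fun t _ => (h3 t).continuousAt.continuousWithinAt)
      (fun t _ => (h3 t).differentiableAt.differentiableWithinAt) fun t ht => ?_
    rw [interior_Ici] at ht
    rw [(h3 t).deriv]
    have := hm1 (le_of_lt ht)
    simp only [zero_smul, add_zero, mul_zero, sub_zero] at this
    linarith
  have := hm2 (Set.mem_Ici.2 le_rfl) (Set.mem_Ici.2 zero_le_one) zero_le_one
  simp only [zero_smul, add_zero, mul_zero, sub_zero, one_smul, mul_one, one_pow] at this
  rw [zero_pow two_ne_zero] at this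
  rw [hk] at this
  linarith

lemma norm_fderiv_le_of_hessian (hα : 0 < α) (hαL : α ≤ L) (hV : ContDiff ℝ 2 V)
    (hHess : ∀ x v : Fin m → ℝ,
      α * ∑ i, v i ^ 2 ≤ fderiv ℝ (fderiv ℝ V) x v v ∧
      fderiv ℝ (fderiv ℝ V) x v v ≤ L * ∑ i, v i ^ 2) (x : Fin m → ℝ) :
    ‖fderiv ℝ V x‖ ≤ ‖fderiv ℝ V 0‖ + L * m * ‖x‖ := by
  have hL : 0 ≤ L := hα.le.trans hαL
  have hd2 : Differentiable ℝ (fderiv ℝ V) :=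
    (hV.fderiv_right (m := 1) (by norm_num)).differentiable (by norm_num)
  have hbound : ∀ y, ‖fderiv ℝ (fderiv ℝ V) y‖ ≤ L * m := by
    intro y
    set B := fderiv ℝ (fderiv ℝ V) y with hB
    have hsymm : ∀ u v, B u v = B v u := fun u v =>
      (hV.contDiffAt (x := y)).isSymmSndFDerivAt (by simp) u v
    have hnn : ∀ v, 0 ≤ B v v := fun v =>
      (mul_nonneg hα.le (Finset.sum_nonneg fun i _ => sq_nonneg _)).trans (hHess y v).1
    have hup : ∀ v, B v v ≤ L * m * ‖v‖ ^ 2 := fun v =>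
      (hHess y v).2.trans (by
        rw [mul_assoc]; exact mul_le_mul_of_nonneg_left (sum_sq_le_norm_sq v) hL)
    refine ContinuousLinearMap.opNorm_le_bound₂ _ (by positivity) fun u v => ?_
    have hdisc := discrim_le_zero (a := B v v) (b := 2 * B u v) (c := B u u) fun t => by
      have := hnn (u + t • v)
      simp only [map_add, map_smul, add_apply, smul_apply,
        smul_eq_mul, hsymm v u] at this
      linarith
    rw [discrim] at hdisc
    have hsq : B u v ^ 2 ≤ (L * m * ‖u‖ * ‖v‖) ^ 2 := by
      have := mul_le_mul (hup u) (hup v) (hnn v) (by positivity)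
      nlinarith
    rw [Real.norm_eq_abs]
    exact abs_le_of_sq_le_sq hsq (by positivity)
  have h := Convex.norm_image_sub_le_of_norm_fderiv_le (𝕜 := ℝ) (f := fderiv ℝ V)
    (fun y _ => hd2 y) (fun y _ => hbound y) convex_univ (Set.mem_univ 0) (Set.mem_univ x)
  rw [sub_zero] at h
  have := norm_sub_norm_le (fderiv ℝ V x) (fderiv ℝ V 0)
  linarith

lemma exists_isPotential (hα : 0 < α) (hαL : α ≤ L) (hV : ContDiff ℝ 2 V)
    (hHess : ∀ x v : Fin m → ℝ,
      α * ∑ i, v i ^ 2 ≤ fderiv ℝ (fderiv ℝ V) x v v ∧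
      fderiv ℝ (fderiv ℝ V) x v v ≤ L * ∑ i, v i ^ 2) (k : ℝ) :
    ∃ c C, IsPotential (fun x => V x + k) α c C := by
  have hL : 0 ≤ L := hα.le.trans hαL
  have hconv := first_order_strong_convexity hV fun x v => (hHess x v).1
  have hgrad := norm_fderiv_le_of_hessian hα hαL hV hHess
  set K := ‖fderiv ℝ V 0‖ with hK
  have hK0 : 0 ≤ K := norm_nonneg _
  set C := K + L * m + |V 0 + k| + K ^ 2 / α with hC
  have hq : 0 ≤ K ^ 2 / α := by positivity
  have hLm : 0 ≤ L * m := by positivity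
  have hab := abs_nonneg (V 0 + k)
  refine ⟨α / 4, C, hα, by positivity, by positivity, fun x => ?_, fun x y => ?_, fun x y => ?_⟩
  · have h1 := hconv 0 x
    rw [zero_add] at h1
    have h2 : -(K * ‖x‖) ≤ fderiv ℝ V 0 x := by
      have := (fderiv ℝ V 0).le_opNorm x
      rw [Real.norm_eq_abs] at this
      exact (neg_le_neg this).trans (neg_abs_le _)
    have h3 : K * ‖x‖ ≤ α / 4 * ‖x‖ ^ 2 + K ^ 2 / α := by
      have : α / 4 * ‖x‖ ^ 2 + K ^ 2 / α - K * ‖x‖ = (α * ‖x‖ / 2 - K) ^ 2 / α := by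
        field_simp
        ring
      have h : 0 ≤ (α * ‖x‖ / 2 - K) ^ 2 / α := by positivity
      linarith
    have h4 := mul_le_mul_of_nonneg_left (norm_sq_le_sum_sq x) (by positivity : 0 ≤ α / 4)
    have h5 := neg_abs_le (V 0 + k)
    linarith
  · have hM : ∀ z ∈ Metric.closedBall (0 : Fin m → ℝ) (max ‖x‖ ‖y‖),
        ‖fderiv ℝ V z‖ ≤ C * (1 + ‖x‖ + ‖y‖) := by
      intro z hz
      rw [mem_closedBall_zero_iff] at hz
      have hz' : ‖z‖ ≤ ‖x‖ + ‖y‖ := hz.trans (max_le_add_of_nonneg (norm_nonneg _) (norm_nonneg _))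
      have h1 := hgrad z
      have h2 := mul_le_mul_of_nonneg_left hz' hLm
      have h3 := norm_nonneg x
      have h4 := norm_nonneg y
      have h5 : L * m * (‖x‖ + ‖y‖) ≤ C * (‖x‖ + ‖y‖) :=
        mul_le_mul_of_nonneg_right (by linarith) (by positivity)
      have h6 : C * (1 + ‖x‖ + ‖y‖) = C + C * (‖x‖ + ‖y‖) := by ring
      rw [h6]
      linarith
    have h := Convex.norm_image_sub_le_of_norm_fderiv_le (𝕜 := ℝ) (f := V)
      (fun z _ => hV.differentiable (by norm_num) z) hM (convex_closedBall _ _)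
      (mem_closedBall_zero_iff.2 (le_max_right ‖x‖ ‖y‖))
      (mem_closedBall_zero_iff.2 (le_max_left ‖x‖ ‖y‖))
    rw [Real.norm_eq_abs] at h
    simpa using h
  · set z : Fin m → ℝ := fun i => (x i + y i) / 2 with hz
    set v : Fin m → ℝ := fun i => (x i - y i) / 2 with hv
    have hx : z + v = x := by funext i; simp only [hz, hv, Pi.add_apply]; ring
    have hy : z + -v = y := by
      funext i; simp only [hz, hv, Pi.add_apply, Pi.neg_apply]; ring
    have h1 := hconv z v
    have h2 := hconv z (-v)
    rw [hx] at h1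
    rw [hy, map_neg] at h2
    have hs : ∑ i, (x i - y i) ^ 2 = 4 * ∑ i, v i ^ 2 := by
      rw [Finset.mul_sum]
      exact Finset.sum_congr rfl fun i _ => by simp only [hv]; ring
    have hs' : ∑ i, (-v) i ^ 2 = ∑ i, v i ^ 2 :=
      Finset.sum_congr rfl fun i _ => by simp
    rw [hs'] at h2
    simp only [hs]
    linarith

end Hessian

section Functional

variable {m : ℕ} {W : (Fin m → ℝ) → ℝ} {α c C : ℝ}

/-- The product measure with one-dimensional densities `f i`. -/
def productMeasure (f : Fin m → ℝ → ℝ) : Measure (Fin m → ℝ) :=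
  Measure.pi fun i => densityMeasure (f i)

/-- The logarithm of the ratio between a product density and `exp (-W)`. -/
def logRatio (W : (Fin m → ℝ) → ℝ) (f : Fin m → ℝ → ℝ) (x : Fin m → ℝ) : ℝ :=
  ∑ i, Real.log (f i (x i)) + W x

/-- The relative entropy functional on product densities. -/
def entropyFunctional (W : (Fin m → ℝ) → ℝ) (f : Fin m → ℝ → ℝ) : ℝ :=
  ∫ x, logRatio W f x ∂(productMeasure f)

/-- Families of probability densities with finite relative entropy. -/
structure IsAdmissible (W : (Fin m → ℝ) → ℝ) (f : Fin m → ℝ → ℝ) : Prop where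
  isProbDensity : ∀ i, IsProbDensity (f i)
  integrable : Integrable (logRatio W f) (productMeasure f)

lemma isProbabilityMeasure_productMeasure {f : Fin m → ℝ → ℝ} (hf : ∀ i, IsProbDensity (f i)) :
    IsProbabilityMeasure (productMeasure f) := by
  have := fun i => (hf i).prob
  unfold productMeasure
  infer_instance

lemma measurePreserving_eval_productMeasure {f : Fin m → ℝ → ℝ} (hf : ∀ i, IsProbDensity (f i))
    (i : Fin m) :
    MeasurePreserving (fun x : Fin m → ℝ => x i) (productMeasure f) (densityMeasure (f i)) := by
  have := fun i => (hf i).prob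
  exact measurePreserving_eval _ i

lemma logRatio_ae_eq {f : Fin m → ℝ → ℝ} (hf : ∀ i, IsProbDensity (f i)) :
    ∀ᵐ x ∂(productMeasure f), logRatio W f x = Real.log (∏ i, f i (x i)) + W x := by
  have h : ∀ i, ∀ᵐ x ∂(productMeasure f), 0 < f i (x i) := fun i =>
    (measurePreserving_eval_productMeasure hf i).quasiMeasurePreserving.ae
      (ae_pos_densityMeasure (hf i).measurable)
  filter_upwards [ae_all_iff.2 h] with x hx
  rw [logRatio, Real.log_prod fun i _ => (hx i).ne']

lemma KL_productMeasure {f : Fin m → ℝ → ℝ} (hf : ∀ i, IsProbDensity (f i)) (hW : Measurable W) :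
    (Integrable (logRatio W f) (productMeasure f) →
      KL (productMeasure f) (densityMeasure fun x => Real.exp (-W x))
        = ((entropyFunctional W f : ℝ) : EReal)) ∧
    (¬ Integrable (logRatio W f) (productMeasure f) →
      KL (productMeasure f) (densityMeasure fun x => Real.exp (-W x)) = ⊤) := by
  have h := logRatio_ae_eq (W := W) hf
  unfold entropyFunctional
  unfold productMeasure at *
  rw [(isProbDensity_pi hf).1] at *
  exact KL_densityMeasure (isProbDensity_pi hf).2 hW _ h

lemma integrable_exp_sub_sum_sq {k : ℝ} (hk : 0 < k) (D : ℝ) :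
    Integrable fun x : Fin m → ℝ => Real.exp (D - k * ∑ i, x i ^ 2) := by
  have h : Integrable fun x : Fin m → ℝ => ∏ i, Real.exp (-k * x i ^ 2) :=
    Integrable.fintype_prod (f := fun _ t => Real.exp (-k * t ^ 2))
      fun _ => integrable_exp_neg_mul_sq hk
  refine (h.const_mul (Real.exp D)).congr (ae_of_all _ fun x => ?_)
  simp only
  rw [← Real.exp_sum, ← Real.exp_add, ← Finset.mul_sum]
  ring_nf

lemma norm_le_one_add_sum_sq (x : Fin m → ℝ) : ‖x‖ ≤ 1 + ∑ i, x i ^ 2 := by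
  have h := norm_sq_le_sum_sq x
  nlinarith [sq_nonneg (‖x‖ - 1)]

namespace IsPotential

lemma continuous (hW : IsPotential W α c C) : Continuous W := by
  rw [continuous_iff_continuousAt]
  intro x
  rw [ContinuousAt, tendsto_iff_norm_sub_tendsto_zero]
  have h : Tendsto (fun y => C * (1 + ‖y‖ + ‖x‖) * ‖y - x‖) (𝓝 x)
      (𝓝 (C * (1 + ‖x‖ + ‖x‖) * ‖x - x‖)) := by
    apply Continuous.tendsto
    fun_prop
  rw [sub_self, norm_zero, mul_zero] at h
  exact squeeze_zero (fun _ => norm_nonneg _) (fun y => hW.lip y x) h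

lemma abs_le (hW : IsPotential W α c C) (x : Fin m → ℝ) :
    |W x| ≤ (|W 0| + 2 * C) * (1 + ∑ i, x i ^ 2) := by
  have h := hW.lip x 0
  simp only [norm_zero, add_zero, sub_zero] at h
  have h1 := norm_sq_le_sum_sq x
  have h2 : (1 + ‖x‖) * ‖x‖ ≤ 2 * (1 + ∑ i, x i ^ 2) := by
    nlinarith [sq_nonneg (‖x‖ - 1)]
  have h3 := mul_le_mul_of_nonneg_left h2 hW.C_nonneg
  have h4 : |W x| ≤ |W x - W 0| + |W 0| := by
    simpa using abs_add_le (W x - W 0) (W 0)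
  have h5 : 0 ≤ |W 0| * ∑ i, x i ^ 2 :=
    mul_nonneg (abs_nonneg _) (Finset.sum_nonneg fun i _ => sq_nonneg _)
  linarith

lemma integrable_exp_sub (hW : IsPotential W α c C) {k : ℝ} (hk : k < c) :
    Integrable fun x => Real.exp (k * ∑ i, x i ^ 2 - W x) := by
  have := hW.continuous
  refine (integrable_exp_sub_sum_sq (sub_pos.2 hk) C).mono' (by fun_prop)
    (ae_of_all _ fun x => ?_)
  rw [Real.norm_of_nonneg (Real.exp_pos _).le, Real.exp_le_exp]
  linarith [hW.lower x]

/-- Second moments are controlled by the relative entropy. -/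
lemma moment_le (hW : IsPotential W α c C) {f : Fin m → ℝ → ℝ} (hf : IsAdmissible W f) :
    Integrable (fun x => ∑ i, x i ^ 2) (productMeasure f) ∧
      ∫ x, ∑ i, x i ^ 2 ∂(productMeasure f) ≤ 2 / c *
        (entropyFunctional W f - 1 + ∫ x, Real.exp (c / 2 * ∑ i, x i ^ 2 - W x)) := by
  have hc := hW.c_pos
  have h := logRatio_ae_eq (W := W) hf.isProbDensity
  have hi := hf.integrable
  unfold entropyFunctional
  unfold productMeasure at *
  rw [(isProbDensity_pi hf.isProbDensity).1] at *
  obtain ⟨h1, h2⟩ := integral_le_of_entropy (isProbDensity_pi hf.isProbDensity).2 h hi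
    (g := fun x => c / 2 * ∑ i, x i ^ 2) (by fun_prop)
    (fun x => mul_nonneg (by positivity) (Finset.sum_nonneg fun i _ => sq_nonneg _))
    (hW.integrable_exp_sub (by linarith))
  have h3 := h1.const_mul (2 / c)
  have h4 : ∀ y : ℝ, 2 / c * (c / 2 * y) = y := fun y => by field_simp
  simp only [h4] at h3
  refine ⟨h3, ?_⟩
  have h5 := mul_le_mul_of_nonneg_left h2 (by positivity : 0 ≤ 2 / c)
  rwa [integral_const_mul, h4] at h5

lemma entropyFunctional_ge (hW : IsPotential W α c C) {f : Fin m → ℝ → ℝ}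
    (hf : IsAdmissible W f) :
    1 - ∫ x, Real.exp (c / 2 * ∑ i, x i ^ 2 - W x) ≤ entropyFunctional W f := by
  have hc := hW.c_pos
  have h := (hW.moment_le hf).2
  have h0 : 0 ≤ ∫ x, ∑ i, x i ^ 2 ∂(productMeasure f) :=
    integral_nonneg fun x => Finset.sum_nonneg fun i _ => sq_nonneg _
  have h1 := h0.trans h
  rw [mul_nonneg_iff_of_pos_left (by positivity)] at h1
  linarith

/-- The potential is integrable against products with finite second moment. -/
lemma integrable_of_moment (hW : IsPotential W α c C) {E : Type*} [MeasurableSpace E]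
    {μ : Measure E} [IsFiniteMeasure μ] {Φ : E → Fin m → ℝ} (hΦ : Measurable Φ)
    (h : Integrable (fun z => ∑ i, Φ z i ^ 2) μ) : Integrable (fun z => W (Φ z)) μ := by
  refine (((integrable_const 1).add h).const_mul (|W 0| + 2 * C)).mono'
    (hW.continuous.measurable.comp hΦ).aestronglyMeasurable (ae_of_all _ fun z => hW.abs_le _)

end IsPotential

end Functional

/-- Negative log-densities with quadratic growth and controlled local Lipschitz constants. -/
structure IsGibbs (c C : ℝ) (G : ℝ → ℝ) : Prop where
  lower : ∀ t, c * t ^ 2 - C ≤ G t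
  zero : |G 0| ≤ C
  lip : ∀ s t, |G s - G t| ≤ C * (1 + |s| + |t|) * |s - t|
  prob : ∫ t, Real.exp (-G t) = 1

section Gibbs

variable {c C : ℝ} {G : ℝ → ℝ}

lemma continuous_of_local_lipschitz (h : ∀ s t, |G s - G t| ≤ C * (1 + |s| + |t|) * |s - t|) :
    Continuous G := by
  rw [continuous_iff_continuousAt]
  intro x
  rw [ContinuousAt, tendsto_iff_norm_sub_tendsto_zero]
  have h' : Tendsto (fun y => C * (1 + |y| + |x|) * |y - x|) (𝓝 x)
      (𝓝 (C * (1 + |x| + |x|) * |x - x|)) := by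
    apply Continuous.tendsto
    fun_prop
  rw [sub_self, abs_zero, mul_zero] at h'
  exact squeeze_zero (fun _ => norm_nonneg _) (fun y => h y x) h'

lemma abs_le_of_local_lipschitz (hC : 0 ≤ C)
    (h : ∀ s t, |G s - G t| ≤ C * (1 + |s| + |t|) * |s - t|) (t : ℝ) :
    |G t| ≤ (|G 0| + 2 * C) * (1 + t ^ 2) := by
  have h1 := h t 0
  simp only [abs_zero, add_zero, sub_zero] at h1
  have h2 : (1 + |t|) * |t| ≤ 2 * (1 + t ^ 2) := by
    nlinarith [sq_nonneg (|t| - 1), sq_abs t]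
  have h3 := mul_le_mul_of_nonneg_left h2 hC
  have h4 : |G t| ≤ |G t - G 0| + |G 0| := by simpa using abs_add_le (G t - G 0) (G 0)
  have h5 : 0 ≤ |G 0| * t ^ 2 := by positivity
  linarith

namespace IsGibbs

lemma C_nonneg (hG : IsGibbs c C G) : 0 ≤ C := (abs_nonneg _).trans hG.zero

lemma continuous (hG : IsGibbs c C G) : Continuous G := continuous_of_local_lipschitz hG.lip

lemma abs_le (hG : IsGibbs c C G) (t : ℝ) : |G t| ≤ 3 * C * (1 + t ^ 2) := by
  refine (abs_le_of_local_lipschitz hG.C_nonneg hG.lip t).trans ?_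
  have := hG.zero
  exact mul_le_mul_of_nonneg_right (by linarith) (by positivity)

lemma isProbDensity (hG : IsGibbs c C G) : IsProbDensity fun t => Real.exp (-G t) :=
  isProbDensity_of_integral_eq_one (by have := hG.continuous; fun_prop)
    (fun _ => (Real.exp_pos _).le) hG.prob

lemma integrable_sq (hc : 0 < c) (hG : IsGibbs c C G) :
    Integrable (fun t => t ^ 2) (densityMeasure fun t => Real.exp (-G t)) := by
  have hcont := hG.continuous
  rw [integrable_densityMeasure_iff hG.isProbDensity.measurable hG.isProbDensity.nonneg]
  have h := (integrable_exp_neg_mul_sq (half_pos hc)).const_mul (2 / c * Real.exp C)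
  refine h.mono' (by fun_prop) (ae_of_all _ fun t => ?_)
  rw [Real.norm_of_nonneg (by positivity)]
  have h1 : Real.exp (-G t) ≤ Real.exp C * Real.exp (-(c / 2) * t ^ 2) *
      Real.exp (-(c / 2 * t ^ 2)) := by
    rw [← Real.exp_add, ← Real.exp_add, Real.exp_le_exp]
    linarith [hG.lower t]
  have h2 : t ^ 2 * Real.exp (-(c / 2 * t ^ 2)) ≤ 2 / c := by
    rw [Real.exp_neg, ← div_eq_mul_inv, div_le_iff₀ (Real.exp_pos _)]
    have h3 := mul_le_mul_of_nonneg_left (Real.add_one_le_exp (c / 2 * t ^ 2))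
      (by positivity : 0 ≤ 2 / c)
    have h4 : 2 / c * (c / 2 * t ^ 2 + 1) = t ^ 2 + 2 / c := by field_simp
    have : 0 < 2 / c := by positivity
    linarith
  have h5 := Real.exp_pos C
  have h6 := Real.exp_pos (-(c / 2) * t ^ 2)
  calc Real.exp (-G t) * t ^ 2
      ≤ (Real.exp C * Real.exp (-(c / 2) * t ^ 2) * Real.exp (-(c / 2 * t ^ 2))) * t ^ 2 :=
        mul_le_mul_of_nonneg_right h1 (sq_nonneg t)
    _ = (t ^ 2 * Real.exp (-(c / 2 * t ^ 2))) * (Real.exp C * Real.exp (-(c / 2) * t ^ 2)) := by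
        ring
    _ ≤ 2 / c * (Real.exp C * Real.exp (-(c / 2) * t ^ 2)) :=
        mul_le_mul_of_nonneg_right h2 (by positivity)
    _ = _ := by ring

lemma integrable (hc : 0 < c) (hG : IsGibbs c C G) :
    Integrable G (densityMeasure fun t => Real.exp (-G t)) := by
  have := hG.isProbDensity.prob
  exact (((integrable_const 1).add (hG.integrable_sq hc)).const_mul (3 * C)).mono'
    hG.continuous.measurable.aestronglyMeasurable (ae_of_all _ hG.abs_le)

end IsGibbs

/-- The Gibbs inequality together with its equality case. -/
lemma gibbs_inequality {f : ℝ → ℝ} (hf : IsProbDensity f)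
    (hG : IsProbDensity fun t => Real.exp (-G t))
    (hi : Integrable (fun t => Real.log (f t) + G t) (densityMeasure f)) :
    0 ≤ ∫ t, (Real.log (f t) + G t) ∂(densityMeasure f) ∧
      (∫ t, (Real.log (f t) + G t) ∂(densityMeasure f) = 0 →
        densityMeasure f = densityMeasure fun t => Real.exp (-G t)) := by
  have hi' := (integrable_densityMeasure_iff hf.measurable hf.nonneg _).1 hi
  rw [integral_densityMeasure hf.measurable hf.nonneg]
  have h_int : Integrable fun t => f t * (Real.log (f t) + G t) - f t + Real.exp (-G t) :=
    (hi'.sub hf.integrable).add hG.integrable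
  have hnn : ∀ t, 0 ≤ f t * (Real.log (f t) + G t) - f t + Real.exp (-G t) := fun t => by
    simpa using young_entropy (w := G t) (hf.nonneg t) 0
  have heq : ∫ t, f t * (Real.log (f t) + G t) =
      ∫ t, (f t * (Real.log (f t) + G t) - f t + Real.exp (-G t)) := by
    have h := integral_add (hi'.sub hf.integrable) hG.integrable
    simp only [Pi.sub_apply] at h
    rw [h, integral_sub hi' hf.integrable, hf.integral_eq_one, hG.integral_eq_one]
    ring
  rw [heq]
  refine ⟨integral_nonneg hnn, fun h0 => densityMeasure_congr ?_⟩
  rw [integral_eq_zero_iff_of_nonneg hnn h_int] at h0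
  filter_upwards [h0] with t ht
  exact eq_exp_neg_of_entropy_eq_zero (hf.nonneg t) ht

end Gibbs

section CoordinateUpdate

variable {m : ℕ} {W : (Fin m → ℝ) → ℝ} {α c C : ℝ}

/-- The potential averaged over all coordinates but the `i`-th. -/
def averagedPotential (W : (Fin m → ℝ) → ℝ) (f : Fin m → ℝ → ℝ) (i : Fin m) (t : ℝ) : ℝ :=
  ∫ x, W (Function.update x i t) ∂(productMeasure f)

lemma measurePreserving_update_productMeasure {f : Fin m → ℝ → ℝ}
    (hf : ∀ i, IsProbDensity (f i)) (i : Fin m) {g : ℝ → ℝ} (hg : IsProbDensity g) :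
    MeasurePreserving (fun z : (Fin m → ℝ) × ℝ => Function.update z.1 i z.2)
      ((productMeasure f).prod (densityMeasure g))
      (productMeasure (Function.update f i g)) := by
  have := fun i => (hf i).prob
  have := hg.prob
  have h := measurePreserving_update (μ := fun j => densityMeasure (f j)) i (densityMeasure g)
  have heq : productMeasure (Function.update f i g) =
      Measure.pi (Function.update (fun j => densityMeasure (f j)) i (densityMeasure g)) := by
    unfold productMeasure
    congr 1
    funext j
    by_cases hj : j = i
    · subst hj; simp
    · simp [hj]
  rw [heq]
  exact h

lemma isProbDensity_update {f : Fin m → ℝ → ℝ} (hf : ∀ i, IsProbDensity (f i)) (i : Fin m)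
    {g : ℝ → ℝ} (hg : IsProbDensity g) (j : Fin m) : IsProbDensity (Function.update f i g j) := by
  by_cases hj : j = i
  · subst hj; simpa
  · simpa [hj] using hf j

lemma sum_update_eq (φ : Fin m → ℝ → ℝ) (x : Fin m → ℝ) (i : Fin m) (t : ℝ) :
    ∑ j, φ j (Function.update x i t j) = ∑ j ∈ Finset.univ.erase i, φ j (x j) + φ i t := by
  rw [← Finset.sum_erase_add _ _ (Finset.mem_univ i), Function.update_self]
  congr 1
  exact Finset.sum_congr rfl fun j hj => by rw [Function.update_of_ne (Finset.ne_of_mem_erase hj)]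

lemma sum_sq_update_le (x : Fin m → ℝ) (i : Fin m) (t : ℝ) :
    ∑ j, Function.update x i t j ^ 2 ≤ ∑ j, x j ^ 2 + t ^ 2 := by
  rw [sum_update_eq (fun _ s => s ^ 2)]
  have := Finset.sum_le_sum_of_subset_of_nonneg (Finset.erase_subset i Finset.univ)
    (f := fun j => x j ^ 2) fun j _ _ => sq_nonneg _
  linarith

lemma measurable_update_prod (i : Fin m) :
    Measurable fun z : (Fin m → ℝ) × ℝ => Function.update z.1 i z.2 := by
  refine measurable_pi_lambda _ fun j => ?_
  by_cases hj : j = i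
  · subst hj; simpa using measurable_snd
  · simp only [Function.update_of_ne hj]
    fun_prop

lemma IsPotential.integrable_update (hW : IsPotential W α c C) {μ : Measure (Fin m → ℝ)}
    [IsProbabilityMeasure μ] {ν : Measure ℝ} [IsProbabilityMeasure ν]
    (hμ : Integrable (fun x => ∑ j, x j ^ 2) μ) (hν : Integrable (fun t => t ^ 2) ν) (i : Fin m) :
    Integrable (fun z : (Fin m → ℝ) × ℝ => W (Function.update z.1 i z.2)) (μ.prod ν) := by
  refine hW.integrable_of_moment (measurable_update_prod i) ?_
  have hm := measurable_update_prod i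
  refine ((hμ.comp_fst ν).add (hν.comp_snd μ)).mono' ?_ (ae_of_all _ fun z => ?_)
  · refine Measurable.aestronglyMeasurable (Finset.measurable_sum _ fun j _ => ?_)
    exact ((measurable_pi_apply j).comp hm).pow_const 2
  · rw [Real.norm_of_nonneg (Finset.sum_nonneg fun j _ => sq_nonneg _)]
    exact sum_sq_update_le _ _ _

/-- Relative entropy after replacing the `i`-th marginal. -/
lemma entropyFunctional_update (hW : IsPotential W α c C) {f : Fin m → ℝ → ℝ}
    (hf : ∀ i, IsProbDensity (f i))
    (hmom : Integrable (fun x => ∑ j, x j ^ 2) (productMeasure f)) (i : Fin m)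
    (hR : Integrable (fun x => ∑ j ∈ Finset.univ.erase i, Real.log (f j (x j))) (productMeasure f))
    {g : ℝ → ℝ} (hg : IsProbDensity g) (hlog : Integrable (fun t => Real.log (g t))
      (densityMeasure g))
    (hsq : Integrable (fun t => t ^ 2) (densityMeasure g)) :
    IsAdmissible W (Function.update f i g) ∧
    Integrable (averagedPotential W f i) (densityMeasure g) ∧
    entropyFunctional W (Function.update f i g) =
      ∫ x, ∑ j ∈ Finset.univ.erase i, Real.log (f j (x j)) ∂(productMeasure f) +
      ∫ t, Real.log (g t) ∂(densityMeasure g) +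
      ∫ t, averagedPotential W f i t ∂(densityMeasure g) := by
  have hμ := isProbabilityMeasure_productMeasure hf
  have hν := hg.prob
  have hmp := measurePreserving_update_productMeasure hf i hg
  have hWi := hW.integrable_update hmom hsq i
  have hsplit : ∀ z : (Fin m → ℝ) × ℝ,
      logRatio W (Function.update f i g) (Function.update z.1 i z.2) =
        ∑ j ∈ Finset.univ.erase i, Real.log (f j (z.1 j)) + Real.log (g z.2) +
          W (Function.update z.1 i z.2) := fun z => by
    rw [logRatio, sum_update_eq (fun j s => Real.log (Function.update f i g j s)),
      Function.update_self]
    congr 2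
    exact Finset.sum_congr rfl fun j hj => by
      rw [Function.update_of_ne (Finset.ne_of_mem_erase hj)]
  have h1 := hR.comp_fst (densityMeasure g)
  have h2 := hlog.comp_snd (productMeasure f)
  have h_int : Integrable (fun z : (Fin m → ℝ) × ℝ =>
      ∑ j ∈ Finset.univ.erase i, Real.log (f j (z.1 j)) + Real.log (g z.2) +
          W (Function.update z.1 i z.2)) ((productMeasure f).prod (densityMeasure g)) :=
    (h1.add h2).add hWi
  have hmeas : Measurable (logRatio W (Function.update f i g)) := by
    refine (Finset.measurable_sum _ fun j _ => ?_).add hW.continuous.measurable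
    exact ((isProbDensity_update hf i hg j).measurable.comp (measurable_pi_apply j)).log
  refine ⟨⟨isProbDensity_update hf i hg, ?_⟩, hWi.integral_prod_right, ?_⟩
  · rw [← hmp.map_eq, integrable_map_measure hmeas.aestronglyMeasurable hmp.measurable.aemeasurable]
    exact h_int.congr (ae_of_all _ fun z => (hsplit z).symm)
  · rw [entropyFunctional, ← hmp.map_eq,
      integral_map hmp.measurable.aemeasurable hmeas.aestronglyMeasurable]
    simp only [hsplit]
    have h3 := integral_add (h1.add h2) hWi
    simp only [Pi.add_apply] at h3
    rw [h3, integral_add h1 h2, integral_prod_symm _ hWi,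
      integral_fun_fst (μ := productMeasure f) (ν := densityMeasure g)
        (fun x => ∑ j ∈ Finset.univ.erase i, Real.log (f j (x j))),
      integral_fun_snd (μ := productMeasure f) (ν := densityMeasure g)
        (fun t => Real.log (g t))]
    simp [averagedPotential]

lemma IsAdmissible.integrable_log (hW : IsPotential W α c C) {f : Fin m → ℝ → ℝ}
    (hf : IsAdmissible W f) (i : Fin m) :
    Integrable (fun t => Real.log (f i t)) (densityMeasure (f i)) := by
  have hfi := hf.isProbDensity
  have hμ := isProbabilityMeasure_productMeasure hfi
  have hν := (hfi i).prob
  have hWi := hW.integrable_of_moment measurable_id (hW.moment_le hf).1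
  have hS : Integrable (fun x => ∑ j, Real.log (f j (x j))) (productMeasure f) :=
    (hf.integrable.sub hWi).congr (ae_of_all _ fun x => by simp [logRatio])
  have hmp := measurePreserving_update_productMeasure hfi i (hfi i)
  rw [Function.update_eq_self] at hmp
  have h := hmp.integrable_comp_of_integrable hS
  obtain ⟨x, hx⟩ := h.prod_right_ae.exists
  simp only [Function.comp_def, sum_update_eq (fun j s => Real.log (f j s))] at hx
  exact (hx.sub (integrable_const _)).congr (ae_of_all _ fun t => by
    simp only [Pi.sub_apply]; exact add_sub_cancel_left _ _)

lemma IsAdmissible.integrable_sq (hW : IsPotential W α c C) {f : Fin m → ℝ → ℝ}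
    (hf : IsAdmissible W f) (i : Fin m) :
    Integrable (fun t => t ^ 2) (densityMeasure (f i)) := by
  have hmp := measurePreserving_eval_productMeasure hf.isProbDensity i
  rw [← hmp.map_eq, integrable_map_measure (by fun_prop) hmp.measurable.aemeasurable]
  refine (hW.moment_le hf).1.mono'
    ((measurable_pi_apply i).pow_const 2).aestronglyMeasurable (ae_of_all _ fun x => ?_)
  rw [Function.comp_apply, Real.norm_of_nonneg (sq_nonneg _)]
  exact Finset.single_le_sum (f := fun i => x i ^ 2) (fun i _ => sq_nonneg _) (Finset.mem_univ i)

/-- Replacing one marginal by the Gibbs density of its averaged potential decreases the relative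
entropy, strictly unless the marginal already has that density. -/
lemma entropyFunctional_update_gibbs_le (hW : IsPotential W α c C) {f : Fin m → ℝ → ℝ}
    (hf : IsAdmissible W f) (i : Fin m) {D k : ℝ}
    (hG : IsGibbs c D fun t => averagedPotential W f i t + k) :
    IsAdmissible W
        (Function.update f i fun t => Real.exp (-(averagedPotential W f i t + k))) ∧
      entropyFunctional W
        (Function.update f i fun t => Real.exp (-(averagedPotential W f i t + k))) ≤
        entropyFunctional W f ∧
      (entropyFunctional W f ≤ entropyFunctional W
        (Function.update f i fun t => Real.exp (-(averagedPotential W f i t + k))) →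
        densityMeasure (f i) =
          densityMeasure fun t => Real.exp (-(averagedPotential W f i t + k))) := by
  have hfi := hf.isProbDensity
  have hmom := (hW.moment_le hf).1
  have hμ := isProbabilityMeasure_productMeasure hfi
  have hν := (hfi i).prob
  have hν' := hG.isProbDensity.prob
  have hR : Integrable (fun x => ∑ j ∈ Finset.univ.erase i, Real.log (f j (x j)))
      (productMeasure f) :=
    integrable_finsetSum _ fun j _ =>
      (measurePreserving_eval_productMeasure hfi j).integrable_comp_of_integrable
        (hf.integrable_log hW j)
  have hGi := hG.integrable hW.c_pos
  have hlogG : Integrable (fun t => Real.log (Real.exp (-(averagedPotential W f i t + k))))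
      (densityMeasure fun t => Real.exp (-(averagedPotential W f i t + k))) := by
    simp only [Real.log_exp]; exact hGi.neg
  obtain ⟨-, hF1, hE1⟩ := entropyFunctional_update hW hfi hmom i hR (hfi i)
    (hf.integrable_log hW i) (hf.integrable_sq hW i)
  obtain ⟨hadm, hF2, hE2⟩ := entropyFunctional_update hW hfi hmom i hR hG.isProbDensity
    hlogG (hG.integrable_sq hW.c_pos)
  rw [Function.update_eq_self] at hE1
  simp only [Real.log_exp] at hE2
  rw [integral_neg, integral_add hF2 (integrable_const _), integral_const] at hE2
  simp only [probReal_univ, one_smul] at hE2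
  have hlf := hf.integrable_log hW i
  have h_int : Integrable (fun t => Real.log (f i t) + (averagedPotential W f i t + k))
      (densityMeasure (f i)) := hlf.add (hF1.add (integrable_const _))
  have hval : ∫ t, (Real.log (f i t) + (averagedPotential W f i t + k)) ∂(densityMeasure (f i)) =
      ∫ t, Real.log (f i t) ∂(densityMeasure (f i)) +
        (∫ t, averagedPotential W f i t ∂(densityMeasure (f i)) + k) := by
    have h := integral_add hlf (hF1.add (integrable_const k))
    simp only [Pi.add_apply] at h
    rw [h, integral_add hF1 (integrable_const _), integral_const]
    simp
  obtain ⟨h0, heq⟩ := gibbs_inequality (hfi i) hG.isProbDensity h_int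
  rw [hval] at h0 heq
  exact ⟨hadm, by linarith, fun h => heq (by linarith)⟩

/-- Averaged potentials are uniformly regular on sublevel sets of the relative entropy. -/
lemma exists_isGibbs_averagedPotential (hW : IsPotential W α c C) (B : ℝ) :
    ∃ D, ∀ f, IsAdmissible W f → entropyFunctional W f ≤ B → ∀ i,
      ∃ k, IsGibbs c D fun t => averagedPotential W f i t + k := by
  have hc := hW.c_pos
  have hC := hW.C_nonneg
  set M := |2 / c * (B - 1 + ∫ x, Real.exp (c / 2 * ∑ i, x i ^ 2 - W x))| with hM
  have hM0 : 0 ≤ M := abs_nonneg _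
  set C₁ := C * (3 + 2 * M) with hC₁
  have hC₁0 : 0 ≤ C₁ := by positivity
  set K := (|W 0| + 2 * C) * (1 + M) with hK
  have hK0 : 0 ≤ K := by positivity
  set hi := ∫ t : ℝ, Real.exp (-(c * t ^ 2 - C)) with hhi
  have hlo_int : Integrable fun t : ℝ => Real.exp (-((K + 2 * C₁ + 1) * (1 + t ^ 2))) := by
    have h := (integrable_exp_neg_mul_sq (by positivity : 0 < K + 2 * C₁ + 1)).const_mul
      (Real.exp (-(K + 2 * C₁ + 1)))
    refine h.congr (ae_of_all _ fun t => ?_)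
    simp only
    rw [← Real.exp_add]; ring_nf
  set lo := ∫ t : ℝ, Real.exp (-((K + 2 * C₁ + 1) * (1 + t ^ 2))) with hlo
  have hhi_int : Integrable fun t : ℝ => Real.exp (-(c * t ^ 2 - C)) := by
    refine ((integrable_exp_neg_mul_sq hc).const_mul (Real.exp C)).congr (ae_of_all _ fun t => ?_)
    simp only
    rw [← Real.exp_add]; ring_nf
  have hlo0 : 0 < lo := integral_exp_pos hlo_int
  set N₀ := |Real.log lo| + |Real.log hi| with hN₀
  have hN₀0 : 0 ≤ N₀ := by positivity
  refine ⟨C + K + C₁ + N₀, fun f hf hB i => ?_⟩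
  have hfi := hf.isProbDensity
  have hμ := isProbabilityMeasure_productMeasure hfi
  obtain ⟨hmom, hle⟩ := hW.moment_le hf
  have hMle : ∫ x, ∑ j, x j ^ 2 ∂(productMeasure f) ≤ M := by
    refine (hle.trans ?_).trans (le_abs_self _)
    exact mul_le_mul_of_nonneg_left (by linarith) (by positivity)
  have hupd : ∀ t, Integrable (fun x => W (Function.update x i t)) (productMeasure f) := by
    intro t
    have hm : Measurable fun x : Fin m → ℝ => Function.update x i t :=
      (measurable_update_prod i).comp (by fun_prop : Measurable fun x : Fin m → ℝ => (x, t))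
    refine hW.integrable_of_moment hm ?_
    refine (hmom.add (integrable_const (t ^ 2))).mono' ?_ (ae_of_all _ fun x => ?_)
    · exact (Finset.measurable_sum _ fun j _ =>
        ((measurable_pi_apply j).comp hm).pow_const 2).aestronglyMeasurable
    · rw [Real.norm_of_nonneg (Finset.sum_nonneg fun j _ => sq_nonneg _)]
      exact sum_sq_update_le _ _ _
  set F := averagedPotential W f i with hF
  have hlower : ∀ t, c * t ^ 2 - C ≤ F t := by
    intro t
    have h : ∀ x : Fin m → ℝ, c * t ^ 2 - C ≤ W (Function.update x i t) := fun x => by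
      have h1 := Finset.single_le_sum (f := fun j => Function.update x i t j ^ 2)
        (fun j _ => sq_nonneg _) (Finset.mem_univ i)
      simp only [Function.update_self] at h1
      have h2 := mul_le_mul_of_nonneg_left h1 hc.le
      linarith [hW.lower (Function.update x i t)]
    have := integral_mono (μ := productMeasure f) (integrable_const _) (hupd t) h
    simp only [integral_const, probReal_univ, one_smul] at this
    exact this
  have hlip : ∀ s t, |F s - F t| ≤ C₁ * (1 + |s| + |t|) * |s - t| := by
    intro s t
    have hnorm : ∀ (x : Fin m → ℝ) (r : ℝ), ‖Function.update x i r‖ ≤ ‖x‖ + |r| := by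
      intro x r
      rw [pi_norm_le_iff_of_nonneg (by positivity)]
      intro j
      by_cases hj : j = i
      · subst hj; simp
      · simp only [Function.update_of_ne hj]
        linarith [norm_le_pi_norm x j, abs_nonneg r]
    have hdiff : ∀ x : Fin m → ℝ,
        ‖Function.update x i s - Function.update x i t‖ ≤ |s - t| := by
      intro x
      rw [pi_norm_le_iff_of_nonneg (abs_nonneg _)]
      intro j
      by_cases hj : j = i
      · subst hj; simp
      · simp [Function.update_of_ne hj]
    have hpt : ∀ x : Fin m → ℝ, ‖W (Function.update x i s) - W (Function.update x i t)‖ ≤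
        C * (3 + 2 * ∑ j, x j ^ 2 + |s| + |t|) * |s - t| := by
      intro x
      refine (hW.lip _ _).trans ?_
      have h1 := hnorm x s
      have h2 := hnorm x t
      have h3 := norm_le_one_add_sum_sq x
      have h4 : 0 ≤ ∑ j, x j ^ 2 := Finset.sum_nonneg fun j _ => sq_nonneg _
      refine mul_le_mul (mul_le_mul_of_nonneg_left (by linarith) hC) (hdiff x) (norm_nonneg _) ?_
      positivity
    have hbd : Integrable (fun x => C * (3 + 2 * ∑ j, x j ^ 2 + |s| + |t|) * |s - t|)
        (productMeasure f) :=
      ((((((integrable_const 3).add (hmom.const_mul 2)).add (integrable_const |s|)).add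
        (integrable_const |t|))).const_mul C).mul_const |s - t|
    have h := norm_integral_le_of_norm_le hbd (ae_of_all _ hpt)
    rw [integral_sub (hupd s) (hupd t)] at h
    refine h.trans ?_
    rw [integral_mul_const, integral_const_mul]
    have hv : ∫ x, (3 + 2 * ∑ j, x j ^ 2 + |s| + |t|) ∂(productMeasure f) =
        3 + 2 * ∫ x, ∑ j, x j ^ 2 ∂(productMeasure f) + |s| + |t| := by
      have e1 := (integrable_const (3 : ℝ)).add (hmom.const_mul 2)
      have e2 := integral_add (e1.add (integrable_const |s|)) (integrable_const |t|)
      have e3 := integral_add e1 (integrable_const |s|)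
      have e4 := integral_add (integrable_const (μ := productMeasure f) (3 : ℝ)) (hmom.const_mul 2)
      simp only [Pi.add_apply] at e2 e3 e4
      rw [e2, e3, e4, integral_const_mul]
      simp
    rw [hv]
    refine mul_le_mul_of_nonneg_right ?_ (abs_nonneg _)
    rw [hC₁, mul_assoc]
    refine mul_le_mul_of_nonneg_left ?_ hC
    have h5 := abs_nonneg s
    have h6 := abs_nonneg t
    nlinarith [mul_nonneg hM0 h5, mul_nonneg hM0 h6]
  have hF0 : |F 0| ≤ K := by
    have h := norm_integral_le_of_norm_le
      (((integrable_const 1).add hmom).const_mul (|W 0| + 2 * C))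
      (f := fun x => W (Function.update x i 0)) (ae_of_all (productMeasure f) fun x => by
        refine (hW.abs_le _).trans (mul_le_mul_of_nonneg_left ?_ (by positivity))
        have := sum_sq_update_le x i 0
        simp only [Pi.add_apply]
        linarith)
    refine h.trans ?_
    have e := integral_add (integrable_const (μ := productMeasure f) (1 : ℝ)) hmom
    rw [integral_const_mul]
    simp only [Pi.add_apply] at e ⊢
    rw [e]
    refine mul_le_mul_of_nonneg_left ?_ (by positivity)
    simpa using hMle
  have hFabs := abs_le_of_local_lipschitz hC₁0 hlip
  have hFc : Continuous F := continuous_of_local_lipschitz hlip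
  have hexp_int : Integrable fun t => Real.exp (-F t) := by
    refine hhi_int.mono' (by fun_prop) (ae_of_all _ fun t => ?_)
    rw [Real.norm_of_nonneg (Real.exp_pos _).le, Real.exp_le_exp]
    linarith [hlower t]
  set N := ∫ t, Real.exp (-F t) with hN
  have hN0 : 0 < N := integral_exp_pos hexp_int
  have hNhi : N ≤ hi := integral_mono hexp_int hhi_int fun t => by
    simp only [Real.exp_le_exp]
    linarith [hlower t]
  have hNlo : lo ≤ N := integral_mono hlo_int hexp_int fun t => by
    simp only [Real.exp_le_exp]
    have h1 := (le_abs_self _).trans (hFabs t)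
    have h2 : (|F 0| + 2 * C₁) * (1 + t ^ 2) ≤ (K + 2 * C₁ + 1) * (1 + t ^ 2) :=
      mul_le_mul_of_nonneg_right (by linarith) (by positivity)
    linarith
  have hlogN : |Real.log N| ≤ N₀ := by
    have h1 := Real.log_le_log hlo0 hNlo
    have h2 := Real.log_le_log hN0 hNhi
    have h3 := neg_abs_le (Real.log lo)
    have h4 := le_abs_self (Real.log hi)
    have h5 := abs_nonneg (Real.log lo)
    have h6 := abs_nonneg (Real.log hi)
    rw [abs_le]
    constructor <;> linarith
  refine ⟨Real.log N, fun t => ?_, ?_, fun s t => ?_, ?_⟩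
  · have := neg_abs_le (Real.log N)
    linarith [hlower t]
  · refine (abs_add_le _ _).trans ?_
    linarith
  · rw [add_sub_add_right_eq_sub]
    refine (hlip s t).trans (mul_le_mul_of_nonneg_right ?_ (abs_nonneg _))
    exact mul_le_mul_of_nonneg_right (by linarith) (by positivity)
  · have h : ∀ t, Real.exp (-(F t + Real.log N)) = Real.exp (-F t) / N := fun t => by
      rw [neg_add, Real.exp_add, Real.exp_neg (Real.log N), Real.exp_log hN0, div_eq_mul_inv]
    simp only [h]
    rw [integral_div, div_self hN0.ne']

end CoordinateUpdate

section Existence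

variable {m : ℕ} {W : (Fin m → ℝ) → ℝ} {α c C D : ℝ} {G : Fin m → ℝ → ℝ}

lemma gibbs_entropy_density_bound (hW : IsPotential W α c C) (hG : ∀ i, IsGibbs c D (G i))
    (hD : 0 ≤ D) (x : Fin m → ℝ) :
    ‖(∏ i, Real.exp (-G i (x i))) * logRatio W (fun i t => Real.exp (-G i t)) x‖ ≤
      (|W 0| + 2 * C + 3 * D * (m + 1)) * (1 + 2 / c) *
        Real.exp (m * D - c / 2 * ∑ i, x i ^ 2) := by
  have hc := hW.c_pos
  have hC := hW.C_nonneg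
  set S := ∑ i, x i ^ 2 with hS
  have hS0 : 0 ≤ S := Finset.sum_nonneg fun i _ => sq_nonneg _
  have h1 : |logRatio W (fun i t => Real.exp (-G i t)) x| ≤
      (|W 0| + 2 * C + 3 * D * (m + 1)) * (1 + S) := by
    simp only [logRatio, Real.log_exp]
    refine (abs_add_le _ _).trans ?_
    have h2 : |∑ i, -G i (x i)| ≤ ∑ i, 3 * D * (1 + x i ^ 2) :=
      (Finset.abs_sum_le_sum_abs _ _).trans (Finset.sum_le_sum fun i _ => by
        rw [abs_neg]; exact (hG i).abs_le _)
    rw [← Finset.mul_sum, Finset.sum_add_distrib] at h2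
    simp only [Finset.sum_const, Finset.card_univ, Fintype.card_fin, nsmul_eq_mul, mul_one] at h2
    have h3 := hW.abs_le x
    have h4 : 3 * D * (m + S) ≤ 3 * D * (m + 1) * (1 + S) := by
      have : (m : ℝ) + S ≤ (m + 1) * (1 + S) := by nlinarith [Nat.cast_nonneg (α := ℝ) m]
      rw [mul_assoc (3 * D)]
      exact mul_le_mul_of_nonneg_left this (by positivity)
    linarith
  have h5 : ∏ i, Real.exp (-G i (x i)) ≤ Real.exp (m * D - c * S) := by
    rw [← Real.exp_sum, Real.exp_le_exp]
    refine (Finset.sum_le_sum fun i _ => neg_le_neg ((hG i).lower (x i))).trans_eq ?_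
    simp only [neg_sub, Finset.sum_sub_distrib, ← Finset.mul_sum, hS]
    simp
  have h6 : 1 + S ≤ (1 + 2 / c) * Real.exp (c / 2 * S) := by
    have h := mul_le_mul_of_nonneg_left (Real.add_one_le_exp (c / 2 * S))
      (by positivity : 0 ≤ 1 + 2 / c)
    have h' : (1 + 2 / c) * (c / 2 * S + 1) = 1 + S + (c / 2 * S + 2 / c) := by field_simp; ring
    have : 0 ≤ c / 2 * S + 2 / c := by positivity
    linarith
  have h7 : Real.exp (m * D - c / 2 * S) = Real.exp (m * D - c * S) * Real.exp (c / 2 * S) := by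
    rw [← Real.exp_add]; ring_nf
  have h8 : 0 ≤ |W 0| + 2 * C + 3 * D * (m + 1) := by positivity
  rw [norm_mul, Real.norm_of_nonneg (Finset.prod_nonneg fun i _ => (Real.exp_pos _).le), h7]
  calc _ ≤ Real.exp (m * D - c * S) * ((|W 0| + 2 * C + 3 * D * (m + 1)) *
        ((1 + 2 / c) * Real.exp (c / 2 * S))) :=
        mul_le_mul h5 (h1.trans (mul_le_mul_of_nonneg_left h6 h8)) (abs_nonneg _)
          (Real.exp_pos _).le
    _ = _ := by ring

lemma continuous_logRatio_gibbs (hW : IsPotential W α c C) (hG : ∀ i, IsGibbs c D (G i)) :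
    Continuous (logRatio W fun i t => Real.exp (-G i t)) := by
  have hWc := hW.continuous
  unfold logRatio
  simp only [Real.log_exp]
  exact (continuous_finsetSum _ fun i _ =>
    ((hG i).continuous.comp (continuous_apply i)).neg).add hWc

lemma isProbDensity_prod_gibbs (hG : ∀ i, IsGibbs c D (G i)) :
    productMeasure (fun i t => Real.exp (-G i t)) =
        densityMeasure (fun x => ∏ i, Real.exp (-G i (x i))) ∧
      IsProbDensity fun x : Fin m → ℝ => ∏ i, Real.exp (-G i (x i)) :=
  isProbDensity_pi fun i => (hG i).isProbDensity

lemma isAdmissible_gibbs (hW : IsPotential W α c C) (hD : 0 ≤ D) (hG : ∀ i, IsGibbs c D (G i)) :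
    IsAdmissible W fun i t => Real.exp (-G i t) := by
  have hc := hW.c_pos
  refine ⟨fun i => (hG i).isProbDensity, ?_⟩
  obtain ⟨h1, h2⟩ := isProbDensity_prod_gibbs hG
  rw [h1, integrable_densityMeasure_iff h2.measurable h2.nonneg]
  refine ((integrable_exp_sub_sum_sq (half_pos hc) (m * D)).const_mul _).mono'
    (h2.measurable.mul (continuous_logRatio_gibbs hW hG).measurable).aestronglyMeasurable
    (ae_of_all _ fun x => gibbs_entropy_density_bound hW hG hD x)

/-- The relative entropy is continuous along pointwise convergent Gibbs families. -/
lemma tendsto_entropyFunctional_gibbs (hW : IsPotential W α c C) (hD : 0 ≤ D)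
    {Gn : ℕ → Fin m → ℝ → ℝ} (hGn : ∀ n i, IsGibbs c D (Gn n i)) (hG : ∀ i, IsGibbs c D (G i))
    (hlim : ∀ i t, Tendsto (fun n => Gn n i t) atTop (𝓝 (G i t))) :
    Tendsto (fun n => entropyFunctional W fun i t => Real.exp (-Gn n i t)) atTop
      (𝓝 (entropyFunctional W fun i t => Real.exp (-G i t))) := by
  have hc := hW.c_pos
  have key : ∀ {H : Fin m → ℝ → ℝ}, (∀ i, IsGibbs c D (H i)) →
      entropyFunctional W (fun i t => Real.exp (-H i t)) =
        ∫ x, (∏ i, Real.exp (-H i (x i))) * logRatio W (fun i t => Real.exp (-H i t)) x := by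
    intro H hH
    obtain ⟨h1, h2⟩ := isProbDensity_prod_gibbs hH
    rw [entropyFunctional, h1, integral_densityMeasure h2.measurable h2.nonneg]
  rw [key hG]
  simp only [fun n => key (hGn n)]
  refine tendsto_integral_of_dominated_convergence _ (fun n => ?_)
    ((integrable_exp_sub_sum_sq (half_pos hc) (m * D)).const_mul _)
    (fun n => ae_of_all _ fun x => gibbs_entropy_density_bound hW (hGn n) hD x)
    (ae_of_all _ fun x => ?_)
  · exact ((isProbDensity_prod_gibbs (hGn n)).2.measurable.mul
      (continuous_logRatio_gibbs hW (hGn n)).measurable).aestronglyMeasurable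
  · simp only [logRatio, Real.log_exp]
    refine (tendsto_finsetProd _ fun i _ => ?_).mul ((tendsto_finsetSum _ fun i _ =>
      (hlim i _).neg).add_const _)
    exact (Real.continuous_exp.tendsto _).comp (hlim i _).neg

lemma IsGibbs.of_tendsto (hc : 0 < c) {Gn : ℕ → ℝ → ℝ} {H : ℝ → ℝ}
    (hGn : ∀ n, IsGibbs c D (Gn n)) (hlim : ∀ t, Tendsto (fun n => Gn n t) atTop (𝓝 (H t))) :
    IsGibbs c D H where
  lower t := ge_of_tendsto' (hlim t) fun n => (hGn n).lower t
  zero := le_of_tendsto' (hlim 0).abs fun n => (hGn n).zero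
  lip s t := le_of_tendsto' ((hlim s).sub (hlim t)).abs fun n => (hGn n).lip s t
  prob := by
    have hb : Integrable fun t : ℝ => Real.exp D * Real.exp (-c * t ^ 2) :=
      (integrable_exp_neg_mul_sq hc).const_mul _
    have h := tendsto_integral_of_dominated_convergence
      (F := fun n t => Real.exp (-Gn n t)) (f := fun t => Real.exp (-H t)) _
      (fun n => (hGn n).isProbDensity.measurable.aestronglyMeasurable) hb
      (fun n => ae_of_all _ fun t => by
        rw [Real.norm_of_nonneg (Real.exp_pos _).le, ← Real.exp_add, Real.exp_le_exp]
        linarith [(hGn n).lower t])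
      (ae_of_all _ fun t => (Real.continuous_exp.tendsto _).comp (hlim t).neg)
    simp only [(hGn _).prob] at h
    exact (tendsto_nhds_unique h tendsto_const_nhds)

/-- Sequential compactness of Gibbs families for pointwise convergence. -/
lemma exists_subseq_tendsto_gibbs (hc : 0 < c) {Gn : ℕ → Fin m → ℝ → ℝ}
    (hGn : ∀ n i, IsGibbs c D (Gn n i)) :
    ∃ (H : Fin m → ℝ → ℝ) (φ : ℕ → ℕ), StrictMono φ ∧ (∀ i, IsGibbs c D (H i)) ∧
      ∀ i t, Tendsto (fun n => Gn (φ n) i t) atTop (𝓝 (H i t)) := by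
  have hK : IsCompact (Set.univ.pi fun p : Fin m × ℚ =>
      Set.Icc (-(3 * D * (1 + (p.2 : ℝ) ^ 2))) (3 * D * (1 + (p.2 : ℝ) ^ 2))) :=
    isCompact_univ_pi fun _ => isCompact_Icc
  obtain ⟨g, -, φ, hφ, hg⟩ := hK.tendsto_subseq
    (x := fun n p => Gn n p.1 p.2) fun n p _ => abs_le.1 ((hGn n p.1).abs_le p.2)
  rw [tendsto_pi_nhds] at hg
  have hlim : ∀ i t, ∃ l, Tendsto (fun n => Gn (φ n) i t) atTop (𝓝 l) := by
    intro i t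
    refine cauchySeq_tendsto_of_complete ?_
    rw [Metric.cauchySeq_iff']
    intro ε hε
    have hcont : Continuous fun s : ℝ => D * (1 + |t| + |s|) * |t - s| := by fun_prop
    have hopen : IsOpen {s : ℝ | D * (1 + |t| + |s|) * |t - s| < ε / 3} :=
      isOpen_lt hcont continuous_const
    obtain ⟨q, hq⟩ := Rat.denseRange_cast.exists_mem_open hopen ⟨t, by simpa using hε⟩
    have hcau := (hg (i, q)).cauchySeq
    rw [Metric.cauchySeq_iff'] at hcau
    obtain ⟨N, hN⟩ := hcau (ε / 3) (by linarith)
    refine ⟨N, fun n hn => ?_⟩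
    have h1 := hN n hn
    simp only [Function.comp_apply, Real.dist_eq] at h1 ⊢
    have h2 := ((hGn (φ n) i).lip t q).trans_lt hq
    have h3 := ((hGn (φ N) i).lip t q).trans_lt hq
    rw [abs_lt] at h1 h2 h3 ⊢
    constructor <;> linarith
  choose H hH using hlim
  exact ⟨H, φ, hφ, fun i => IsGibbs.of_tendsto hc (fun n => hGn (φ n) i) (hH i), hH⟩

lemma exists_isGibbs (hc : 0 < c) : ∃ D G, IsGibbs c D G := by
  have h_int := integrable_exp_neg_mul_sq hc
  set N := ∫ t : ℝ, Real.exp (-c * t ^ 2) with hN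
  have hN0 : 0 < N := integral_exp_pos h_int
  refine ⟨c + |Real.log N|, fun t => c * t ^ 2 + Real.log N, fun t => ?_, ?_, fun s t => ?_, ?_⟩
  · linarith [neg_abs_le (Real.log N)]
  · simp [hc.le]
  · have h : c * s ^ 2 + Real.log N - (c * t ^ 2 + Real.log N) = c * (s + t) * (s - t) := by ring
    rw [h, abs_mul, abs_mul, abs_of_pos hc]
    refine mul_le_mul_of_nonneg_right ?_ (abs_nonneg _)
    have h1 := abs_add_le s t
    exact mul_le_mul (by linarith [abs_nonneg (Real.log N)]) (by linarith) (abs_nonneg _)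
      (by positivity)
  · have h : ∀ t : ℝ, Real.exp (-(c * t ^ 2 + Real.log N)) = Real.exp (-c * t ^ 2) / N := fun t => by
      rw [neg_add, Real.exp_add, Real.exp_neg (Real.log N), Real.exp_log hN0, div_eq_mul_inv,
        neg_mul]
    simp only [h]
    rw [integral_div, div_self hN0.ne']

/-- One sweep of coordinate updates turns an admissible family into a Gibbs family, without
increasing the relative entropy. -/
lemma exists_gibbs_entropyFunctional_le (hW : IsPotential W α c C) (B : ℝ) :
    ∃ D, ∀ f, IsAdmissible W f → entropyFunctional W f ≤ B →
      ∃ G : Fin m → ℝ → ℝ, (∀ i, IsGibbs c D (G i)) ∧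
        entropyFunctional W (fun i t => Real.exp (-G i t)) ≤ entropyFunctional W f := by
  obtain ⟨D, hD⟩ := exists_isGibbs_averagedPotential hW B
  refine ⟨D, fun f hf hB => ?_⟩
  have key : ∀ s : Finset (Fin m), ∃ f', IsAdmissible W f' ∧
      entropyFunctional W f' ≤ entropyFunctional W f ∧
      ∀ i ∈ s, ∃ G, IsGibbs c D G ∧ f' i = fun t => Real.exp (-G t) := by
    intro s
    induction s using Finset.induction_on with
    | empty => exact ⟨f, hf, le_rfl, by simp⟩
    | insert i s _ ih =>
      obtain ⟨f', hf', hle, hs⟩ := ih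
      obtain ⟨k, hk⟩ := hD f' hf' (hle.trans hB) i
      obtain ⟨h1, h2, -⟩ := entropyFunctional_update_gibbs_le hW hf' i hk
      refine ⟨_, h1, h2.trans hle, fun j hj => ?_⟩
      by_cases hji : j = i
      · subst hji
        exact ⟨_, hk, by rw [Function.update_self]⟩
      · obtain ⟨G, hG, hfG⟩ := hs j ((Finset.mem_insert.1 hj).resolve_left hji)
        exact ⟨G, hG, by rw [Function.update_of_ne hji, hfG]⟩
  obtain ⟨f', hf', hle, h⟩ := key Finset.univ
  choose G hG hfG using fun i => h i (Finset.mem_univ i)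
  have : f' = fun i t => Real.exp (-G i t) := funext hfG
  exact ⟨G, hG, this ▸ hle⟩

/-- The relative entropy attains its minimum among admissible families. -/
lemma exists_minimizer (hW : IsPotential W α c C) :
    ∃ f, IsAdmissible W f ∧ ∀ f', IsAdmissible W f' →
      entropyFunctional W f ≤ entropyFunctional W f' := by
  have hc := hW.c_pos
  obtain ⟨D₀, G₀, hG₀⟩ := exists_isGibbs hc
  have hadm₀ := isAdmissible_gibbs (m := m) (G := fun _ => G₀) hW hG₀.C_nonneg fun _ => hG₀
  set f₀ : Fin m → ℝ → ℝ := fun _ t => Real.exp (-G₀ t) with hf₀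
  obtain ⟨D', hD'⟩ := exists_gibbs_entropyFunctional_le hW (entropyFunctional W f₀)
  set D := max D' 0 with hDdef
  have hD : 0 ≤ D := le_max_right _ _
  have hsweep : ∀ f, IsAdmissible W f → entropyFunctional W f ≤ entropyFunctional W f₀ →
      ∃ G : Fin m → ℝ → ℝ, (∀ i, IsGibbs c D (G i)) ∧
        entropyFunctional W (fun i t => Real.exp (-G i t)) ≤ entropyFunctional W f := by
    intro f hf hle
    obtain ⟨G, hG, h⟩ := hD' f hf hle
    have hDD : ∀ i : Fin m, D = D' := fun i => max_eq_left (hG i).C_nonneg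
    exact ⟨G, fun i => hDD i ▸ hG i, h⟩
  set A := {r | ∃ G : Fin m → ℝ → ℝ, (∀ i, IsGibbs c D (G i)) ∧
    entropyFunctional W (fun i t => Real.exp (-G i t)) = r} with hA
  obtain ⟨G₁, hG₁, hle₁⟩ := hsweep f₀ hadm₀ le_rfl
  have hne : A.Nonempty := ⟨_, G₁, hG₁, rfl⟩
  have hbdd : BddBelow A := ⟨_, by
    rintro r ⟨G, hG, rfl⟩
    exact hW.entropyFunctional_ge (isAdmissible_gibbs hW hD hG)⟩
  obtain ⟨u, -, hu, huA⟩ := exists_seq_tendsto_sInf hne hbdd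
  choose Gn hGn hun using huA
  obtain ⟨H, φ, hφ, hH, hlim⟩ := exists_subseq_tendsto_gibbs hc hGn
  have hval : entropyFunctional W (fun i t => Real.exp (-H i t)) = sInf A := by
    refine tendsto_nhds_unique
      (tendsto_entropyFunctional_gibbs hW hD (fun n => hGn (φ n)) hH hlim) ?_
    simp only [hun]
    exact hu.comp hφ.tendsto_atTop
  have hmin : ∀ f', IsAdmissible W f' → entropyFunctional W f' ≤ entropyFunctional W f₀ →
      sInf A ≤ entropyFunctional W f' := fun f' hf' hle => by
    obtain ⟨G, hG, h⟩ := hsweep f' hf' hle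
    exact (csInf_le hbdd ⟨G, hG, rfl⟩).trans h
  refine ⟨_, isAdmissible_gibbs hW hD hH, fun f' hf' => ?_⟩
  rw [hval]
  rcases le_total (entropyFunctional W f') (entropyFunctional W f₀) with hle | hle
  · exact hmin f' hf' hle
  · exact (hmin f₀ hadm₀ le_rfl).trans hle

end Existence

section Uniqueness

variable {m : ℕ} {W : (Fin m → ℝ) → ℝ} {α c C : ℝ}

lemma measurable_logRatio (hW : Measurable W) {f : Fin m → ℝ → ℝ}
    (hf : ∀ i, IsProbDensity (f i)) : Measurable (logRatio W f) :=
  (Finset.measurable_sum _ fun i _ =>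
    ((hf i).measurable.comp (measurable_pi_apply i)).log).add hW

lemma entropyFunctional_congr (hW : Measurable W) {f g : Fin m → ℝ → ℝ}
    (hf : IsAdmissible W f) (hg : IsAdmissible W g)
    (h : productMeasure f = productMeasure g) :
    entropyFunctional W f = entropyFunctional W g := by
  have h1 := (KL_productMeasure hf.isProbDensity hW).1 hf.integrable
  have h2 := (KL_productMeasure hg.isProbDensity hW).1 hg.integrable
  rw [h, h2] at h1
  exact (EReal.coe_injective h1).symm

/-- Marginals of minimizers are Gibbs measures. -/
lemma exists_gibbs_of_minimizer (hW : IsPotential W α c C) {f : Fin m → ℝ → ℝ}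
    (hf : IsAdmissible W f)
    (hmin : ∀ f', IsAdmissible W f' → entropyFunctional W f ≤ entropyFunctional W f') :
    ∃ a : Fin m → ℝ → ℝ, IsAdmissible W a ∧ (∀ i, Continuous (a i)) ∧ (∀ i t, 0 < a i t) ∧
      productMeasure f = productMeasure a ∧ entropyFunctional W f = entropyFunctional W a := by
  obtain ⟨D', hD'⟩ := exists_isGibbs_averagedPotential hW (entropyFunctional W f)
  choose k hk using hD' f hf le_rfl
  have hDD : ∀ i : Fin m, max D' 0 = D' := fun i => max_eq_left (hk i).C_nonneg
  have hk' : ∀ i, IsGibbs c (max D' 0) fun t => averagedPotential W f i t + k i :=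
    fun i => (hDD i).symm ▸ hk i
  have hadm := isAdmissible_gibbs hW (le_max_right _ _) hk'
  have hprod : productMeasure f =
      productMeasure fun i t => Real.exp (-(averagedPotential W f i t + k i)) := by
    unfold productMeasure
    congr 1
    funext i
    obtain ⟨h1, -, h3⟩ := entropyFunctional_update_gibbs_le hW hf i (hk i)
    exact h3 (hmin _ h1)
  exact ⟨_, hadm, fun i => Real.continuous_exp.comp (hk i).continuous.neg,
    fun i t => Real.exp_pos _, hprod,
    entropyFunctional_congr hW.continuous.measurable hf hadm hprod⟩

lemma productMeasure_map {a b T : Fin m → ℝ → ℝ} (ha : ∀ i, IsProbDensity (a i))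
    (hb : ∀ i, IsProbDensity (b i)) (hT : ∀ i, Measurable (T i))
    (h : ∀ i, (densityMeasure (a i)).map (T i) = densityMeasure (b i)) :
    (productMeasure a).map (fun x i => T i (x i)) = productMeasure b := by
  have := fun i => (ha i).prob
  have := fun i => (hb i).prob
  have : ∀ i, IsProbabilityMeasure ((densityMeasure (a i)).map (T i)) := fun i => by
    rw [h i]; infer_instance
  unfold productMeasure
  rw [Measure.pi_map_pi fun i => (hT i).aemeasurable]
  simp only [h]

/-- Two positive continuous minimizers coincide, by displacement convexity. -/
lemma productMeasure_eq_of_minimizers (hW : IsPotential W α c C) {a b : Fin m → ℝ → ℝ}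
    (ha : IsAdmissible W a) (hb : IsAdmissible W b)
    (hac : ∀ i, Continuous (a i)) (hbc : ∀ i, Continuous (b i))
    (ha0 : ∀ i t, 0 < a i t) (hb0 : ∀ i t, 0 < b i t)
    (hmina : ∀ f, IsAdmissible W f → entropyFunctional W a ≤ entropyFunctional W f)
    (hminb : ∀ f, IsAdmissible W f → entropyFunctional W b ≤ entropyFunctional W f) :
    productMeasure a = productMeasure b := by
  have hα := hW.α_pos
  have hWm := hW.continuous.measurable
  have hap := ha.isProbDensity
  have hbp := hb.isProbDensity
  choose T h hT hh hTmap hSmap hlog using fun i =>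
    exists_transport (hap i) (hbp i) (hac i) (hbc i) (ha0 i) (hb0 i)
  have hTm : Measurable fun (x : Fin m → ℝ) i => T i (x i) :=
    measurable_pi_lambda _ fun i => (hT i).comp (measurable_pi_apply i)
  have hSm : Measurable fun (x : Fin m → ℝ) i => (x i + T i (x i)) / 2 :=
    measurable_pi_lambda _ fun i => ((measurable_pi_apply i).add
      ((hT i).comp (measurable_pi_apply i))).div_const 2
  have hmapT := productMeasure_map hap hbp hT hTmap
  have hmapS := productMeasure_map (T := fun i t => (t + T i t) / 2) hap hh
    (fun i => (measurable_id.add (hT i)).div_const 2) hSmap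
  set S : (Fin m → ℝ) → Fin m → ℝ := fun x i => (x i + T i (x i)) / 2 with hS
  set Q : (Fin m → ℝ) → ℝ := fun x => α / 8 * ∑ i, (x i - T i (x i)) ^ 2 with hQ
  have hQm : Measurable Q := (Finset.measurable_sum _ fun i _ =>
    ((measurable_pi_apply i).sub ((hT i).comp (measurable_pi_apply i))).pow_const 2).const_mul _
  have hQ0 : ∀ x, 0 ≤ Q x := fun x =>
    mul_nonneg (by positivity) (Finset.sum_nonneg fun i _ => sq_nonneg _)
  have hψm := measurable_logRatio hWm hh
  have hlb := measurable_logRatio hWm hbp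
  have hbT : Integrable (fun x => logRatio W b fun i => T i (x i)) (productMeasure a) := by
    have := hb.integrable
    rw [← hmapT, integrable_map_measure hlb.aestronglyMeasurable hTm.aemeasurable] at this
    exact this
  set φ : (Fin m → ℝ) → ℝ := fun x =>
    (logRatio W a x + logRatio W b fun i => T i (x i)) / 2 with hφ
  have hφi : Integrable φ (productMeasure a) := (ha.integrable.add hbT).div_const 2
  have hpt : ∀ x, logRatio W h (S x) ≤ φ x - Q x := by
    intro x
    have h1 := Finset.sum_le_sum fun i (_ : i ∈ Finset.univ) => hlog i (x i)
    rw [← Finset.sum_div, Finset.sum_add_distrib] at h1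
    have h2 := hW.mid x fun i => T i (x i)
    simp only [hφ, hQ, hS, logRatio]
    linarith
  have hψ : Integrable (logRatio W h) (productMeasure h) := by
    obtain ⟨h1, h2⟩ := isProbDensity_pi hh
    have hae := logRatio_ae_eq (W := W) hh
    have hg : Integrable (fun y => max (logRatio W h y) 0) (productMeasure h) := by
      rw [← hmapS, integrable_map_measure (hψm.max measurable_const).aestronglyMeasurable
        hSm.aemeasurable]
      refine hφi.mono ((hψm.max measurable_const).comp hSm).aestronglyMeasurable
        (ae_of_all _ fun x => ?_)
      rw [Function.comp_apply, Real.norm_of_nonneg (le_max_right _ _), Real.norm_eq_abs]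
      exact max_le ((hpt x).trans (by linarith [hQ0 x, le_abs_self (φ x)])) (abs_nonneg _)
    have he : Integrable fun x => Real.exp (-W x) := by
      simpa using hW.integrable_exp_sub hW.c_pos
    rw [productMeasure, h1] at hae hg ⊢
    exact integrable_of_le_of_entropy h2 hWm hae he hg (ae_of_all _ fun y => le_max_left _ _)
  have hψS : Integrable (fun x => logRatio W h (S x)) (productMeasure a) := by
    have := hψ
    rw [← hmapS, integrable_map_measure hψm.aestronglyMeasurable hSm.aemeasurable] at this
    exact this
  have hQi : Integrable Q (productMeasure a) := by
    refine (hφi.sub hψS).mono' hQm.aestronglyMeasurable (ae_of_all _ fun x => ?_)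
    rw [Real.norm_of_nonneg (hQ0 x), Pi.sub_apply]
    linarith [hpt x]
  have hJh : entropyFunctional W h = ∫ x, logRatio W h (S x) ∂(productMeasure a) := by
    rw [entropyFunctional, ← hmapS, integral_map hSm.aemeasurable hψm.aestronglyMeasurable]
  have hJb : entropyFunctional W b = ∫ x, logRatio W b (fun i => T i (x i)) ∂(productMeasure a) := by
    rw [entropyFunctional, ← hmapT, integral_map hTm.aemeasurable hlb.aestronglyMeasurable]
  have hle : entropyFunctional W h ≤
      (entropyFunctional W a + entropyFunctional W b) / 2 - ∫ x, Q x ∂(productMeasure a) := by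
    have h1 := integral_mono hψS (hφi.sub hQi) hpt
    rw [integral_sub' hφi hQi] at h1
    simp only [hφ] at h1
    rw [integral_div, integral_add ha.integrable hbT, ← hJh, ← hJb] at h1
    exact h1
  have hQint : ∫ x, Q x ∂(productMeasure a) = 0 := by
    have h1 := hmina h ⟨hh, hψ⟩
    have h2 := hminb h ⟨hh, hψ⟩
    have h3 : 0 ≤ ∫ x, Q x ∂(productMeasure a) := integral_nonneg hQ0
    linarith
  rw [integral_eq_zero_iff_of_nonneg hQ0 hQi] at hQint
  rw [← hmapT]
  conv_lhs => rw [← Measure.map_id (μ := productMeasure a)]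
  refine Measure.map_congr ?_
  filter_upwards [hQint] with x hx
  have h1 : ∑ i, (x i - T i (x i)) ^ 2 = 0 := by
    simpa [hQ, hα.ne'] using hx
  rw [Finset.sum_eq_zero_iff_of_nonneg fun i _ => sq_nonneg _] at h1
  funext i
  have h2 := h1 i (Finset.mem_univ i)
  rw [sq_eq_zero_iff, sub_eq_zero] at h2
  exact h2

lemma productMeasure_eq_of_isMinimizer (hW : IsPotential W α c C) {f g : Fin m → ℝ → ℝ}
    (hf : IsAdmissible W f) (hg : IsAdmissible W g)
    (hminf : ∀ f', IsAdmissible W f' → entropyFunctional W f ≤ entropyFunctional W f')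
    (hming : ∀ f', IsAdmissible W f' → entropyFunctional W g ≤ entropyFunctional W f') :
    productMeasure f = productMeasure g := by
  obtain ⟨a, ha, hac, ha0, hfa, hJa⟩ := exists_gibbs_of_minimizer hW hf hminf
  obtain ⟨b, hb, hbc, hb0, hgb, hJb⟩ := exists_gibbs_of_minimizer hW hg hming
  rw [hfa, hgb]
  exact productMeasure_eq_of_minimizers hW ha hb hac hbc ha0 hb0
    (fun f' hf' => hJa ▸ hminf f' hf') (fun f' hf' => hJb ▸ hming f' hf')

end Uniqueness

section MeanField

variable {m : ℕ}

lemma target_eq_densityMeasure {V : (Fin m → ℝ) → ℝ}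
    (hV : Integrable fun x => Real.exp (-V x)) :
    target V = densityMeasure fun x =>
      Real.exp (-(V x + Real.log (∫ y, Real.exp (-V y)))) := by
  have hZ : 0 < ∫ y, Real.exp (-V y) := integral_exp_pos hV
  unfold target densityMeasure
  congr 1
  funext x
  simp only
  rw [neg_add, Real.exp_add, Real.exp_neg (Real.log _), Real.exp_log hZ, div_eq_mul_inv]

lemma productMeasure_mem_meanField {f : Fin m → ℝ → ℝ} (hf : ∀ i, IsProbDensity (f i)) :
    productMeasure f ∈ meanField m :=
  ⟨_, fun i => (hf i).prob, fun _ => withDensity_absolutelyContinuous _ _, rfl⟩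

lemma exists_eq_productMeasure {q : Measure (Fin m → ℝ)} (hq : q ∈ meanField m) :
    ∃ f : Fin m → ℝ → ℝ, (∀ i, IsProbDensity (f i)) ∧ q = productMeasure f := by
  obtain ⟨qi, hprob, hac, rfl⟩ := hq
  choose f hf hqf using fun i => exists_isProbDensity (qi i) (hac i)
  exact ⟨f, hf, by unfold productMeasure; congr 1; exact funext hqf⟩

end MeanField

end VariationalInference

/-- Under the strong convexity and smoothness assumption `α I ⪯ ∇²V ⪯ L I`
(`0 < α ≤ L`), the mean-field variational inference problem
`min_{q ∈ Q} D_KL(q‖p)` with `p ∝ e^{−V}` has a unique optimal solution. -/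
theorem MFVI_existence_uniqueness (m : ℕ) (hm : 0 < m) (V : (Fin m → ℝ) → ℝ)
    (α L : ℝ) (hα : 0 < α) (hαL : α ≤ L) (hV : ContDiff ℝ 2 V)
    (hHess : ∀ x v : Fin m → ℝ,
      α * ∑ i, v i ^ 2 ≤ fderiv ℝ (fderiv ℝ V) x v v ∧
      fderiv ℝ (fderiv ℝ V) x v v ≤ L * ∑ i, v i ^ 2) :
    ∃! q : Measure (Fin m → ℝ),
      q ∈ meanField m ∧ ∀ q' ∈ meanField m, KL q (target V) ≤ KL q' (target V) := by
  obtain ⟨c₀, C₀, hW₀⟩ := exists_isPotential hα hαL hV hHess 0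
  have h_int : Integrable fun x => Real.exp (-V x) := by
    simpa using hW₀.integrable_exp_sub hW₀.c_pos
  rw [target_eq_densityMeasure h_int]
  obtain ⟨c, C, hW⟩ := exists_isPotential hα hαL hV hHess (Real.log (∫ y, Real.exp (-V y)))
  set W : (Fin m → ℝ) → ℝ := fun x => V x + Real.log (∫ y, Real.exp (-V y))
  have hWm := hW.continuous.measurable
  obtain ⟨f, hf, hmin⟩ := exists_minimizer hW
  have hKLf := (KL_productMeasure hf.isProbDensity hWm).1 hf.integrable
  refine ⟨productMeasure f, ⟨productMeasure_mem_meanField hf.isProbDensity, fun q' hq' => ?_⟩,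
    fun q' hq' => ?_⟩
  · obtain ⟨f', hf', rfl⟩ := exists_eq_productMeasure hq'
    obtain ⟨h1, h2⟩ := KL_productMeasure hf' hWm
    by_cases hi : Integrable (logRatio W f') (productMeasure f')
    · rw [hKLf, h1 hi]
      exact EReal.coe_le_coe_iff.2 (hmin f' ⟨hf', hi⟩)
    · rw [h2 hi]
      exact le_top
  · obtain ⟨hmem, hq'min⟩ := hq'
    obtain ⟨f', hf', rfl⟩ := exists_eq_productMeasure hmem
    obtain ⟨h1, h2⟩ := KL_productMeasure hf' hWm
    have hle := hq'min _ (productMeasure_mem_meanField hf.isProbDensity)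
    rw [hKLf] at hle
    have hi : Integrable (logRatio W f') (productMeasure f') := by
      by_contra hi
      rw [h2 hi, top_le_iff] at hle
      exact EReal.coe_ne_top _ hle
    rw [h1 hi, EReal.coe_le_coe_iff] at hle
    exact productMeasure_eq_of_isMinimizer hW ⟨hf', hi⟩ hf
      (fun g hg => hle.trans (hmin g hg)) hmin

end
end

section
/- Let Z and W be random arrays in ℝ^{m×N} defined on a common probability space, and let μ be a probability measure on ℝ^m such that E W₂²(q_Z, μ) < ∞ and E W₂²(q_W, μ) < ∞. Then 0 ≤ √(E W₂²(q_Z, q_W)) − W̃(Law(Z), Law(W)) ≤ 2 √(E W₂²(q_W, μ)). -/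
open MeasureTheory ENNReal

noncomputable section

/-- The set of couplings between two measures. -/
def Couplings {E : Type*} [MeasurableSpace E] (μ ν : Measure E) : Set (Measure (E × E)) :=
  {γ | IsProbabilityMeasure γ ∧ γ.map Prod.fst = μ ∧ γ.map Prod.snd = ν}

/-- Squared 2-Wasserstein distance between measures on ℝ^m (Euclidean cost). -/
def W2sq {m : ℕ} (μ ν : Measure (Fin m → ℝ)) : ℝ≥0∞ :=
  ⨅ γ ∈ Couplings μ ν, ∫⁻ p, ENNReal.ofReal (∑ i, (p.1 i - p.2 i) ^ 2) ∂γ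

/-- The product of the empirical marginal measures of an array `A ∈ ℝ^{m×N}`. -/
def empProd {m N : ℕ} (A : Fin m → Fin N → ℝ) : Measure (Fin m → ℝ) :=
  Measure.pi fun i => (N : ℝ≥0∞)⁻¹ • ∑ j : Fin N, Measure.dirac (A i j)

/-- Squared version of the distance `W̃` between distributions of particle arrays:
the infimum over couplings `γ` of `E_{(X,Y)∼γ} W₂²(q_X, q_Y)`. -/
def WtildeSq {m N : ℕ} (μ ν : Measure (Fin m → Fin N → ℝ)) : ℝ≥0∞ :=
  ⨅ γ ∈ Couplings μ ν, ∫⁻ p, W2sq (empProd p.1) (empProd p.2) ∂γ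

open ProbabilityTheory

lemma lintegral_rpow_half_le_add {α : Type*} [MeasurableSpace α] {ρ : Measure α}
    {h f g : α → ℝ≥0∞} (hf : Measurable f) (hg : Measurable g)
    (hfg : ∀ x, h x ^ (1 / 2 : ℝ) ≤ f x ^ (1 / 2 : ℝ) + g x ^ (1 / 2 : ℝ)) :
    (∫⁻ x, h x ∂ρ) ^ (1 / 2 : ℝ)
      ≤ (∫⁻ x, f x ∂ρ) ^ (1 / 2 : ℝ) + (∫⁻ x, g x ∂ρ) ^ (1 / 2 : ℝ) := by
  have key : ∀ a : ℝ≥0∞, (a ^ (1 / 2 : ℝ)) ^ (2 : ℝ) = a := fun a ↦ by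
    rw [← ENNReal.rpow_mul]; norm_num
  have := ENNReal.lintegral_Lp_add_le (μ := ρ) (p := 2) (hf.pow_const (1 / 2 : ℝ)).aemeasurable
    (hg.pow_const (1 / 2 : ℝ)).aemeasurable (by norm_num)
  simp only [key, Pi.add_apply] at this
  refine le_trans ?_ this
  gcongr with x
  rw [← key (h x)]
  gcongr
  exact hfg x

lemma le_rpow_half_biInf_add {ι : Type*} {s : Set ι} {c : ι → ℝ≥0∞} {a b : ℝ≥0∞}
    (h : ∀ i ∈ s, a ≤ c i ^ (1 / 2 : ℝ) + b) : a ≤ (⨅ i ∈ s, c i) ^ (1 / 2 : ℝ) + b := by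
  rw [← tsub_le_iff_right, one_div, ENNReal.le_rpow_inv_iff (by norm_num)]
  refine le_iInf₂ fun i hi ↦ ?_
  rw [← ENNReal.le_rpow_inv_iff (by norm_num), tsub_le_iff_right, ← one_div]
  exact h i hi

/-- Gluing lemma: two couplings with a common marginal are pushforwards of a single measure. -/
lemma exists_gluing {E : Type*} [MeasurableSpace E] [StandardBorelSpace E] [Nonempty E]
    {μ ν ρ : Measure E} {γ₁ γ₂ : Measure (E × E)}
    (h₁ : γ₁ ∈ Couplings μ ν) (h₂ : γ₂ ∈ Couplings ν ρ) :
    ∃ π : Measure (E × E × E), IsProbabilityMeasure π ∧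
      π.map (fun p ↦ (p.2.1, p.1)) = γ₁ ∧ π.map (fun p ↦ (p.1, p.2.2)) = γ₂ := by
  obtain ⟨_, hμ, hν⟩ := h₁
  obtain ⟨_, hν', hρ⟩ := h₂
  have : IsProbabilityMeasure ν := hν ▸ Measure.isProbabilityMeasure_map (by fun_prop)
  have hP : IsProbabilityMeasure (γ₁.map Prod.swap) :=
    Measure.isProbabilityMeasure_map (by fun_prop)
  have hfst : (γ₁.map Prod.swap).fst = ν := by
    rw [Measure.fst_map_swap]; exact hν
  have hfst' : γ₂.fst = ν := hν'
  set κ₁ := (γ₁.map Prod.swap).condKernel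
  set κ₂ := γ₂.condKernel
  have e₁ : ν ⊗ₘ κ₁ = γ₁.map Prod.swap := by
    rw [← hfst]; exact (γ₁.map Prod.swap).disintegrate _
  have e₂ : ν ⊗ₘ κ₂ = γ₂ := by
    rw [← hfst']; exact γ₂.disintegrate _
  refine ⟨ν ⊗ₘ (κ₁ ×ₖ κ₂), inferInstance, ?_, ?_⟩
  · have : (ν ⊗ₘ (κ₁ ×ₖ κ₂)).map (Prod.map id Prod.fst) = γ₁.map Prod.swap := by
      rw [← Measure.compProd_map measurable_fst, ← Kernel.fst_eq, Kernel.fst_prod, e₁]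
    calc _ = ((ν ⊗ₘ (κ₁ ×ₖ κ₂)).map (Prod.map id Prod.fst)).map Prod.swap := by
            rw [Measure.map_map (by fun_prop) (by fun_prop)]; rfl
      _ = γ₁ := by
            rw [this, Measure.map_map (by fun_prop) (by fun_prop), Prod.swap_swap_eq,
              Measure.map_id]
  · rw [← e₂]
    conv_rhs => rw [← Kernel.snd_prod κ₁ κ₂, Kernel.snd_eq, Measure.compProd_map measurable_snd]
    rfl

lemma ofReal_sum_sq_rpow_half {m : ℕ} (x y : Fin m → ℝ) :
    ENNReal.ofReal (∑ i, (x i - y i) ^ 2) ^ (1 / 2 : ℝ)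
      = edist (WithLp.toLp 2 x : EuclideanSpace ℝ (Fin m)) (WithLp.toLp 2 y) := by
  rw [edist_dist, EuclideanSpace.dist_eq, Real.sqrt_eq_rpow,
    ENNReal.ofReal_rpow_of_nonneg (by positivity) (by norm_num)]
  simp [Real.dist_eq, sq_abs]

lemma W2sq_le_lintegral {m : ℕ} {α : Type*} [MeasurableSpace α] {π : Measure α}
    [IsProbabilityMeasure π] {f g : α → Fin m → ℝ} (hf : Measurable f) (hg : Measurable g)
    {μ ν : Measure (Fin m → ℝ)} (hμ : π.map f = μ) (hν : π.map g = ν) :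
    W2sq μ ν ≤ ∫⁻ a, ENNReal.ofReal (∑ i, (f a i - g a i) ^ 2) ∂π := by
  have hfg : π.map (fun a ↦ (f a, g a)) ∈ Couplings μ ν :=
    ⟨Measure.isProbabilityMeasure_map (by fun_prop),
      by rw [Measure.map_map (by fun_prop) (by fun_prop)]; exact hμ,
      by rw [Measure.map_map (by fun_prop) (by fun_prop)]; exact hν⟩
  exact (iInf₂_le _ hfg).trans (lintegral_map_le _ _)

lemma W2sq_comm {m : ℕ} (μ ν : Measure (Fin m → ℝ)) : W2sq μ ν = W2sq ν μ := by
  suffices H : ∀ μ ν : Measure (Fin m → ℝ), W2sq μ ν ≤ W2sq ν μ from le_antisymm (H _ _) (H _ _)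
  intro μ ν
  refine le_iInf₂ fun γ hγ ↦ ?_
  obtain ⟨_, h₁, h₂⟩ := hγ
  refine (W2sq_le_lintegral measurable_snd measurable_fst h₂ h₁).trans (le_of_eq ?_)
  simp only [sub_sq_comm]

lemma W2sq_rpow_half_triangle {m : ℕ} (μ ν ρ : Measure (Fin m → ℝ)) :
    W2sq μ ρ ^ (1 / 2 : ℝ) ≤ W2sq μ ν ^ (1 / 2 : ℝ) + W2sq ν ρ ^ (1 / 2 : ℝ) := by
  refine le_rpow_half_biInf_add fun γ₁ h₁ ↦ ?_
  rw [add_comm]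
  refine le_rpow_half_biInf_add fun γ₂ h₂ ↦ ?_
  rw [add_comm]
  obtain ⟨π, _, e₁, e₂⟩ := exists_gluing h₁ h₂
  have hμ : π.map (fun p ↦ p.2.1) = μ := by
    rw [← h₁.2.1, ← e₁, Measure.map_map (by fun_prop) (by fun_prop)]; rfl
  have hρ : π.map (fun p ↦ p.2.2) = ρ := by
    rw [← h₂.2.2, ← e₂, Measure.map_map (by fun_prop) (by fun_prop)]; rfl
  have hle := W2sq_le_lintegral (by fun_prop) (by fun_prop) hμ hρ
  rw [← e₁, ← e₂, lintegral_map (by fun_prop) (by fun_prop),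
    lintegral_map (by fun_prop) (by fun_prop)]
  refine (ENNReal.rpow_le_rpow hle (by norm_num)).trans
    (lintegral_rpow_half_le_add (by fun_prop) (by fun_prop) fun p ↦ ?_)
  simp only [ofReal_sum_sq_rpow_half]
  exact edist_triangle _ _ _

/-- The empirical measure of a finite family of points. -/
def empMeasure {E : Type*} [MeasurableSpace E] {N : ℕ} (x : Fin N → E) : Measure E :=
  (N : ℝ≥0∞)⁻¹ • ∑ j : Fin N, Measure.dirac (x j)

lemma isProbabilityMeasure_empMeasure {E : Type*} [MeasurableSpace E] {N : ℕ} (hN : 0 < N)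
    (x : Fin N → E) : IsProbabilityMeasure (empMeasure x) := by
  constructor
  simp only [empMeasure, Measure.smul_apply, Measure.coe_finsetSum, Finset.sum_apply,
    measure_univ, Finset.sum_const, Finset.card_univ, Fintype.card_fin, smul_eq_mul, nsmul_eq_mul,
    mul_one]
  exact ENNReal.inv_mul_cancel (by simpa using hN.ne') (by simp)

lemma map_empMeasure {E F : Type*} [MeasurableSpace E] [MeasurableSpace F] {N : ℕ}
    (x : Fin N → E) {f : E → F} (hf : Measurable f) :
    (empMeasure x).map f = empMeasure fun j ↦ f (x j) := by
  simp only [empMeasure, Measure.map_smul]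
  congr 1
  rw [← Measure.mapₗ_apply_of_measurable hf, map_sum]
  simp only [Measure.mapₗ_apply_of_measurable hf, Measure.map_dirac' hf]

lemma W2sq_empProd_le {m N : ℕ} (hN : 0 < N) (A B : Fin m → Fin N → ℝ) :
    W2sq (empProd A) (empProd B) ≤ m * edist A B ^ (2 : ℝ) := by
  set η : Fin m → Measure (ℝ × ℝ) := fun i ↦ empMeasure fun j ↦ (A i j, B i j) with hη
  have hηP : ∀ i, IsProbabilityMeasure (η i) := fun i ↦ isProbabilityMeasure_empMeasure hN _
  have hfP : ∀ i, IsProbabilityMeasure ((η i).map Prod.fst) := fun i ↦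
    Measure.isProbabilityMeasure_map (by fun_prop)
  have hsP : ∀ i, IsProbabilityMeasure ((η i).map Prod.snd) := fun i ↦
    Measure.isProbabilityMeasure_map (by fun_prop)
  have hA : (Measure.pi η).map (fun p i ↦ (p i).1) = empProd A := by
    rw [Measure.pi_map_pi (f := fun _ ↦ Prod.fst) (fun i ↦ by fun_prop)]
    simp only [hη, map_empMeasure _ measurable_fst]
    rfl
  have hB : (Measure.pi η).map (fun p i ↦ (p i).2) = empProd B := by
    rw [Measure.pi_map_pi (f := fun _ ↦ Prod.snd) (fun i ↦ by fun_prop)]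
    simp only [hη, map_empMeasure _ measurable_snd]
    rfl
  refine (W2sq_le_lintegral (by fun_prop) (by fun_prop) hA hB).trans ?_
  simp_rw [ENNReal.ofReal_sum_of_nonneg (fun _ _ ↦ sq_nonneg _)]
  rw [lintegral_finsetSum _ (fun i _ ↦ by fun_prop)]
  calc _ ≤ ∑ _i : Fin m, edist A B ^ (2 : ℝ) := Finset.sum_le_sum fun i _ ↦ ?_
    _ = _ := by simp
  have hev := (measurePreserving_eval η i).lintegral_comp
    (f := fun q : ℝ × ℝ ↦ ENNReal.ofReal ((q.1 - q.2) ^ 2)) (by fun_prop)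
  refine hev.trans_le ?_
  calc ∫⁻ q, ENNReal.ofReal ((q.1 - q.2) ^ 2) ∂η i ≤ ∫⁻ _, edist A B ^ (2 : ℝ) ∂η i := by
        refine lintegral_mono_ae ?_
        have : ∀ᵐ q ∂∑ j : Fin N, Measure.dirac (A i j, B i j),
            ENNReal.ofReal ((q.1 - q.2) ^ 2) ≤ edist A B ^ (2 : ℝ) := by
          rw [← Measure.sum_fintype, Measure.ae_sum_iff]
          intro j
          rw [ae_dirac_iff (measurableSet_le (by fun_prop) (by fun_prop))]
          have : edist (A i j) (B i j) ≤ edist A B :=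
            (edist_le_pi_edist _ _ j).trans (edist_le_pi_edist A B i)
          rw [← sq_abs, ← Real.dist_eq, ENNReal.ofReal_pow dist_nonneg, ← edist_dist,
            ENNReal.rpow_two]
          gcongr
        exact Measure.ae_smul_measure this _
    _ = _ := by simp

lemma W2sq_empProd_rpow_half_le {m N : ℕ} (hN : 0 < N) (A B : Fin m → Fin N → ℝ) :
    W2sq (empProd A) (empProd B) ^ (1 / 2 : ℝ) ≤ (m : ℝ≥0∞) ^ (1 / 2 : ℝ) * edist A B := by
  refine (ENNReal.rpow_le_rpow (W2sq_empProd_le hN A B) (by norm_num)).trans (le_of_eq ?_)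
  rw [ENNReal.mul_rpow_of_nonneg _ _ (by norm_num), ← ENNReal.rpow_mul]
  norm_num

lemma measurable_of_rpow_half {α : Type*} [MeasurableSpace α] {f : α → ℝ≥0∞}
    (hf : Measurable fun x ↦ f x ^ (1 / 2 : ℝ)) : Measurable f := by
  convert hf.pow_const (2 : ℝ) using 2 with x
  rw [← ENNReal.rpow_mul]
  norm_num

lemma measurable_W2sq_empProd_left {m N : ℕ} (hN : 0 < N) (μ : Measure (Fin m → ℝ)) :
    Measurable fun A : Fin m → Fin N → ℝ ↦ W2sq (empProd A) μ := by
  refine measurable_of_rpow_half (Continuous.measurable ?_)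
  refine continuous_of_le_add_edist ((m : ℝ≥0∞) ^ (1 / 2 : ℝ)) (by simp) fun A B ↦ ?_
  refine (W2sq_rpow_half_triangle _ (empProd B) _).trans ?_
  rw [add_comm]
  gcongr
  exact W2sq_empProd_rpow_half_le hN A B

lemma measurable_W2sq_empProd {m N : ℕ} (hN : 0 < N) :
    Measurable fun p : (Fin m → Fin N → ℝ) × (Fin m → Fin N → ℝ) ↦
      W2sq (empProd p.1) (empProd p.2) := by
  refine measurable_of_rpow_half (Continuous.measurable ?_)
  refine continuous_of_le_add_edist (2 * (m : ℝ≥0∞) ^ (1 / 2 : ℝ))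
    (ENNReal.mul_ne_top (by simp) (by simp)) fun p q ↦ ?_
  have h₁ : W2sq (empProd p.1) (empProd q.1) ^ (1 / 2 : ℝ)
      ≤ (m : ℝ≥0∞) ^ (1 / 2 : ℝ) * edist p q :=
    (W2sq_empProd_rpow_half_le hN _ _).trans (by gcongr; exact le_max_left _ _)
  have h₂ : W2sq (empProd q.2) (empProd p.2) ^ (1 / 2 : ℝ)
      ≤ (m : ℝ≥0∞) ^ (1 / 2 : ℝ) * edist p q := by
    rw [W2sq_comm]
    exact (W2sq_empProd_rpow_half_le hN _ _).trans (by gcongr; exact le_max_right _ _)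
  calc _ ≤ W2sq (empProd p.1) (empProd q.1) ^ (1 / 2 : ℝ)
        + W2sq (empProd q.1) (empProd p.2) ^ (1 / 2 : ℝ) := W2sq_rpow_half_triangle _ _ _
    _ ≤ (m : ℝ≥0∞) ^ (1 / 2 : ℝ) * edist p q + (W2sq (empProd q.1) (empProd q.2) ^ (1 / 2 : ℝ)
        + (m : ℝ≥0∞) ^ (1 / 2 : ℝ) * edist p q) :=
      add_le_add h₁ ((W2sq_rpow_half_triangle _ _ _).trans (by gcongr))
    _ = _ := by ring

lemma WtildeSq_map_le {m N : ℕ} {Ω : Type*} [MeasurableSpace Ω] (P : Measure Ω)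
    [IsProbabilityMeasure P] {Z W : Ω → Fin m → Fin N → ℝ} (hZ : Measurable Z)
    (hW : Measurable W) :
    WtildeSq (P.map Z) (P.map W) ≤ ∫⁻ ω, W2sq (empProd (Z ω)) (empProd (W ω)) ∂P := by
  have hm : Measurable fun ω ↦ (Z ω, W ω) := hZ.prodMk hW
  refine (iInf₂_le (P.map fun ω ↦ (Z ω, W ω))
    ⟨Measure.isProbabilityMeasure_map hm.aemeasurable, ?_, ?_⟩).trans (lintegral_map_le _ _)
  · rw [Measure.map_map measurable_fst hm]; rfl
  · rw [Measure.map_map measurable_snd hm]; rfl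

lemma lintegral_W2sq_rpow_half_le {m N : ℕ} (hN : 0 < N) {Ω : Type*} [MeasurableSpace Ω]
    (P : Measure Ω) {Z W : Ω → Fin m → Fin N → ℝ} (hZ : Measurable Z) (hW : Measurable W)
    (μ : Measure (Fin m → ℝ)) :
    (∫⁻ ω, W2sq (empProd (Z ω)) (empProd (W ω)) ∂P) ^ (1 / 2 : ℝ)
      ≤ (∫⁻ ω, W2sq (empProd (Z ω)) μ ∂P) ^ (1 / 2 : ℝ)
        + (∫⁻ ω, W2sq (empProd (W ω)) μ ∂P) ^ (1 / 2 : ℝ) := by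
  refine lintegral_rpow_half_le_add ((measurable_W2sq_empProd_left hN μ).comp hZ)
    ((measurable_W2sq_empProd_left hN μ).comp hW) fun ω ↦ ?_
  rw [W2sq_comm (empProd (W ω)) μ]
  exact W2sq_rpow_half_triangle _ _ _

lemma lintegral_W2sq_rpow_half_le_WtildeSq_add {m N : ℕ} (hN : 0 < N) {Ω : Type*}
    [MeasurableSpace Ω] (P : Measure Ω) {Z W : Ω → Fin m → Fin N → ℝ} (hZ : Measurable Z)
    (hW : Measurable W) (μ : Measure (Fin m → ℝ)) :
    (∫⁻ ω, W2sq (empProd (Z ω)) μ ∂P) ^ (1 / 2 : ℝ)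
      ≤ WtildeSq (P.map Z) (P.map W) ^ (1 / 2 : ℝ)
        + (∫⁻ ω, W2sq (empProd (W ω)) μ ∂P) ^ (1 / 2 : ℝ) := by
  have hμm := measurable_W2sq_empProd_left (N := N) hN μ
  refine le_rpow_half_biInf_add fun γ hγ ↦ ?_
  obtain ⟨_, h₁, h₂⟩ := hγ
  rw [← lintegral_map hμm hZ, ← lintegral_map hμm hW, ← h₁, ← h₂,
    lintegral_map hμm measurable_fst, lintegral_map hμm measurable_snd]
  exact lintegral_rpow_half_le_add (measurable_W2sq_empProd hN) (hμm.comp measurable_snd)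
    fun p ↦ W2sq_rpow_half_triangle _ _ _

/-- Second part of Lemma 3: for random arrays `Z, W ∈ ℝ^{m×N}` on a common probability
space and a probability measure `μ` on ℝ^m with `E W₂²(q_Z, μ) < ∞` and
`E W₂²(q_W, μ) < ∞`, one has
`0 ≤ √(E W₂²(q_Z, q_W)) − W̃(Law(Z), Law(W)) ≤ 2 √(E W₂²(q_W, μ))`. -/
theorem sqrt_expected_W2sq_vs_Wtilde (m N : ℕ) (hm : 0 < m) (hN : 0 < N)
    (Ω : Type) [MeasurableSpace Ω] (P : Measure Ω) [IsProbabilityMeasure P]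
    (Z W : Ω → Fin m → Fin N → ℝ) (hZ : Measurable Z) (hW : Measurable W)
    (μ : Measure (Fin m → ℝ)) [IsProbabilityMeasure μ]
    (hZμ : ∫⁻ ω, W2sq (empProd (Z ω)) μ ∂P < ⊤)
    (hWμ : ∫⁻ ω, W2sq (empProd (W ω)) μ ∂P < ⊤) :
    0 ≤ Real.sqrt (∫⁻ ω, W2sq (empProd (Z ω)) (empProd (W ω)) ∂P).toReal
        - Real.sqrt (WtildeSq (P.map Z) (P.map W)).toReal ∧
    Real.sqrt (∫⁻ ω, W2sq (empProd (Z ω)) (empProd (W ω)) ∂P).toReal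
        - Real.sqrt (WtildeSq (P.map Z) (P.map W)).toReal
      ≤ 2 * Real.sqrt (∫⁻ ω, W2sq (empProd (W ω)) μ ∂P).toReal := by
  have h₁ := WtildeSq_map_le P hZ hW
  have h₂ := lintegral_W2sq_rpow_half_le hN P hZ hW μ
  have h₃ := lintegral_W2sq_rpow_half_le_WtildeSq_add hN P hZ hW μ
  have hroot : ∀ a : ℝ≥0∞, √a.toReal = (a ^ (1 / 2 : ℝ)).toReal := fun a ↦ by
    rw [Real.sqrt_eq_rpow, ENNReal.toReal_rpow]
  have htop : ∀ {a : ℝ≥0∞}, a ≠ ⊤ → a ^ (1 / 2 : ℝ) ≠ ⊤ := fun h ↦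
    ENNReal.rpow_ne_top_of_nonneg (by norm_num) h
  have hZ' := htop hZμ.ne
  have hW' := htop hWμ.ne
  have hS := ne_top_of_le_ne_top (ENNReal.add_ne_top.2 ⟨hZ', hW'⟩) h₂
  have h₁' := ENNReal.rpow_le_rpow h₁ (z := 1 / 2) (by norm_num)
  have hT := ne_top_of_le_ne_top hS h₁'
  simp only [hroot]
  have r₁ := ENNReal.toReal_mono hS h₁'
  have r₂ := ENNReal.toReal_mono (ENNReal.add_ne_top.2 ⟨hZ', hW'⟩) h₂
  have r₃ := ENNReal.toReal_mono (ENNReal.add_ne_top.2 ⟨hT, hW'⟩) h₃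
  rw [ENNReal.toReal_add hZ' hW'] at r₂
  rw [ENNReal.toReal_add hT hW'] at r₃
  constructor <;> linarith

end
end

section
/- Under Assumption 1, the MFVI minimizer q* satisfies: (a) E_{x∼q*} ∇V(x) = 0; (b) E_{x∼q*} ‖∇V(x)‖₂² ≤ m L² / α; (c) the covariance matrix of q* satisfies Cov_{x∼q*}(x) ⪯ α⁻¹ I_m. -/
open MeasureTheory ProbabilityTheory ENNReal

noncomputable section

/-- The `i`-th partial derivative of `V`. -/
def pderiv {m : ℕ} (V : (Fin m → ℝ) → ℝ) (i : Fin m) (x : Fin m → ℝ) : ℝ :=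
  deriv (fun t => V (Function.update x i t)) (x i)

section ProductMeasure

variable {ι : Type*} [DecidableEq ι]

/-- The point whose coordinates in `A` come from the second copy and the others from the
first. -/
def hybrid {X : Type*} (A : Finset ι) (w : ι → X × X) : ι → X :=
  fun i => if i ∈ A then (w i).2 else (w i).1

/-- Exchange the two copies in the coordinates belonging to `A`. -/
def swapOn {X : Type*} (A : Finset ι) (w : ι → X × X) : ι → X × X :=
  fun i => if i ∈ A then (w i).swap else w i

lemma hybrid_swapOn {X : Type*} (A B : Finset ι) (w : ι → X × X) :
    hybrid A (swapOn B w) = hybrid (symmDiff A B) w := by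
  ext i
  by_cases hA : i ∈ A <;> by_cases hB : i ∈ B <;> simp [hybrid, swapOn, hA, hB, Finset.mem_symmDiff]

variable [Fintype ι]

/-- Resampling one coordinate of a product probability measure preserves its law. -/
lemma measurePreserving_update_pi {X : ι → Type*} [∀ i, MeasurableSpace (X i)]
    (μ : ∀ i, Measure (X i)) [∀ i, IsProbabilityMeasure (μ i)] (k : ι) :
    MeasurePreserving (fun p : (∀ i, X i) × X k => Function.update p.1 k p.2)
      ((Measure.pi μ).prod (μ k)) (Measure.pi μ) := by
  have hm : Measurable (fun p : (∀ i, X i) × X k => Function.update p.1 k p.2) :=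
    measurable_update'
  refine ⟨hm, Measure.ext_of_lintegral _ fun f hf => ?_⟩
  rw [lintegral_map hf hm,
    lintegral_prod (fun p => f (Function.update p.1 k p.2)) (hf.comp hm).aemeasurable]
  have h1 : ∀ x, ∫⁻ y, f (Function.update x k y) ∂μ k = lmarginal μ {k} f x := fun x => by
    rw [lmarginal_singleton]
  simp only [h1]
  refine lintegral_eq_of_lmarginal_eq {k} (hf.lmarginal μ) hf ?_
  rw [lmarginal_singleton]
  ext x
  simp [lmarginal_update_of_mem]

variable {X : Type*} [MeasurableSpace X] (μ : ι → Measure X) [∀ i, IsProbabilityMeasure (μ i)]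

lemma measurePreserving_hybrid (A : Finset ι) :
    MeasurePreserving (hybrid (X := X) A) (Measure.pi fun i => (μ i).prod (μ i))
      (Measure.pi μ) := by
  refine measurePreserving_pi (fun i => (μ i).prod (μ i)) μ
    (f := fun i (p : X × X) => if i ∈ A then p.2 else p.1) fun i => ?_
  by_cases h : i ∈ A
  · simpa [h] using (measurePreserving_snd (μ := μ i) (ν := μ i))
  · simpa [h] using (measurePreserving_fst (μ := μ i) (ν := μ i))

lemma measurePreserving_swapOn (A : Finset ι) :
    MeasurePreserving (swapOn (X := X) A) (Measure.pi fun i => (μ i).prod (μ i))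
      (Measure.pi fun i => (μ i).prod (μ i)) := by
  refine measurePreserving_pi (fun i => (μ i).prod (μ i)) (fun i => (μ i).prod (μ i))
    (f := fun i (p : X × X) => if i ∈ A then p.swap else p) fun i => ?_
  by_cases h : i ∈ A
  · simpa [h] using (Measure.measurePreserving_swap (μ := μ i) (ν := μ i))
  · simpa [h] using! (MeasurePreserving.id ((μ i).prod (μ i)))

variable {μ}

lemma integral_comp_swapOn (A : Finset ι) {g : (ι → X × X) → ℝ}
    (hg : AEStronglyMeasurable g (Measure.pi fun i => (μ i).prod (μ i))) :
    ∫ w, g (swapOn A w) ∂(Measure.pi fun i => (μ i).prod (μ i))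
      = ∫ w, g w ∂(Measure.pi fun i => (μ i).prod (μ i)) := by
  have h := measurePreserving_swapOn μ A
  rw [← integral_map h.measurable.aemeasurable (by rwa [h.map_eq]), h.map_eq]

lemma integral_comp_hybrid (A : Finset ι) {g : (ι → X) → ℝ}
    (hg : AEStronglyMeasurable g (Measure.pi μ)) :
    ∫ w, g (hybrid A w) ∂(Measure.pi fun i => (μ i).prod (μ i)) = ∫ x, g x ∂(Measure.pi μ) := by
  have h := measurePreserving_hybrid μ A
  rw [← integral_map h.measurable.aemeasurable (by rwa [h.map_eq]), h.map_eq]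

lemma integral_mul_hybrid_univ {f : (ι → X) → ℝ} (hf : MemLp f 2 (Measure.pi μ)) :
    ∫ w, f (hybrid ∅ w) * f (hybrid Finset.univ w) ∂(Measure.pi fun i => (μ i).prod (μ i))
      = (∫ x, f x ∂(Measure.pi μ)) ^ 2 := by
  have hmp : MeasurePreserving
      (fun w : ι → X × X => (hybrid ∅ w, hybrid Finset.univ w))
      (Measure.pi fun i => (μ i).prod (μ i)) ((Measure.pi μ).prod (Measure.pi μ)) := by
    convert measurePreserving_arrowProdEquivProdArrow X X ι μ μ using 1
    ext w i <;>
      simp [hybrid, MeasurableEquiv.arrowProdEquivProdArrow, Equiv.arrowProdEquivProdArrow]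
  have hg : Integrable (fun p : (ι → X) × (ι → X) => f p.1 * f p.2)
      ((Measure.pi μ).prod (Measure.pi μ)) :=
    (hf.integrable one_le_two).mul_prod (hf.integrable one_le_two)
  have := integral_map hmp.measurable.aemeasurable
    (f := fun p : (ι → X) × (ι → X) => f p.1 * f p.2)
    (by rw [hmp.map_eq]; exact hg.aestronglyMeasurable)
  rw [← this, hmp.map_eq, integral_prod_mul, sq]

/-- The **Efron-Stein inequality**. -/
theorem efron_stein {f : (ι → X) → ℝ} (hf : MemLp f 2 (Measure.pi μ)) :
    ∫ x, f x ^ 2 ∂(Measure.pi μ) - (∫ x, f x ∂(Measure.pi μ)) ^ 2 ≤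
      (1 / 2) * ∑ k, ∫ w, (f (hybrid ∅ w) - f (hybrid {k} w)) ^ 2
        ∂(Measure.pi fun i => (μ i).prod (μ i)) := by
  set P := Measure.pi fun i => (μ i).prod (μ i)
  have hL : ∀ A, MemLp (fun w => f (hybrid A w)) 2 P := fun A =>
    hf.comp_measurePreserving (measurePreserving_hybrid μ A)
  have hmul : ∀ A B, Integrable (fun w => f (hybrid A w) * f (hybrid B w)) P := fun A B =>
    (hL A).integrable_mul (hL B)
  have hsq : ∀ A B, Integrable (fun w => (f (hybrid A w) - f (hybrid B w)) ^ 2) P := fun A B =>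
    ((hL A).sub (hL B)).integrable_sq
  have step : ∀ A k, k ∉ A →
      ∫ w, f (hybrid ∅ w) * (f (hybrid A w) - f (hybrid (insert k A) w)) ∂P ≤
        (1 / 2) * ∫ w, (f (hybrid ∅ w) - f (hybrid {k} w)) ^ 2 ∂P := by
    intro A k hk
    have hi : ∀ B C D, Integrable
        (fun w => f (hybrid B w) * (f (hybrid C w) - f (hybrid D w))) P := fun B C D =>
      (hL B).integrable_mul ((hL C).sub (hL D))
    have hAk : symmDiff A {k} = insert k A := by
      ext i; by_cases h : i = k <;> simp [Finset.mem_symmDiff, h, hk]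
    have hAk' : symmDiff (insert k A) {k} = A := by
      ext i; by_cases h : i = k <;> simp [Finset.mem_symmDiff, h, hk]
    have hkA : symmDiff {k} A = insert k A := by rw [symmDiff_comm, hAk]
    have e0 : ∀ B : Finset ι, symmDiff ∅ B = B := fun B => by
      ext i; simp [Finset.mem_symmDiff]
    have e1 : ∫ w, f (hybrid ∅ w) * (f (hybrid A w) - f (hybrid (insert k A) w)) ∂P =
        ∫ w, f (hybrid {k} w) * (f (hybrid (insert k A) w) - f (hybrid A w)) ∂P := by
      rw [← integral_comp_swapOn {k} (hi _ _ _).aestronglyMeasurable]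
      simp only [hybrid_swapOn, hAk, hAk', e0, P]
    have e2 : ∫ w, (f (hybrid ∅ w) - f (hybrid {k} w)) ^ 2 ∂P =
        ∫ w, (f (hybrid A w) - f (hybrid (insert k A) w)) ^ 2 ∂P := by
      rw [← integral_comp_swapOn A (hsq _ _).aestronglyMeasurable]
      simp only [hybrid_swapOn, hkA, e0, P]
    have e3 : 2 * ∫ w, f (hybrid ∅ w) * (f (hybrid A w) - f (hybrid (insert k A) w)) ∂P =
        ∫ w, (f (hybrid ∅ w) - f (hybrid {k} w)) *
          (f (hybrid A w) - f (hybrid (insert k A) w)) ∂P := by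
      rw [two_mul]
      nth_rewrite 2 [e1]
      rw [← integral_add (hi _ _ _) (hi _ _ _)]
      congr 1; ext w; ring
    have e4 : ∫ w, (f (hybrid ∅ w) - f (hybrid {k} w)) *
          (f (hybrid A w) - f (hybrid (insert k A) w)) ∂P ≤
        ∫ w, ((1 / 2) * (f (hybrid ∅ w) - f (hybrid {k} w)) ^ 2 +
          (1 / 2) * (f (hybrid A w) - f (hybrid (insert k A) w)) ^ 2) ∂P := by
      refine integral_mono (((hL _).sub (hL _)).integrable_mul ((hL _).sub (hL _)))
        (((hsq _ _).const_mul _).add ((hsq _ _).const_mul _)) fun w => ?_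
      dsimp only
      nlinarith [sq_nonneg ((f (hybrid ∅ w) - f (hybrid {k} w)) -
        (f (hybrid A w) - f (hybrid (insert k A) w)))]
    rw [integral_add ((hsq _ _).const_mul _) ((hsq _ _).const_mul _), integral_const_mul,
      integral_const_mul, ← e2] at e4
    linarith
  have main : ∀ A : Finset ι, ∫ w, f (hybrid ∅ w) * (f (hybrid ∅ w) - f (hybrid A w)) ∂P ≤
      (1 / 2) * ∑ k ∈ A, ∫ w, (f (hybrid ∅ w) - f (hybrid {k} w)) ^ 2 ∂P := by
    intro A
    induction A using Finset.induction_on with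
    | empty => simp
    | insert k A hk ih =>
      rw [Finset.sum_insert hk, mul_add]
      have h1 := step A k hk
      simp only [mul_sub] at h1 ih ⊢
      rw [integral_sub (hmul _ _) (hmul _ _)] at h1 ih ⊢
      linarith
  have h := main Finset.univ
  simp only [mul_sub] at h
  rw [integral_sub (hmul _ _) (hmul _ _), integral_mul_hybrid_univ hf] at h
  have h0 : ∫ w, f (hybrid ∅ w) * f (hybrid ∅ w) ∂P = ∫ x, f x ^ 2 ∂(Measure.pi μ) := by
    rw [← integral_comp_hybrid ∅ hf.integrable_sq.aestronglyMeasurable]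
    simp only [sq, P]
  rw [h0] at h
  exact h

end ProductMeasure

section Calculus

/-- A function whose derivative grows at rate at most `b` lies below its quadratic Taylor
majorant. -/
lemma taylor_quadratic_upper {φ φ' : ℝ → ℝ} {b : ℝ} (hφ : ∀ t, HasDerivAt φ (φ' t) t)
    (hb : ∀ t s, t ≤ s → φ' s - φ' t ≤ b * (s - t)) (t r : ℝ) :
    φ (t + r) ≤ φ t + φ' t * r + b / 2 * r ^ 2 := by
  set g : ℝ → ℝ := fun r => φ t + φ' t * r + b / 2 * r ^ 2 - φ (t + r)
  have hg : ∀ r, HasDerivAt g (φ' t + b * r - φ' (t + r)) r := by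
    intro r
    have h1 := (hφ (t + r)).comp_const_add t r
    have h2 := (((hasDerivAt_id r).const_mul (φ' t)).const_add (φ t)).add
      (((hasDerivAt_id r).pow 2).const_mul (b / 2))
    convert! h2.sub h1 using 1
    simp; ring
  have hgc : Continuous g := continuous_iff_continuousAt.2 fun r => (hg r).continuousAt
  have hgd : ∀ r, deriv g r = φ' t + b * r - φ' (t + r) := fun r => (hg r).deriv
  have h0 : g 0 = 0 := by simp [g]
  suffices 0 ≤ g r by simp only [g] at this; linarith
  rcases le_total 0 r with hr | hr
  · have := monotoneOn_of_deriv_nonneg (convex_Ici 0) hgc.continuousOn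
      (fun r _ => (hg r).differentiableAt.differentiableWithinAt) (f := g) (fun r hr => by
        rw [interior_Ici] at hr
        rw [hgd]
        have := hb t (t + r) (by linarith [hr.out])
        nlinarith)
    have := this (Set.mem_Ici.2 le_rfl) (Set.mem_Ici.2 hr) hr
    linarith
  · have := antitoneOn_of_deriv_nonpos (convex_Iic 0) hgc.continuousOn
      (fun r _ => (hg r).differentiableAt.differentiableWithinAt) (f := g) (fun r hr => by
        rw [interior_Iic] at hr
        rw [hgd]
        have := hb (t + r) t (by linarith [hr.out])
        nlinarith)
    have := this (Set.mem_Iic.2 hr) (Set.mem_Iic.2 le_rfl) hr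
    linarith

lemma taylor_quadratic_lower {φ φ' : ℝ → ℝ} {a : ℝ} (hφ : ∀ t, HasDerivAt φ (φ' t) t)
    (ha : ∀ t s, t ≤ s → a * (s - t) ≤ φ' s - φ' t) (t r : ℝ) :
    φ t + φ' t * r + a / 2 * r ^ 2 ≤ φ (t + r) := by
  have := taylor_quadratic_upper (φ := fun t => -φ t) (φ' := fun t => -φ' t) (b := -a)
    (fun t => (hφ t).neg) (fun t s h => by linarith [ha t s h]) t r
  linarith

variable {m : ℕ}

lemma clm_apply_eq_sum_single (A : (Fin m → ℝ) →L[ℝ] ℝ) (v : Fin m → ℝ) :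
    A v = ∑ k, v k * A (Pi.single k 1) := by
  have h := LinearMap.pi_apply_eq_sum_univ A.toLinearMap v
  simp only [ContinuousLinearMap.coe_coe] at h
  rw [h]
  refine Finset.sum_congr rfl fun k _ => ?_
  have h1 : (fun j => if k = j then (1 : ℝ) else 0) = Pi.single k 1 := by
    ext j; simp [Pi.single_apply, eq_comm]
  rw [h1, smul_eq_mul]

lemma hasDerivAt_comp_update {f : (Fin m → ℝ) → ℝ} (hf : Differentiable ℝ f) (x : Fin m → ℝ)
    (i : Fin m) (t : ℝ) :
    HasDerivAt (fun t => f (Function.update x i t))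
      (fderiv ℝ f (Function.update x i t) (Pi.single i 1)) t :=
  (hf _).hasFDerivAt.comp_hasDerivAt t (hasDerivAt_update x i t)

lemma pderiv_eq_fderiv {f : (Fin m → ℝ) → ℝ} (hf : Differentiable ℝ f) (i : Fin m) :
    pderiv f i = fun x => fderiv ℝ f x (Pi.single i 1) := by
  ext x
  have := (hasDerivAt_comp_update hf x i (x i)).deriv
  rwa [Function.update_eq_self] at this

lemma hasDerivAt_comp_update_pderiv {f : (Fin m → ℝ) → ℝ} (hf : Differentiable ℝ f)
    (x : Fin m → ℝ) (i : Fin m) (t : ℝ) :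
    HasDerivAt (fun t => f (Function.update x i t)) (pderiv f i (Function.update x i t)) t := by
  rw [pderiv_eq_fderiv hf]
  exact hasDerivAt_comp_update hf x i t

lemma continuous_pderiv {f : (Fin m → ℝ) → ℝ} (hf : ContDiff ℝ 1 f) (i : Fin m) :
    Continuous (pderiv f i) := by
  rw [pderiv_eq_fderiv (hf.differentiable one_ne_zero)]
  exact (hf.continuous_fderiv one_ne_zero).clm_apply continuous_const

lemma exists_lipschitzWith_of_pderiv_bound {f : (Fin m → ℝ) → ℝ} (hf : Differentiable ℝ f)
    {C : ℝ} (hC : ∀ x i, |pderiv f i x| ≤ C) : ∃ K, LipschitzWith K f := by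
  refine ⟨Real.toNNReal (m * |C|), lipschitzWith_of_nnnorm_fderiv_le hf fun x => ?_⟩
  rw [← NNReal.coe_le_coe, Real.coe_toNNReal _ (by positivity), coe_nnnorm]
  refine ContinuousLinearMap.opNorm_le_bound _ (by positivity) fun v => ?_
  rw [clm_apply_eq_sum_single]
  calc ‖∑ i, v i * fderiv ℝ f x (Pi.single i 1)‖ ≤ ∑ i : Fin m, ‖v‖ * |C| := by
        refine norm_sum_le_of_le _ fun i _ => ?_
        rw [norm_mul]
        have h2 := hC x i
        rw [pderiv_eq_fderiv hf] at h2
        exact mul_le_mul (norm_le_pi_norm v i) (h2.trans (le_abs_self C)) (norm_nonneg _)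
          (norm_nonneg _)
    _ = m * |C| * ‖v‖ := by simp; ring

end Calculus

section Hessian

variable {m : ℕ} {V : (Fin m → ℝ) → ℝ} {α L : ℝ}

lemma contDiff_pderiv (hV : ContDiff ℝ 2 V) (i : Fin m) : ContDiff ℝ 1 (pderiv V i) := by
  rw [pderiv_eq_fderiv (hV.differentiable two_ne_zero)]
  exact (hV.fderiv_right (m := 1) le_rfl).clm_apply contDiff_const

lemma pderiv_pderiv_eq (hV : ContDiff ℝ 2 V) (i k : Fin m) (x : Fin m → ℝ) :
    pderiv (pderiv V i) k x = fderiv ℝ (fderiv ℝ V) x (Pi.single k 1) (Pi.single i 1) := by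
  rw [pderiv_eq_fderiv ((contDiff_pderiv hV i).differentiable one_ne_zero),
    pderiv_eq_fderiv (hV.differentiable two_ne_zero)]
  have h1 : DifferentiableAt ℝ (fderiv ℝ V) x :=
    (hV.fderiv_right (m := 1) le_rfl).differentiable one_ne_zero x
  dsimp only
  rw [fderiv_clm_apply h1 (differentiableAt_const _)]
  simp

lemma pderiv_update_sub_bounds (hV : ContDiff ℝ 2 V)
    (hHess : ∀ x v : Fin m → ℝ,
      α * ∑ i, v i ^ 2 ≤ fderiv ℝ (fderiv ℝ V) x v v ∧
      fderiv ℝ (fderiv ℝ V) x v v ≤ L * ∑ i, v i ^ 2)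
    (x : Fin m → ℝ) (i : Fin m) (t s : ℝ) (hts : t ≤ s) :
    α * (s - t) ≤ pderiv V i (Function.update x i s) - pderiv V i (Function.update x i t) ∧
    pderiv V i (Function.update x i s) - pderiv V i (Function.update x i t) ≤ L * (s - t) := by
  have hd := hasDerivAt_comp_update_pderiv
    ((contDiff_pderiv hV i).differentiable one_ne_zero) x i
  have hsum : ∑ j, (Pi.single i (1 : ℝ) : Fin m → ℝ) j ^ 2 = 1 := by
    simp [Pi.single_apply]
  have hb : ∀ y, α ≤ pderiv (pderiv V i) i y ∧ pderiv (pderiv V i) i y ≤ L := fun y => by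
    have := hHess y (Pi.single i 1)
    rwa [hsum, mul_one, mul_one, ← pderiv_pderiv_eq hV] at this
  exact ⟨mul_sub_le_image_sub_of_le_deriv (fun t => (hd t).differentiableAt)
      (fun t => by rw [(hd t).deriv]; exact (hb _).1) hts,
    image_sub_le_mul_sub_of_deriv_le (fun t => (hd t).differentiableAt)
      (fun t => by rw [(hd t).deriv]; exact (hb _).2) hts⟩

lemma potential_update_bounds (hV : ContDiff ℝ 2 V)
    (hHess : ∀ x v : Fin m → ℝ,
      α * ∑ i, v i ^ 2 ≤ fderiv ℝ (fderiv ℝ V) x v v ∧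
      fderiv ℝ (fderiv ℝ V) x v v ≤ L * ∑ i, v i ^ 2)
    (x : Fin m → ℝ) (i : Fin m) (r : ℝ) :
    V x + pderiv V i x * r + α / 2 * r ^ 2 ≤ V (Function.update x i (x i + r)) ∧
    V (Function.update x i (x i + r)) ≤ V x + pderiv V i x * r + L / 2 * r ^ 2 := by
  have hd := hasDerivAt_comp_update_pderiv (hV.differentiable two_ne_zero) x i
  have h1 := taylor_quadratic_lower hd
    (fun t s h => (pderiv_update_sub_bounds hV hHess x i t s h).1) (x i) r
  have h2 := taylor_quadratic_upper hd
    (fun t s h => (pderiv_update_sub_bounds hV hHess x i t s h).2) (x i) r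
  simp only [Function.update_eq_self] at h1 h2
  exact ⟨h1, h2⟩

/-- Each row of the Hessian has Euclidean norm at most `L`. -/
lemma sum_pderiv_pderiv_sq_le (hα : 0 < α) (hαL : α ≤ L) (hV : ContDiff ℝ 2 V)
    (hHess : ∀ x v : Fin m → ℝ,
      α * ∑ i, v i ^ 2 ≤ fderiv ℝ (fderiv ℝ V) x v v ∧
      fderiv ℝ (fderiv ℝ V) x v v ≤ L * ∑ i, v i ^ 2)
    (x : Fin m → ℝ) (i : Fin m) :
    ∑ k, pderiv (pderiv V i) k x ^ 2 ≤ L ^ 2 := by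
  set H := fderiv ℝ (fderiv ℝ V) x
  set e : Fin m → ℝ := Pi.single i 1
  set v : Fin m → ℝ := fun k => pderiv (pderiv V i) k x
  have hL : 0 < L := hα.trans_le hαL
  have hsymm : ∀ a b, H a b = H b a := fun a b =>
    (hV.contDiffAt.isSymmSndFDerivAt (by simp)).eq a b
  have hve : H v e = ∑ k, v k ^ 2 := by
    have h := clm_apply_eq_sum_single (H.flip e) v
    simp only [ContinuousLinearMap.flip_apply] at h
    rw [h]
    refine Finset.sum_congr rfl fun k _ => ?_
    rw [← pderiv_pderiv_eq hV, sq]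
  set s := ∑ k, v k ^ 2
  have hsum : ∑ j, e j ^ 2 = 1 := by simp [e, Pi.single_apply]
  have hee : H e e ≤ L := by simpa [hsum] using (hHess x e).2
  have hvv : H v v ≤ L * s := (hHess x v).2
  have hpos : 0 ≤ H (v - (s / L) • e) (v - (s / L) • e) :=
    le_trans (mul_nonneg hα.le (Finset.sum_nonneg fun _ _ => sq_nonneg _)) (hHess x _).1
  have hexp : H (v - (s / L) • e) (v - (s / L) • e) =
      H v v - 2 * (s / L) * s + (s / L) ^ 2 * H e e := by
    simp only [map_sub, map_smul, sub_apply, smul_apply,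
      smul_eq_mul, hsymm e v, hve]
    ring
  have h1 : (s / L) ^ 2 * H e e ≤ (s / L) ^ 2 * L :=
    mul_le_mul_of_nonneg_left hee (sq_nonneg _)
  have h2 : 0 ≤ L * s - s ^ 2 / L := by
    have : L * s - 2 * (s / L) * s + (s / L) ^ 2 * L = L * s - s ^ 2 / L := by
      field_simp; ring
    linarith
  have hs0 : 0 ≤ s := Finset.sum_nonneg fun _ _ => sq_nonneg _
  rw [sub_nonneg, div_le_iff₀ hL] at h2
  show s ≤ L ^ 2
  rcases hs0.eq_or_lt with h | h
  · rw [← h]; positivity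
  · nlinarith

/-- A strongly convex potential dominates a quadratic. -/
lemma exists_quadratic_le_potential (hα : 0 < α) (hV : ContDiff ℝ 2 V)
    (hHess : ∀ x v : Fin m → ℝ,
      α * ∑ i, v i ^ 2 ≤ fderiv ℝ (fderiv ℝ V) x v v ∧
      fderiv ℝ (fderiv ℝ V) x v v ≤ L * ∑ i, v i ^ 2) :
    ∃ c, ∀ x, c + α / 4 * ∑ i, x i ^ 2 ≤ V x := by
  have hd : Differentiable ℝ V := hV.differentiable two_ne_zero
  refine ⟨V 0 - ∑ i, (pderiv V i 0) ^ 2 / α, fun x => ?_⟩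
  have hline : ∀ t : ℝ, HasDerivAt (fun t : ℝ => t • x) x t := fun t => by
    have h := (hasDerivAt_id t).smul_const x
    rw [one_smul] at h
    exact h
  have hφ : ∀ t : ℝ, HasDerivAt (fun t : ℝ => V (t • x)) (fderiv ℝ V (t • x) x) t := fun t =>
    (hd _).hasFDerivAt.comp_hasDerivAt t (hline t)
  have hφ' : ∀ t : ℝ, HasDerivAt (fun t : ℝ => fderiv ℝ V (t • x) x)
      (fderiv ℝ (fderiv ℝ V) (t • x) x x) t := fun t => by
    have h1 : DifferentiableAt ℝ (fderiv ℝ V) (t • x) :=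
      (hV.fderiv_right (m := 1) le_rfl).differentiable one_ne_zero _
    have h2 : HasDerivAt (fun t : ℝ => fderiv ℝ V (t • x)) (fderiv ℝ (fderiv ℝ V) (t • x) x) t :=
      h1.hasFDerivAt.comp_hasDerivAt t (hline t)
    have h3 := h2.clm_apply (hasDerivAt_const t x)
    rw [map_zero, add_zero] at h3
    exact h3
  have h := taylor_quadratic_lower hφ (a := α * ∑ i, x i ^ 2) (fun t s hts =>
    mul_sub_le_image_sub_of_le_deriv (fun t => (hφ' t).differentiableAt)
      (fun t => by rw [(hφ' t).deriv]; exact (hHess _ _).1) hts) 0 1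
  have hlin : fderiv ℝ V 0 x = ∑ i, x i * pderiv V i 0 := by
    rw [clm_apply_eq_sum_single]
    simp only [pderiv_eq_fderiv hd]
  have hyoung : ∑ i, (-(α / 4 * x i ^ 2) - (pderiv V i 0) ^ 2 / α) ≤
      ∑ i, x i * pderiv V i 0 := by
    refine Finset.sum_le_sum fun i _ => ?_
    have : 0 ≤ (α / 2 * x i + pderiv V i 0) ^ 2 / α := by positivity
    have h2 : (α / 2 * x i + pderiv V i 0) ^ 2 / α =
      α / 4 * x i ^ 2 + x i * pderiv V i 0 + (pderiv V i 0) ^ 2 / α := by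
      field_simp; ring
    linarith
  rw [Finset.sum_sub_distrib, Finset.sum_neg_distrib, ← Finset.mul_sum] at hyoung
  simp only [zero_smul, zero_add, one_smul, hlin] at h
  linarith

end Hessian

section KL

lemma KL_withDensity {E : Type*} [MeasurableSpace E] {p q : Measure E} [SigmaFinite p]
    {F : E → ℝ≥0∞} (hF : Measurable F) (hq : q = p.withDensity F) {G : E → ℝ}
    (hG : Integrable G q) (hFG : ∀ᵐ x ∂q, Real.log (F x).toReal = G x) :
    KL q p = ((∫ x, G x ∂q : ℝ) : EReal) := by
  have hqp : q ≪ p := hq ▸ withDensity_absolutelyContinuous _ _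
  have h : (fun x => Real.log ((q.rnDeriv p x).toReal)) =ᵐ[q] G := by
    have h1 : q.rnDeriv p =ᵐ[q] F := hqp.ae_le (hq ▸ Measure.rnDeriv_withDensity p hF)
    filter_upwards [h1, hFG] with x h1 h2
    rw [h1, h2]
  rw [KL, if_pos ⟨hqp, hG.congr h.symm⟩, integral_congr_ae h]

end KL

section Target

variable {m : ℕ} {V : (Fin m → ℝ) → ℝ} {a c : ℝ}

/-- The Lebesgue density of `target V`. -/
def targetDensity (V : (Fin m → ℝ) → ℝ) (x : Fin m → ℝ) : ℝ :=
  Real.exp (-V x) / ∫ y, Real.exp (-V y)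

lemma target_eq_withDensity (V : (Fin m → ℝ) → ℝ) :
    target V = volume.withDensity fun x => ENNReal.ofReal (targetDensity V x) := rfl

lemma integrable_exp_quadratic_sub_potential (hV : Continuous V) (ha : 0 < a)
    (hc : ∀ x, c + 2 * a * ∑ i, x i ^ 2 ≤ V x) :
    Integrable (fun x => Real.exp (a * ∑ i, x i ^ 2 - V x)) volume := by
  have h1 : Integrable (fun x : Fin m → ℝ => ∏ i, Real.exp (-a * x i ^ 2)) volume :=
    Integrable.fintype_prod (μ := fun _ => volume) fun _ => integrable_exp_neg_mul_sq ha
  refine (h1.const_mul (Real.exp (-c))).mono' (by fun_prop) (ae_of_all _ fun x => ?_)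
  rw [Real.norm_eq_abs, abs_of_pos (Real.exp_pos _), ← Real.exp_sum, ← Real.exp_add,
    Real.exp_le_exp, ← Finset.mul_sum]
  linarith [hc x]

lemma integrable_exp_neg_potential (hV : Continuous V) (ha : 0 < a)
    (hc : ∀ x, c + 2 * a * ∑ i, x i ^ 2 ≤ V x) :
    Integrable (fun x => Real.exp (-V x)) volume := by
  refine (integrable_exp_quadratic_sub_potential hV ha hc).mono' (by fun_prop)
    (ae_of_all _ fun x => ?_)
  rw [Real.norm_eq_abs, abs_of_pos (Real.exp_pos _), Real.exp_le_exp]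
  have : 0 ≤ a * ∑ i, x i ^ 2 := by positivity
  linarith

lemma normalization_pos (hV : Continuous V) (ha : 0 < a)
    (hc : ∀ x, c + 2 * a * ∑ i, x i ^ 2 ≤ V x) : 0 < ∫ y, Real.exp (-V y) :=
  integral_exp_pos (integrable_exp_neg_potential hV ha hc)

lemma measurable_targetDensity (hV : Continuous V) : Measurable (targetDensity V) :=
  ((Real.continuous_exp.comp hV.neg).div_const _).measurable

lemma isFiniteMeasure_target (hV : Continuous V) (ha : 0 < a)
    (hc : ∀ x, c + 2 * a * ∑ i, x i ^ 2 ≤ V x) : IsFiniteMeasure (target V) :=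
  isFiniteMeasure_withDensity_ofReal ((integrable_exp_neg_potential hV ha hc).div_const _).2

/-- Finite relative entropy with respect to the target forces finite second moments. -/
lemma integrable_sum_sq_of_KL_finite (hV : Continuous V) (ha : 0 < a)
    (hc : ∀ x, c + 2 * a * ∑ i, x i ^ 2 ≤ V x) {q : Measure (Fin m → ℝ)} [IsFiniteMeasure q]
    (hqp : q ≪ target V)
    (hlog : Integrable (fun x => Real.log ((q.rnDeriv (target V) x).toReal)) q) :
    Integrable (fun x => ∑ i, x i ^ 2) q := by
  set p := target V with hp
  have hfin : IsFiniteMeasure p := isFiniteMeasure_target hV ha hc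
  have hleb : q.HaveLebesgueDecomposition p :=
    Measure.haveLebesgueDecomposition_of_sigmaFinite q p
  set g : (Fin m → ℝ) → ℝ := fun x => a * ∑ i, x i ^ 2 with hg
  have hgc : Continuous g := by fun_prop
  have hgp : Integrable (fun x => Real.exp (g x)) p := by
    rw [hp, target_eq_withDensity, integrable_withDensity_iff_integrable_smul'
      (measurable_targetDensity hV).ennreal_ofReal (ae_of_all _ fun _ => ENNReal.ofReal_lt_top)]
    refine ((integrable_exp_quadratic_sub_potential hV ha hc).div_const
      (∫ y, Real.exp (-V y))).congr (ae_of_all _ fun x => ?_)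
    dsimp only
    rw [targetDensity,
      ENNReal.toReal_ofReal (div_nonneg (Real.exp_pos _).le (normalization_pos hV ha hc).le),
      smul_eq_mul, sub_eq_neg_add, Real.exp_add]
    ring
  have hquot : Integrable
      (fun x => Real.exp (g x) * ((q.rnDeriv p x).toReal)⁻¹) q := by
    rw [← integrable_rnDeriv_smul_iff hqp]
    have hm := (Measure.measurable_rnDeriv q p).ennreal_toReal
    refine hgp.mono' ?_ (ae_of_all _ fun x => ?_)
    · exact (hm.smul ((Real.measurable_exp.comp hgc.measurable).mul hm.inv)).aestronglyMeasurable
    · rw [smul_eq_mul, Real.norm_eq_abs, abs_of_nonneg (by positivity)]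
      by_cases h : (q.rnDeriv p x).toReal = 0
      · rw [h]; simp [(Real.exp_pos _).le]
      · rw [mul_left_comm, mul_inv_cancel₀ h, mul_one]
  have hgq : Integrable g q := by
    refine (hlog.add hquot).mono' hgc.aestronglyMeasurable ?_
    filter_upwards [Measure.rnDeriv_pos hqp, hqp.ae_le (Measure.rnDeriv_lt_top q p)] with x h0 h1
    have hf : 0 < (q.rnDeriv p x).toReal := ENNReal.toReal_pos h0.ne' h1.ne
    rw [Real.norm_eq_abs, abs_of_nonneg (by positivity)]
    have := Real.add_one_le_exp (g x - Real.log (q.rnDeriv p x).toReal)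
    rw [Real.exp_sub, Real.exp_log hf, div_eq_mul_inv] at this
    simp only [Pi.add_apply]
    linarith
  refine (hgq.const_mul a⁻¹).congr (ae_of_all _ fun x => ?_)
  simp only [hg]
  field_simp

/-- The mean-field family contains a measure of finite divergence from the target. -/
lemma exists_meanField_KL_ne_top (hV : Continuous V) (ha : 0 < a)
    (hc : ∀ x, c + 2 * a * ∑ i, x i ^ 2 ≤ V x) :
    ∃ q ∈ meanField m, KL q (target V) ≠ ⊤ := by
  have := isFiniteMeasure_target hV ha hc
  have hZ := normalization_pos hV ha hc
  set S : Set (Fin m → ℝ) := Set.univ.pi fun _ => Set.Icc (0 : ℝ) 1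
  have hSm : MeasurableSet S := MeasurableSet.univ_pi fun _ => measurableSet_Icc
  have hSc : IsCompact S := isCompact_univ_pi fun _ => isCompact_Icc
  have hdc : Continuous (targetDensity V) := (Real.continuous_exp.comp hV.neg).div_const _
  have hdpos : ∀ x, 0 < targetDensity V x := fun x => div_pos (Real.exp_pos _) hZ
  set F : (Fin m → ℝ) → ℝ≥0∞ :=
    S.indicator fun x => ENNReal.ofReal (targetDensity V x)⁻¹
  have hFm : Measurable F := (measurable_targetDensity hV).inv.ennreal_ofReal.indicator hSm
  have hq : volume.restrict S = (target V).withDensity F := by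
    rw [target_eq_withDensity, ← withDensity_mul _ (measurable_targetDensity hV).ennreal_ofReal hFm,
      ← withDensity_indicator_one hSm]
    congr 1
    ext x
    by_cases hx : x ∈ S
    · simp only [F, Pi.mul_apply, Set.indicator_of_mem hx, Pi.one_apply]
      rw [← ENNReal.ofReal_mul (hdpos x).le, mul_inv_cancel₀ (hdpos x).ne', ENNReal.ofReal_one]
    · simp [F, hx]
  have hlc : Continuous fun x => Real.log (targetDensity V x)⁻¹ :=
    (hdc.inv₀ fun x => (hdpos x).ne').log fun x => (inv_pos.2 (hdpos x)).ne'
  refine ⟨volume.restrict S, ⟨fun _ => volume.restrict (Set.Icc 0 1), fun _ => ⟨by simp⟩,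
    fun _ => Measure.absolutelyContinuous_of_le Measure.restrict_le_self, ?_⟩, ?_⟩
  · exact Measure.restrict_pi_pi (fun _ => volume) _
  · rw [KL_withDensity hFm hq (hlc.continuousOn.integrableOn_compact hSc) ?_]
    · exact EReal.coe_ne_top _
    · filter_upwards [ae_restrict_mem hSm] with x hx
      simp only [F, Set.indicator_of_mem hx]
      rw [ENNReal.toReal_ofReal (inv_pos.2 (hdpos x)).le]

end Target

section Transport

variable {τ τ' : ℝ → ℝ}

lemma strictMono_of_half_le_deriv (hτ : ∀ x, HasDerivAt τ (τ' x) x) (hpos : ∀ x, 1 / 2 ≤ τ' x) :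
    StrictMono τ :=
  strictMono_of_deriv_pos fun x => by rw [(hτ x).deriv]; linarith [hpos x]

lemma surjective_of_half_le_deriv (hτ : ∀ x, HasDerivAt τ (τ' x) x) (hpos : ∀ x, 1 / 2 ≤ τ' x) :
    Function.Surjective τ := by
  have hb : ∀ x y, x ≤ y → 1 / 2 * (y - x) ≤ τ y - τ x := fun x y h =>
    mul_sub_le_image_sub_of_le_deriv (fun t => (hτ t).differentiableAt)
      (fun t => by rw [(hτ t).deriv]; exact hpos t) h
  refine (continuous_iff_continuousAt.2 fun x => (hτ x).continuousAt).surjective ?_ ?_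
  · refine Filter.tendsto_atTop.2 fun b => ?_
    filter_upwards [Filter.eventually_ge_atTop 0,
      Filter.eventually_ge_atTop (2 * (b - τ 0))] with x h0 h1
    linarith [hb 0 x h0]
  · refine Filter.tendsto_atBot.2 fun b => ?_
    filter_upwards [Filter.eventually_le_atBot 0,
      Filter.eventually_le_atBot (2 * (b - τ 0))] with x h0 h1
    linarith [hb x 0 h0]

lemma lintegral_deriv_mul_comp (hτ : ∀ x, HasDerivAt τ (τ' x) x) (hpos : ∀ x, 1 / 2 ≤ τ' x)
    (G : ℝ → ℝ≥0∞) : ∫⁻ x, ENNReal.ofReal (τ' x) * G (τ x) = ∫⁻ y, G y := by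
  have h := lintegral_image_eq_lintegral_abs_deriv_mul MeasurableSet.univ
    (fun x _ => (hτ x).hasDerivWithinAt) (strictMono_of_half_le_deriv hτ hpos).injective.injOn G
  rw [Set.image_univ, (surjective_of_half_le_deriv hτ hpos).range_eq, setLIntegral_univ,
    setLIntegral_univ] at h
  rw [h]
  exact lintegral_congr fun x => by rw [abs_of_nonneg (by linarith [hpos x])]

lemma map_absolutelyContinuous_volume (hτ : ∀ x, HasDerivAt τ (τ' x) x)
    (hτ'c : Continuous τ') (hpos : ∀ x, 1 / 2 ≤ τ' x) {ν : Measure ℝ} (hν : ν ≪ volume) :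
    ν.map τ ≪ volume := by
  have hc : Continuous τ := continuous_iff_continuousAt.2 fun x => (hτ x).continuousAt
  refine Measure.AbsolutelyContinuous.mk fun s hs h0 => ?_
  rw [Measure.map_apply hc.measurable hs]
  refine hν ?_
  have h := lintegral_deriv_mul_comp hτ hpos (s.indicator 1)
  have hm : Measurable fun x => ENNReal.ofReal (τ' x) * s.indicator (1 : ℝ → ℝ≥0∞) (τ x) :=
    hτ'c.measurable.ennreal_ofReal.mul ((measurable_one.indicator hs).comp hc.measurable)
  rw [lintegral_indicator_one hs, h0, lintegral_eq_zero_iff hm] at h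
  refine measure_mono_null ?_ (ae_iff.1 h)
  intro x hx
  have hx' : τ x ∈ s := hx
  have := hpos x
  simp [hx']
  linarith

variable {m : ℕ}

/-- Apply a map to a single coordinate. -/
def coordMap (k : Fin m) (τ : ℝ → ℝ) (x : Fin m → ℝ) : Fin m → ℝ :=
  Function.update x k (τ (x k))

lemma measurable_coordMap (k : Fin m) (hτ : Measurable τ) : Measurable (coordMap k τ) :=
  measurable_update'.comp (measurable_id.prodMk (hτ.comp (measurable_pi_apply k)))

lemma lintegral_coordMap (hτ : ∀ x, HasDerivAt τ (τ' x) x) (hτ'c : Continuous τ')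
    (hpos : ∀ x, 1 / 2 ≤ τ' x) (k : Fin m) {G : (Fin m → ℝ) → ℝ≥0∞} (hG : Measurable G) :
    ∫⁻ x, ENNReal.ofReal (τ' (x k)) * G (coordMap k τ x) = ∫⁻ y, G y := by
  have hc : Continuous τ := continuous_iff_continuousAt.2 fun x => (hτ x).continuousAt
  refine lintegral_eq_of_lmarginal_eq (μ := fun _ : Fin m => (volume : Measure ℝ)) {k}
    ((hτ'c.measurable.comp (measurable_pi_apply k)).ennreal_ofReal.mul
      (hG.comp (measurable_coordMap k hc.measurable))) hG ?_
  rw [lmarginal_singleton, lmarginal_singleton]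
  ext x
  simp only [coordMap, Function.update_self, Function.update_idem]
  exact lintegral_deriv_mul_comp hτ hpos fun t => G (Function.update x k t)

lemma map_coordMap_mem_meanField (hτ : ∀ x, HasDerivAt τ (τ' x) x)
    (hτ'c : Continuous τ') (hpos : ∀ x, 1 / 2 ≤ τ' x) (k : Fin m) {q : Measure (Fin m → ℝ)}
    (hq : q ∈ meanField m) : q.map (coordMap k τ) ∈ meanField m := by
  obtain ⟨qi, hprob, hac, rfl⟩ := hq
  have hc : Continuous τ := continuous_iff_continuousAt.2 fun x => (hτ x).continuousAt
  set f : Fin m → ℝ → ℝ := fun i => if i = k then τ else id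
  have hfm : ∀ i, Measurable (f i) := fun i => by
    by_cases h : i = k
    · simpa [f, h] using hc.measurable
    · simpa [f, h] using measurable_id
  have hp : ∀ i, IsProbabilityMeasure ((qi i).map (f i)) := fun i =>
    Measure.isProbabilityMeasure_map (hfm i).aemeasurable
  refine ⟨fun i => (qi i).map (f i), hp, fun i => ?_, ?_⟩
  · by_cases h : i = k
    · simpa [f, h] using map_absolutelyContinuous_volume hτ hτ'c hpos (hac k)
    · simpa [f, h] using hac i
  · rw [← Measure.pi_map_pi fun i => (hfm i).aemeasurable]
    congr 1
    ext x i
    by_cases h : i = k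
    · subst h; simp [coordMap, f]
    · simp [coordMap, f, h]

/-- The divergence from the target after transporting one coordinate. -/
lemma KL_map_coordMap {V : (Fin m → ℝ) → ℝ} (hV : Continuous V) [IsFiniteMeasure (target V)]
    (hZ : 0 < ∫ y, Real.exp (-V y))
    (hτ : ∀ x, HasDerivAt τ (τ' x) x) (hτ'c : Continuous τ') (hpos : ∀ x, 1 / 2 ≤ τ' x)
    (k : Fin m) {q : Measure (Fin m → ℝ)} [IsFiniteMeasure q] (hqp : q ≪ target V)
    (hlog : Integrable (fun x => Real.log ((q.rnDeriv (target V) x).toReal)) q)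
    (hVi : Integrable (fun x => V (coordMap k τ x) - V x) q)
    (hτi : Integrable (fun x => Real.log (τ' (x k))) q) :
    KL (q.map (coordMap k τ)) (target V) =
      ((∫ x, Real.log ((q.rnDeriv (target V) x).toReal) ∂q +
        ∫ x, (V (coordMap k τ x) - V x) ∂q - ∫ x, Real.log (τ' (x k)) ∂q : ℝ) : EReal) := by
  have hc : Continuous τ := continuous_iff_continuousAt.2 fun x => (hτ x).continuousAt
  have hT := measurable_coordMap k hc.measurable
  obtain ⟨σ, hστ, hτσ⟩ := Function.bijective_iff_has_inverse.1
    ⟨(strictMono_of_half_le_deriv hτ hpos).injective, surjective_of_half_le_deriv hτ hpos⟩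
  have hσm : Measurable σ := by
    refine Monotone.measurable fun a b hab => ?_
    rw [← (strictMono_of_half_le_deriv hτ hpos).le_iff_le, hτσ, hτσ]
    exact hab
  have hS := measurable_coordMap k hσm
  have hST : ∀ x, coordMap k σ (coordMap k τ x) = x := fun x => by simp [coordMap, hστ _]
  have hτpos : ∀ x, 0 < τ' x := fun x => by linarith [hpos x]
  set p := target V
  have hleb : q.HaveLebesgueDecomposition p :=
    Measure.haveLebesgueDecomposition_of_sigmaFinite q p
  set f := q.rnDeriv p
  set E : (Fin m → ℝ) → ℝ := fun x => Real.exp (V (coordMap k τ x) - V x) / τ' (x k)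
  have hEpos : ∀ x, 0 < E x := fun x => div_pos (Real.exp_pos _) (hτpos _)
  have hEm : Measurable E :=
    (((hV.measurable.comp hT).sub hV.measurable).exp).div
      (hτ'c.measurable.comp (measurable_pi_apply k))
  set F : (Fin m → ℝ) → ℝ≥0∞ :=
    fun y => f (coordMap k σ y) * ENNReal.ofReal (E (coordMap k σ y))
  have hfm : Measurable f := Measure.measurable_rnDeriv q p
  have hFm : Measurable F := (hfm.comp hS).mul (hEm.comp hS).ennreal_ofReal
  have hρm := (measurable_targetDensity hV).ennreal_ofReal
  have hq : q.map (coordMap k τ) = p.withDensity F := by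
    refine Measure.ext_of_lintegral _ fun G hG => ?_
    rw [lintegral_map hG hT, lintegral_withDensity_eq_lintegral_mul _ hFm hG]
    have h1 : ∫⁻ x, G (coordMap k τ x) ∂q = ∫⁻ x, f x * G (coordMap k τ x) ∂p := by
      conv_lhs => rw [← Measure.withDensity_rnDeriv_eq q p hqp]
      exact lintegral_withDensity_eq_lintegral_mul _ hfm (hG.comp hT)
    rw [h1]
    refine (lintegral_withDensity_eq_lintegral_mul _ hρm (hfm.mul (hG.comp hT))).trans ?_
    refine Eq.trans ?_ (lintegral_withDensity_eq_lintegral_mul _ hρm (hFm.mul hG)).symm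
    refine Eq.trans ?_ (lintegral_coordMap hτ hτ'c hpos k (hρm.mul (hFm.mul hG)))
    refine lintegral_congr fun x => ?_
    simp only [Pi.mul_apply, Function.comp_apply, F, hST]
    have h2 : ENNReal.ofReal (τ' (x k)) * (ENNReal.ofReal (targetDensity V (coordMap k τ x)) *
        ENNReal.ofReal (E x)) = ENNReal.ofReal (targetDensity V x) := by
      have hd : 0 ≤ targetDensity V (coordMap k τ x) := div_nonneg (Real.exp_pos _).le hZ.le
      rw [← ENNReal.ofReal_mul hd, ← ENNReal.ofReal_mul (hτpos _).le]
      congr 1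
      have := (hτpos (x k)).ne'
      simp only [targetDensity, E, Real.exp_sub, Real.exp_neg]
      field_simp
    rw [← h2]
    ring
  have hG : Integrable (fun x => Real.log (f x).toReal + (V (coordMap k τ x) - V x) -
      Real.log (τ' (x k))) q := (hlog.add hVi).sub hτi
  have hmap : MeasurePreserving (coordMap k τ) q (q.map (coordMap k τ)) := ⟨hT, rfl⟩
  set G : (Fin m → ℝ) → ℝ := fun y => Real.log (f (coordMap k σ y)).toReal +
    (V y - V (coordMap k σ y)) - Real.log (τ' (coordMap k σ y k))
  have hGm : Measurable G :=
    (((hfm.comp hS).ennreal_toReal.log).add (hV.measurable.sub (hV.measurable.comp hS))).sub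
      (hτ'c.measurable.comp ((measurable_pi_apply k).comp hS)).log
  have hGT : ∀ x, G (coordMap k τ x) = Real.log (f x).toReal + (V (coordMap k τ x) - V x) -
      Real.log (τ' (x k)) := fun x => by simp only [G, hST]
  have hGi : Integrable G (q.map (coordMap k τ)) := by
    rw [integrable_map_measure hGm.aestronglyMeasurable hT.aemeasurable]
    exact hG.congr (ae_of_all _ fun x => (hGT x).symm)
  rw [KL_withDensity hFm hq hGi, integral_map hT.aemeasurable hGm.aestronglyMeasurable]
  · simp only [hGT]
    exact congrArg _ ((integral_sub (hlog.add hVi) hτi).trans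
      (congrArg (· - _) (integral_add hlog hVi)))
  · rw [ae_map_iff hT.aemeasurable (measurableSet_eq_fun hFm.ennreal_toReal.log hGm)]
    filter_upwards [Measure.rnDeriv_pos hqp, hqp.ae_le (Measure.rnDeriv_lt_top q p)] with x h0 h1
    rw [hGT]
    have hf : 0 < (f x).toReal := ENNReal.toReal_pos h0.ne' h1.ne
    simp only [F, hST, ENNReal.toReal_mul, ENNReal.toReal_ofReal (hEpos x).le]
    rw [Real.log_mul hf.ne' (hEpos x).ne', Real.log_div (Real.exp_pos _).ne' (hτpos _).ne',
      Real.log_exp]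
    ring

end Transport

section Stein

variable {m : ℕ}

lemma memLp_two_of_lipschitzWith {q : Measure (Fin m → ℝ)} [IsFiniteMeasure q]
    (hq2 : Integrable (fun x => ∑ i, x i ^ 2) q) {f : (Fin m → ℝ) → ℝ} {K : NNReal}
    (hf : LipschitzWith K f) : MemLp f 2 q := by
  rw [memLp_two_iff_integrable_sq hf.continuous.aestronglyMeasurable]
  refine ((integrable_const (2 * f 0 ^ 2)).add (hq2.const_mul (2 * (K : ℝ) ^ 2))).mono'
    (hf.continuous.pow 2).aestronglyMeasurable (ae_of_all _ fun x => ?_)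
  rw [Real.norm_eq_abs, abs_of_nonneg (sq_nonneg _), Pi.add_apply]
  have h1 : |f x - f 0| ≤ K * ‖x‖ := by simpa [Real.dist_eq] using hf.dist_le_mul x 0
  have h2 : ‖x‖ ^ 2 ≤ ∑ i, x i ^ 2 := by
    have hs : 0 ≤ ∑ i, x i ^ 2 := Finset.sum_nonneg fun i _ => sq_nonneg _
    refine (Real.le_sqrt (norm_nonneg _) hs).1 ?_
    refine (pi_norm_le_iff_of_nonneg (Real.sqrt_nonneg _)).2 fun i => ?_
    exact Real.abs_le_sqrt (Finset.single_le_sum (f := fun i => x i ^ 2)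
      (fun i _ => sq_nonneg _) (Finset.mem_univ i))
  have h3 : (f x - f 0) ^ 2 ≤ K ^ 2 * ‖x‖ ^ 2 := by
    rw [← mul_pow, ← sq_abs]
    exact pow_le_pow_left₀ (abs_nonneg _) h1 2
  nlinarith [sq_nonneg (f x - 2 * f 0), mul_le_mul_of_nonneg_left h2 (sq_nonneg (K : ℝ))]

lemma eq_zero_of_forall_abs_le_quadratic_nonneg {A B δ : ℝ} (hδ : 0 < δ)
    (h : ∀ t, |t| ≤ δ → 0 ≤ t * A + t ^ 2 * B) : A = 0 := by
  have hd : HasDerivAt (fun t : ℝ => t * A + t ^ 2 * B) A 0 := by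
    have := ((hasDerivAt_id (0 : ℝ)).mul_const A).add ((hasDerivAt_pow 2 (0 : ℝ)).mul_const B)
    exact this.congr_deriv (by simp)
  refine IsLocalMin.hasDerivAt_eq_zero ?_ hd
  filter_upwards [Metric.closedBall_mem_nhds (0 : ℝ) hδ] with t ht
  simpa using h t (by simpa using ht)

lemma sub_two_mul_sq_le_log_one_add {u : ℝ} (hu : |u| ≤ 1 / 2) :
    u - 2 * u ^ 2 ≤ Real.log (1 + u) := by
  have h := abs_le.1 hu
  have hpos : 0 < 1 + u := by linarith
  refine le_trans ?_ (Real.one_sub_inv_le_log_of_pos hpos)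
  rw [← sub_nonneg]
  have : 1 - (1 + u)⁻¹ - (u - 2 * u ^ 2) = u ^ 2 * (1 + 2 * u) / (1 + u) := by
    field_simp
    ring
  rw [this]
  exact div_nonneg (mul_nonneg (sq_nonneg _) (by linarith)) hpos.le

/-- First-order optimality of a mean-field minimizer along coordinatewise transports. -/
lemma integral_pderiv_mul_eq_integral_deriv {V : (Fin m → ℝ) → ℝ} {α L : ℝ}
    (hV : ContDiff ℝ 2 V)
    (hHess : ∀ x v : Fin m → ℝ,
      α * ∑ i, v i ^ 2 ≤ fderiv ℝ (fderiv ℝ V) x v v ∧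
      fderiv ℝ (fderiv ℝ V) x v v ≤ L * ∑ i, v i ^ 2)
    {q : Measure (Fin m → ℝ)} [IsProbabilityMeasure q] (hqQ : q ∈ meanField m)
    (hmin : ∀ q' ∈ meanField m, KL q (target V) ≤ KL q' (target V))
    [IsFiniteMeasure (target V)] (hZ : 0 < ∫ y, Real.exp (-V y)) (hqp : q ≪ target V)
    (hlog : Integrable (fun x => Real.log ((q.rnDeriv (target V) x).toReal)) q)
    (k : Fin m) (hVk : MemLp (pderiv V k) 2 q) {h h' : ℝ → ℝ}
    (hh : ∀ x, HasDerivAt h (h' x) x) (hc : Continuous h') {C : ℝ} (hC : ∀ x, |h' x| ≤ C)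
    (hh2 : MemLp (fun x : Fin m → ℝ => h (x k)) 2 q) :
    ∫ x, pderiv V k x * h (x k) ∂q = ∫ x, h' (x k) ∂q := by
  have hhc : Continuous h := continuous_iff_continuousAt.2 fun x => (hh x).continuousAt
  have hC0 : 0 ≤ C := (abs_nonneg _).trans (hC 0)
  have hVh : Integrable (fun x => pderiv V k x * h (x k)) q := hVk.integrable_mul hh2
  have hhsq : Integrable (fun x => h (x k) ^ 2) q := hh2.integrable_sq
  have hh'i : Integrable (fun x : Fin m → ℝ => h' (x k)) q :=
    (integrable_const C).mono' (hc.comp (continuous_apply k)).aestronglyMeasurable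
      (ae_of_all _ fun x => hC _)
  rw [← sub_eq_zero]
  refine eq_zero_of_forall_abs_le_quadratic_nonneg (δ := 1 / (2 * (C + 1)))
    (B := L / 2 * ∫ x, h (x k) ^ 2 ∂q + 2 * C ^ 2) (by positivity) fun t ht => ?_
  have htC : ∀ x, |t * h' x| ≤ 1 / 2 := fun x => by
    rw [abs_mul]
    calc |t| * |h' x| ≤ 1 / (2 * (C + 1)) * (C + 1) :=
          mul_le_mul ht ((hC x).trans (by linarith)) (abs_nonneg _) (by positivity)
      _ = 1 / 2 := by field_simp
  have hτ : ∀ x, HasDerivAt (fun x => x + t * h x) (1 + t * h' x) x := fun x =>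
    (hasDerivAt_id x).add ((hh x).const_mul t)
  have hτ'c : Continuous fun x => 1 + t * h' x := by fun_prop
  have hpos : ∀ x, 1 / 2 ≤ 1 + t * h' x := fun x => by linarith [(abs_le.1 (htC x)).1]
  have hpos' : ∀ x, 0 < 1 + t * h' x := fun x => by linarith [hpos x]
  have hb : ∀ x : Fin m → ℝ, _ := fun x => potential_update_bounds hV hHess x k (t * h (x k))
  have hquad : ∀ b : ℝ, Integrable
      (fun x => pderiv V k x * (t * h (x k)) + b / 2 * (t * h (x k)) ^ 2) q := fun b => by
    refine ((hVh.const_mul t).add (hhsq.const_mul (b / 2 * t ^ 2))).congr (ae_of_all _ fun x => ?_)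
    simp only [Pi.add_apply]
    ring
  have hVi : Integrable (fun x => V (coordMap k (fun x => x + t * h x) x) - V x) q := by
    refine integrable_of_le_of_le ?_ (ae_of_all _ fun x => ?_) (ae_of_all _ fun x => ?_)
      (hquad α) (hquad L)
    · have : Continuous (coordMap k fun x => x + t * h x) :=
        continuous_id.update k (by fun_prop)
      exact ((hV.continuous.comp this).sub hV.continuous).aestronglyMeasurable
    · simp only [coordMap]; linarith [(hb x).1]
    · simp only [coordMap]; linarith [(hb x).2]
  have hlogle : ∀ x, t * h' x - 2 * (t ^ 2 * C ^ 2) ≤ Real.log (1 + t * h' x) := fun x => by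
    refine le_trans ?_ (sub_two_mul_sq_le_log_one_add (htC x))
    have : h' x ^ 2 ≤ C ^ 2 := sq_le_sq.2 ((hC x).trans (le_abs_self C))
    nlinarith [mul_le_mul_of_nonneg_left this (sq_nonneg t)]
  have hτi : Integrable (fun x : Fin m → ℝ => Real.log (1 + t * h' (x k))) q := by
    refine integrable_of_le_of_le ?_ (ae_of_all _ fun x => hlogle (x k))
      (ae_of_all _ fun x => Real.log_le_sub_one_of_pos (hpos' (x k)))
      ((hh'i.const_mul t).sub (integrable_const _))
      (((integrable_const 1).add (hh'i.const_mul t)).sub (integrable_const 1))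
    exact (hτ'c.log fun x => (hpos' x).ne').comp (continuous_apply k)
      |>.aestronglyMeasurable
  have hKL := hmin _ (map_coordMap_mem_meanField hτ hτ'c hpos k hqQ)
  rw [KL_map_coordMap hV.continuous hZ hτ hτ'c hpos k hqp hlog hVi hτi, KL,
    if_pos ⟨hqp, hlog⟩, EReal.coe_le_coe_iff] at hKL
  have h1 : ∫ x, (V (coordMap k (fun x => x + t * h x) x) - V x) ∂q ≤
      t * ∫ x, pderiv V k x * h (x k) ∂q + L / 2 * t ^ 2 * ∫ x, h (x k) ^ 2 ∂q := by
    rw [← integral_const_mul, ← integral_const_mul,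
      ← integral_add (hVh.const_mul t) (hhsq.const_mul _)]
    refine integral_mono hVi ((hVh.const_mul t).add (hhsq.const_mul _)) fun x => ?_
    simp only [coordMap]
    nlinarith [(hb x).2]
  have h2 : t * ∫ x, h' (x k) ∂q - 2 * (t ^ 2 * C ^ 2) ≤
      ∫ x, Real.log (1 + t * h' (x k)) ∂q := by
    have := integral_mono ((hh'i.const_mul t).sub (integrable_const _)) hτi
      fun x => hlogle (x k)
    simpa [integral_sub (hh'i.const_mul t) (integrable_const _), integral_const_mul] using this
  linarith

end Stein

section ScorePoincare

variable {ν : Measure ℝ} [IsProbabilityMeasure ν] {w : ℝ → ℝ} {α : ℝ}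

lemma sq_sub_le_mul_sub_of_deriv_sq {φ φ' h : ℝ → ℝ} (hφ : ∀ x, HasDerivAt φ (φ' x) x)
    (hh : ∀ x, HasDerivAt h (φ' x ^ 2) x) {t s : ℝ} (hts : t < s) :
    (φ s - φ t) ^ 2 ≤ (s - t) * (h s - h t) := by
  set b := (φ s - φ t) / (s - t)
  have hb : b * (s - t) = φ s - φ t := div_mul_cancel₀ _ (sub_pos.2 hts).ne'
  have hd : ∀ x, HasDerivAt (fun x => h x - 2 * b * φ x + b ^ 2 * x) ((φ' x - b) ^ 2) x :=
    fun x => (((hh x).sub ((hφ x).const_mul (2 * b))).add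
      ((hasDerivAt_id x).const_mul (b ^ 2))).congr_deriv (by ring)
  have hm : Monotone fun x => h x - 2 * b * φ x + b ^ 2 * x :=
    monotone_of_deriv_nonneg (fun x => (hd x).differentiableAt)
      fun x => by rw [(hd x).deriv]; positivity
  have h1 := hm hts.le
  have h2 : 2 * b * (b * (s - t)) - b ^ 2 * (s - t) ≤ h s - h t := by
    rw [hb]
    dsimp only at h1
    linarith
  rw [← hb]
  nlinarith [sub_pos.2 hts]

lemma sq_sub_le_mul_sub_mul_sub (hα : 0 < α) (hw : ∀ t s, t ≤ s → α * (s - t) ≤ w s - w t)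
    {φ φ' h : ℝ → ℝ} (hφ : ∀ x, HasDerivAt φ (φ' x) x)
    (hh : ∀ x, HasDerivAt h (φ' x ^ 2) x) (s t : ℝ) :
    (φ s - φ t) ^ 2 ≤ α⁻¹ * ((w s - w t) * (h s - h t)) := by
  have key : ∀ t s, t < s → (φ s - φ t) ^ 2 ≤ α⁻¹ * ((w s - w t) * (h s - h t)) := by
    intro t s hts
    refine (sq_sub_le_mul_sub_of_deriv_sq hφ hh hts).trans ?_
    have hm : Monotone h := monotone_of_deriv_nonneg (fun x => (hh x).differentiableAt)
      fun x => by rw [(hh x).deriv]; positivity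
    rw [← mul_assoc]
    refine mul_le_mul_of_nonneg_right ?_ (sub_nonneg.2 (hm hts.le))
    rw [le_inv_mul_iff₀ hα]
    exact hw t s hts.le
  rcases lt_trichotomy t s with hts | rfl | hts
  · exact key t s hts
  · simp
  · have := key s t hts
    nlinarith

/-- A Poincaré inequality for a measure on the line satisfying Stein's identity with a
strongly increasing score. -/
lemma integral_prod_sq_sub_le_of_stein (hα : 0 < α)
    (hw : ∀ t s, t ≤ s → α * (s - t) ≤ w s - w t) (hw2 : MemLp w 2 ν)
    (hid : MemLp (fun x : ℝ => x) 2 ν)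
    (hstein : ∀ (h h' : ℝ → ℝ) (C : ℝ), (∀ x, HasDerivAt h (h' x) x) → Continuous h' →
      (∀ x, |h' x| ≤ C) → MemLp h 2 ν → ∫ x, w x * h x ∂ν = ∫ x, h' x ∂ν)
    {φ φ' : ℝ → ℝ} (hφ : ∀ x, HasDerivAt φ (φ' x) x) (hφ' : Continuous φ') {C : ℝ}
    (hC : ∀ x, |φ' x| ≤ C) :
    ∫ p, (φ p.1 - φ p.2) ^ 2 ∂(ν.prod ν) ≤ 2 * α⁻¹ * ∫ x, φ' x ^ 2 ∂ν := by
  set h : ℝ → ℝ := fun s => ∫ x in (0 : ℝ)..s, φ' x ^ 2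
  have hh : ∀ x, HasDerivAt h (φ' x ^ 2) x := fun x =>
    (hφ'.pow 2).integral_hasStrictDerivAt 0 x |>.hasDerivAt
  have hhc : Continuous h := continuous_iff_continuousAt.2 fun x => (hh x).continuousAt
  have hC2 : ∀ x, |φ' x ^ 2| ≤ C ^ 2 := fun x => by
    rw [abs_of_nonneg (sq_nonneg _)]
    exact sq_le_sq.2 ((hC x).trans (le_abs_self C))
  have hh2 : MemLp h 2 ν := by
    refine hid.of_le_mul (c := C ^ 2) hhc.aestronglyMeasurable (ae_of_all _ fun x => ?_)
    have := intervalIntegral.norm_integral_le_of_norm_le_const (a := 0) (b := x)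
      (f := fun x => φ' x ^ 2) fun y _ => hC2 y
    simpa [h] using this
  have hwh := hstein h _ _ hh (hφ'.pow 2) hC2 hh2
  have hw0 : ∫ x, w x ∂ν = 0 := by
    simpa using hstein (fun _ => 1) (fun _ => 0) 0 (fun x => hasDerivAt_const x 1)
      continuous_const (by simp) (memLp_const 1)
  have hwi := hw2.integrable one_le_two
  have hhi := hh2.integrable one_le_two
  have hwhi : Integrable (fun x => w x * h x) ν := hw2.integrable_mul hh2
  have i11 : Integrable (fun p : ℝ × ℝ => w p.1 * h p.1) (ν.prod ν) := hwhi.comp_fst ν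
  have i22 : Integrable (fun p : ℝ × ℝ => w p.2 * h p.2) (ν.prod ν) := hwhi.comp_snd ν
  have i12 : Integrable (fun p : ℝ × ℝ => w p.1 * h p.2) (ν.prod ν) := hwi.mul_prod hhi
  have i21 : Integrable (fun p : ℝ × ℝ => h p.1 * w p.2) (ν.prod ν) := hhi.mul_prod hwi
  have hprod : Integrable (fun p : ℝ × ℝ => w p.1 * h p.1 + w p.2 * h p.2 -
      (w p.1 * h p.2 + h p.1 * w p.2)) (ν.prod ν) := (i11.add i22).sub (i12.add i21)
  have hval : ∫ p : ℝ × ℝ, (w p.1 * h p.1 + w p.2 * h p.2 -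
      (w p.1 * h p.2 + h p.1 * w p.2)) ∂(ν.prod ν) = 2 * ∫ x, φ' x ^ 2 ∂ν := by
    have e1 : ∫ p : ℝ × ℝ, w p.1 * h p.1 ∂(ν.prod ν) = ∫ x, w x * h x ∂ν := by
      simpa using integral_fun_fst (μ := ν) (ν := ν) fun x => w x * h x
    have e2 : ∫ p : ℝ × ℝ, w p.2 * h p.2 ∂(ν.prod ν) = ∫ x, w x * h x ∂ν := by
      simpa using integral_fun_snd (μ := ν) (ν := ν) fun x => w x * h x
    refine (integral_sub (i11.add i22) (i12.add i21)).trans ?_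
    rw [integral_add' i11 i22, integral_add' i12 i21, e1, e2, integral_prod_mul,
      integral_prod_mul, hw0, hwh]
    ring
  calc ∫ p, (φ p.1 - φ p.2) ^ 2 ∂(ν.prod ν)
      ≤ ∫ p : ℝ × ℝ, α⁻¹ * (w p.1 * h p.1 + w p.2 * h p.2 -
          (w p.1 * h p.2 + h p.1 * w p.2)) ∂(ν.prod ν) := by
        refine integral_mono_of_nonneg (ae_of_all _ fun p => sq_nonneg _) (hprod.const_mul _)
          (ae_of_all _ fun p => ?_)
        refine (sq_sub_le_mul_sub_mul_sub hα hw hφ hh p.1 p.2).trans (le_of_eq ?_)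
        ring
    _ = 2 * α⁻¹ * ∫ x, φ' x ^ 2 ∂ν := by
        rw [integral_const_mul, hval]
        ring

end ScorePoincare

section MarginalPoincare

variable {m : ℕ}

lemma lipschitzWith_comp_update {f : (Fin m → ℝ) → ℝ} {K : NNReal} (hf : LipschitzWith K f)
    (k : Fin m) (s : ℝ) : LipschitzWith K fun x => f (Function.update x k s) := by
  refine LipschitzWith.of_dist_le_mul fun x y => (hf.dist_le_mul _ _).trans ?_
  refine mul_le_mul_of_nonneg_left ((dist_pi_le_iff dist_nonneg).2 fun i => ?_) K.2
  by_cases h : i = k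
  · subst h; simp
  · simpa [h] using dist_le_pi_dist x y i

/-- The marginals of a product measure satisfying coordinatewise Stein identities for a strongly
convex potential satisfy a Poincaré inequality. -/
lemma integral_marginal_prod_sq_sub_le {V : (Fin m → ℝ) → ℝ} {α L : ℝ} (hα : 0 < α)
    (hV : ContDiff ℝ 2 V)
    (hHess : ∀ x v : Fin m → ℝ,
      α * ∑ i, v i ^ 2 ≤ fderiv ℝ (fderiv ℝ V) x v v ∧
      fderiv ℝ (fderiv ℝ V) x v v ≤ L * ∑ i, v i ^ 2)
    {μ : Fin m → Measure ℝ} [∀ i, IsProbabilityMeasure (μ i)]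
    (hq2 : Integrable (fun x => ∑ i, x i ^ 2) (Measure.pi μ)) (k : Fin m) {K : NNReal}
    (hVk : LipschitzWith K (pderiv V k))
    (hstein : ∀ (h h' : ℝ → ℝ) (C : ℝ), (∀ x, HasDerivAt h (h' x) x) → Continuous h' →
      (∀ x, |h' x| ≤ C) → MemLp (fun x : Fin m → ℝ => h (x k)) 2 (Measure.pi μ) →
      ∫ x, pderiv V k x * h (x k) ∂(Measure.pi μ) = ∫ x, h' (x k) ∂(Measure.pi μ))
    {φ φ' : ℝ → ℝ} (hφ : ∀ x, HasDerivAt φ (φ' x) x) (hφ' : Continuous φ') {C : ℝ}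
    (hC : ∀ x, |φ' x| ≤ C) :
    ∫ p, (φ p.1 - φ p.2) ^ 2 ∂((μ k).prod (μ k)) ≤ 2 * α⁻¹ * ∫ x, φ' x ^ 2 ∂(μ k) := by
  set q := Measure.pi μ
  have heval : MeasurePreserving (fun x => x k) q (μ k) := measurePreserving_eval μ k
  have hupd : MeasurePreserving (fun p : (Fin m → ℝ) × ℝ => Function.update p.1 k p.2)
      (q.prod (μ k)) q := measurePreserving_update_pi μ k
  set w : ℝ → ℝ := fun s => ∫ z, pderiv V k (Function.update z k s) ∂q
  have hi : ∀ s, Integrable (fun z => pderiv V k (Function.update z k s)) q := fun s =>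
    (memLp_two_of_lipschitzWith hq2 (lipschitzWith_comp_update hVk k s)).integrable one_le_two
  have hbd : ∀ t s, t ≤ s → α * (s - t) ≤ w s - w t ∧ w s - w t ≤ L * (s - t) := by
    intro t s hts
    have hb := fun z => pderiv_update_sub_bounds hV hHess z k t s hts
    have hc : ∀ c : ℝ, ∫ _, c ∂q = c := fun c => by simp
    rw [← integral_sub (hi s) (hi t), ← hc (α * (s - t)), ← hc (L * (s - t))]
    exact ⟨integral_mono (integrable_const _) ((hi s).sub (hi t)) fun z => (hb z).1,
      integral_mono ((hi s).sub (hi t)) (integrable_const _) fun z => (hb z).2⟩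
  have hwlip : ∀ s t, |w s - w t| ≤ L * |s - t| := by
    intro s t
    rcases le_total t s with h | h
    · rw [abs_of_nonneg (sub_nonneg.2 h), abs_of_nonneg]
      · exact (hbd t s h).2
      · exact (mul_nonneg hα.le (sub_nonneg.2 h)).trans (hbd t s h).1
    · rw [abs_sub_comm, abs_sub_comm s, abs_of_nonneg (sub_nonneg.2 h), abs_of_nonneg]
      · exact (hbd s t h).2
      · exact (mul_nonneg hα.le (sub_nonneg.2 h)).trans (hbd s t h).1
  have hid : MemLp (fun x : ℝ => x) 2 (μ k) := by
    rw [← heval.map_eq,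
      memLp_map_measure_iff continuous_id'.aestronglyMeasurable heval.aemeasurable]
    exact memLp_two_of_lipschitzWith hq2 (LipschitzWith.eval k)
  have hwc : Continuous w := by
    refine (LipschitzWith.of_dist_le_mul (K := L.toNNReal) fun s t => ?_).continuous
    rw [Real.dist_eq, Real.dist_eq]
    exact (hwlip s t).trans (mul_le_mul_of_nonneg_right (Real.le_coe_toNNReal L) (abs_nonneg _))
  have hw2 : MemLp w 2 (μ k) := by
    have h1 : MemLp (fun s => w s - w 0) 2 (μ k) :=
      hid.of_le_mul (c := L) (by fun_prop) (ae_of_all _ fun s => by simpa using hwlip s 0)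
    refine (h1.add (memLp_const (w 0))).ae_eq (ae_of_all _ fun s => ?_)
    simp
  refine integral_prod_sq_sub_le_of_stein hα (fun t s h => (hbd t s h).1) hw2 hid ?_ hφ hφ' hC
  intro h h' D hh hh' hD hh2
  have hhc : Continuous h := continuous_iff_continuousAt.2 fun x => (hh x).continuousAt
  have hh2' : MemLp (fun x : Fin m → ℝ => h (x k)) 2 q := hh2.comp_measurePreserving heval
  have hG : Integrable (fun x : Fin m → ℝ => pderiv V k x * h (x k)) q :=
    (memLp_two_of_lipschitzWith hq2 hVk).integrable_mul hh2'
  have e1 : ∫ x, h' (x k) ∂q = ∫ s, h' s ∂(μ k) := by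
    rw [← heval.map_eq, integral_map heval.aemeasurable hh'.aestronglyMeasurable]
  have e2 : ∫ x, pderiv V k x * h (x k) ∂q =
      ∫ p : (Fin m → ℝ) × ℝ, pderiv V k (Function.update p.1 k p.2) * h p.2 ∂(q.prod (μ k)) := by
    conv_lhs => rw [← hupd.map_eq]
    rw [integral_map hupd.aemeasurable (by rw [hupd.map_eq]; exact hG.aestronglyMeasurable)]
    simp
  have hGp : Integrable (fun p : (Fin m → ℝ) × ℝ =>
      pderiv V k (Function.update p.1 k p.2) * h p.2) (q.prod (μ k)) := by
    simpa [Function.comp_def] using hupd.integrable_comp_of_integrable hG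
  rw [← e1, ← hstein h h' D hh hh' hD hh2', e2, integral_prod_symm _ hGp]
  exact integral_congr_ae (ae_of_all _ fun s => (integral_mul_const _ _).symm)

end MarginalPoincare

section Tensorization

variable {m : ℕ}

lemma hybrid_empty_update (w : Fin m → ℝ × ℝ) (k : Fin m) (p : ℝ × ℝ) :
    hybrid ∅ (Function.update w k p) = Function.update (hybrid ∅ w) k p.1 := by
  ext i
  by_cases h : i = k
  · subst h; simp [hybrid]
  · simp [hybrid, h]

lemma hybrid_singleton_update (w : Fin m → ℝ × ℝ) (k : Fin m) (p : ℝ × ℝ) :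
    hybrid {k} (Function.update w k p) = Function.update (hybrid ∅ w) k p.2 := by
  ext i
  by_cases h : i = k
  · subst h; simp [hybrid]
  · simp [hybrid, h]

/-- Poincaré inequalities for the factors tensorize. -/
lemma integral_sq_sub_sq_integral_le {μ : Fin m → Measure ℝ} [∀ i, IsProbabilityMeasure (μ i)]
    {c : ℝ} (hμ : ∀ (k : Fin m) (φ φ' : ℝ → ℝ) (C : ℝ), (∀ x, HasDerivAt φ (φ' x) x) →
      Continuous φ' → (∀ x, |φ' x| ≤ C) →
      ∫ p, (φ p.1 - φ p.2) ^ 2 ∂((μ k).prod (μ k)) ≤ 2 * c * ∫ x, φ' x ^ 2 ∂(μ k))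
    {f : (Fin m → ℝ) → ℝ} (hf : ContDiff ℝ 1 f) {C : ℝ} (hC : ∀ x i, |pderiv f i x| ≤ C)
    (hf2 : MemLp f 2 (Measure.pi μ)) :
    ∫ x, f x ^ 2 ∂(Measure.pi μ) - (∫ x, f x ∂(Measure.pi μ)) ^ 2 ≤
      c * ∑ k, ∫ x, pderiv f k x ^ 2 ∂(Measure.pi μ) := by
  refine (efron_stein hf2).trans ?_
  rw [Finset.mul_sum, Finset.mul_sum]
  refine Finset.sum_le_sum fun k _ => ?_
  set P := Measure.pi fun i => (μ i).prod (μ i)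
  have hupd : MeasurePreserving (fun p : (Fin m → ℝ × ℝ) × (ℝ × ℝ) => Function.update p.1 k p.2)
      (P.prod ((μ k).prod (μ k))) P := measurePreserving_update_pi (fun i => (μ i).prod (μ i)) k
  have hupd1 := measurePreserving_update_pi μ k
  have hpc : Continuous (pderiv f k) := continuous_pderiv hf k
  have hF : Integrable (fun w => (f (hybrid ∅ w) - f (hybrid {k} w)) ^ 2) P :=
    ((hf2.comp_measurePreserving (measurePreserving_hybrid μ ∅)).sub
      (hf2.comp_measurePreserving (measurePreserving_hybrid μ {k}))).integrable_sq
  have hFp : Integrable (fun p : (Fin m → ℝ × ℝ) × (ℝ × ℝ) =>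
      (f (Function.update (hybrid ∅ p.1) k p.2.1) -
        f (Function.update (hybrid ∅ p.1) k p.2.2)) ^ 2) (P.prod ((μ k).prod (μ k))) := by
    simpa only [Function.comp_def, hybrid_empty_update, hybrid_singleton_update] using
      hupd.integrable_comp_of_integrable hF
  have e1 : ∫ w, (f (hybrid ∅ w) - f (hybrid {k} w)) ^ 2 ∂P =
      ∫ w, ∫ p : ℝ × ℝ, (f (Function.update (hybrid ∅ w) k p.1) -
        f (Function.update (hybrid ∅ w) k p.2)) ^ 2 ∂((μ k).prod (μ k)) ∂P := by
    conv_lhs => rw [← hupd.map_eq]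
    rw [integral_map hupd.aemeasurable (by rw [hupd.map_eq]; exact hF.aestronglyMeasurable)]
    simp only [hybrid_empty_update, hybrid_singleton_update]
    exact integral_prod _ hFp
  have hg : Integrable (fun x => pderiv f k x ^ 2) (Measure.pi μ) :=
    (integrable_const (C ^ 2)).mono' (by fun_prop) (ae_of_all _ fun x => by
      rw [Real.norm_eq_abs, abs_of_nonneg (sq_nonneg _)]
      exact sq_le_sq.2 ((hC x k).trans (le_abs_self C)))
  have hgp : Integrable (fun p : (Fin m → ℝ) × ℝ => pderiv f k (Function.update p.1 k p.2) ^ 2)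
      ((Measure.pi μ).prod (μ k)) := hupd1.integrable_comp_of_integrable hg
  have hgi := hgp.integral_prod_left
  have e2 : ∫ w, ∫ s, pderiv f k (Function.update (hybrid ∅ w) k s) ^ 2 ∂(μ k) ∂P =
      ∫ x, pderiv f k x ^ 2 ∂(Measure.pi μ) := by
    rw [integral_comp_hybrid ∅ (g := fun x =>
      ∫ s, pderiv f k (Function.update x k s) ^ 2 ∂(μ k)) hgi.aestronglyMeasurable]
    conv_rhs => rw [← hupd1.map_eq]
    rw [integral_map hupd1.aemeasurable (by rw [hupd1.map_eq]; exact hg.aestronglyMeasurable)]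
    exact (integral_prod _ hgp).symm
  have hle : ∫ w, (f (hybrid ∅ w) - f (hybrid {k} w)) ^ 2 ∂P ≤
      2 * c * ∫ x, pderiv f k x ^ 2 ∂(Measure.pi μ) := by
    rw [e1, ← e2, ← integral_const_mul]
    refine integral_mono hFp.integral_prod_left
      (((measurePreserving_hybrid μ ∅).integrable_comp_of_integrable hgi).const_mul _) fun w => ?_
    refine hμ k (fun s => f (Function.update (hybrid ∅ w) k s)) _ C
      (fun s => hasDerivAt_comp_update_pderiv (hf.differentiable one_ne_zero) _ k s) ?_
      fun s => hC _ k
    exact hpc.comp (continuous_const.update k continuous_id)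
  linarith

end Tensorization

/-- Under Assumption 1, the MFVI minimizer `q*` satisfies
(a) `E_{x∼q*} ∇V(x) = 0`;
(b) `E_{x∼q*} ‖∇V(x)‖₂² ≤ m L²/α`;
(c) `Cov_{x∼q*}(x) ⪯ α⁻¹ I_m`, i.e. `Var_{x∼q*}⟨u, x⟩ ≤ α⁻¹ ‖u‖₂²` for every `u`. -/
theorem MFVI_minimizer_gradient_properties (m : ℕ) (hm : 0 < m) (V : (Fin m → ℝ) → ℝ)
    (α L : ℝ) (hα : 0 < α) (hαL : α ≤ L) (hV : ContDiff ℝ 2 V)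
    (hHess : ∀ x v : Fin m → ℝ,
      α * ∑ i, v i ^ 2 ≤ fderiv ℝ (fderiv ℝ V) x v v ∧
      fderiv ℝ (fderiv ℝ V) x v v ≤ L * ∑ i, v i ^ 2)
    (qstar : Measure (Fin m → ℝ)) (hqQ : qstar ∈ meanField m)
    (hqmin : ∀ q ∈ meanField m, KL qstar (target V) ≤ KL q (target V)) :
    (∀ i : Fin m, ∫ x, pderiv V i x ∂qstar = 0) ∧
    (∫⁻ x, ENNReal.ofReal (∑ i, pderiv V i x ^ 2) ∂qstar
        ≤ ENNReal.ofReal (m * L ^ 2 / α)) ∧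
    (∀ u : Fin m → ℝ,
      evariance (fun x => ∑ i, u i * x i) qstar
        ≤ ENNReal.ofReal (α⁻¹ * ∑ i, u i ^ 2)) := by
  obtain ⟨c, hc⟩ := exists_quadratic_le_potential hα hV hHess
  have ha : 0 < α / 8 := by positivity
  have hc' : ∀ x : Fin m → ℝ, c + 2 * (α / 8) * ∑ i, x i ^ 2 ≤ V x := fun x => by
    refine (le_of_eq ?_).trans (hc x)
    ring
  have hfin := isFiniteMeasure_target hV.continuous ha hc'
  have hZ := normalization_pos hV.continuous ha hc'
  obtain ⟨hqp, hlog⟩ : qstar ≪ target V ∧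
      Integrable (fun x => Real.log ((qstar.rnDeriv (target V) x).toReal)) qstar := by
    by_contra hnot
    obtain ⟨q, hq, hne⟩ := exists_meanField_KL_ne_top hV.continuous ha hc'
    have h := hqmin q hq
    rw [KL, if_neg hnot] at h
    exact hne (top_le_iff.1 h)
  obtain ⟨μ, hprob, -, hμ⟩ := id hqQ
  have hqprob : IsProbabilityMeasure qstar := hμ ▸ inferInstance
  have hq2 := integrable_sum_sq_of_KL_finite hV.continuous ha hc' hqp hlog
  have hL : 0 ≤ L := hα.le.trans hαL
  have hpp : ∀ i x k, |pderiv (pderiv V i) k x| ≤ L := fun i x k =>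
    abs_le_of_sq_le_sq ((Finset.single_le_sum (f := fun k => pderiv (pderiv V i) k x ^ 2)
      (fun _ _ => sq_nonneg _) (Finset.mem_univ k)).trans
      (sum_pderiv_pderiv_sq_le hα hαL hV hHess x i)) hL
  have hlip : ∀ i, ∃ K, LipschitzWith K (pderiv V i) := fun i =>
    exists_lipschitzWith_of_pderiv_bound ((contDiff_pderiv hV i).differentiable one_ne_zero)
      fun x k => hpp i x k
  have hV2 : ∀ i, MemLp (pderiv V i) 2 qstar := fun i =>
    memLp_two_of_lipschitzWith hq2 (hlip i).choose_spec
  have hstein : ∀ (k : Fin m) (h h' : ℝ → ℝ) (C : ℝ), (∀ x, HasDerivAt h (h' x) x) →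
      Continuous h' → (∀ x, |h' x| ≤ C) → MemLp (fun x : Fin m → ℝ => h (x k)) 2 qstar →
      ∫ x, pderiv V k x * h (x k) ∂qstar = ∫ x, h' (x k) ∂qstar :=
    fun k h h' C hh hh' hC hh2 => integral_pderiv_mul_eq_integral_deriv hV hHess hqQ hqmin hZ
      hqp hlog k (hV2 k) hh hh' hC hh2
  have hmean : ∀ i, ∫ x, pderiv V i x ∂qstar = 0 := fun i => by
    simpa using hstein i (fun _ => 1) (fun _ => 0) 0 (fun x => hasDerivAt_const x 1)
      continuous_const (by simp) (memLp_const 1)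
  have hpoincare : ∀ (f : (Fin m → ℝ) → ℝ) (C : ℝ), ContDiff ℝ 1 f →
      (∀ x i, |pderiv f i x| ≤ C) → MemLp f 2 qstar →
      ∫ x, f x ^ 2 ∂qstar - (∫ x, f x ∂qstar) ^ 2 ≤
        α⁻¹ * ∑ k, ∫ x, pderiv f k x ^ 2 ∂qstar := by
    subst hμ
    exact fun f C hf hC hf2 => integral_sq_sub_sq_integral_le
      (fun k φ φ' D hφ hφ' hD => integral_marginal_prod_sq_sub_le hα hV hHess hq2 k
        (hlip k).choose_spec (hstein k) hφ hφ' hD) hf hC hf2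
  refine ⟨hmean, ?_, fun u => ?_⟩
  · have hi : ∀ i, Integrable (fun x => pderiv V i x ^ 2) qstar := fun i => (hV2 i).integrable_sq
    rw [← ofReal_integral_eq_lintegral_ofReal (integrable_finsetSum _ fun i _ => hi i)
      (ae_of_all _ fun x => Finset.sum_nonneg fun i _ => sq_nonneg _),
      integral_finsetSum _ fun i _ => hi i]
    refine ENNReal.ofReal_le_ofReal ?_
    have hle : ∀ i, ∫ x, pderiv V i x ^ 2 ∂qstar ≤ L ^ 2 / α := fun i => by
      have h := hpoincare _ L (contDiff_pderiv hV i) (hpp i) (hV2 i)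
      have hki : ∀ k, Integrable (fun x => pderiv (pderiv V i) k x ^ 2) qstar := fun k =>
        (integrable_const (L ^ 2)).mono'
          ((continuous_pderiv (contDiff_pderiv hV i) k).pow 2).aestronglyMeasurable
          (ae_of_all _ fun x => by
            rw [Real.norm_eq_abs, abs_of_nonneg (sq_nonneg _)]
            exact sq_le_sq.2 ((hpp i x k).trans (le_abs_self L)))
      have hsum : ∑ k, ∫ x, pderiv (pderiv V i) k x ^ 2 ∂qstar ≤ L ^ 2 := by
        rw [← integral_finsetSum _ fun k _ => hki k]
        calc ∫ x, ∑ k, pderiv (pderiv V i) k x ^ 2 ∂qstar ≤ ∫ _, L ^ 2 ∂qstar :=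
              integral_mono (integrable_finsetSum _ fun k _ => hki k) (integrable_const _)
                fun x => sum_pderiv_pderiv_sq_le hα hαL hV hHess x i
          _ = L ^ 2 := by simp
      rw [hmean, zero_pow two_ne_zero, sub_zero] at h
      calc ∫ x, pderiv V i x ^ 2 ∂qstar ≤ α⁻¹ * L ^ 2 :=
            h.trans (mul_le_mul_of_nonneg_left hsum (inv_nonneg.2 hα.le))
        _ = L ^ 2 / α := inv_mul_eq_div _ _
    calc ∑ i, ∫ x, pderiv V i x ^ 2 ∂qstar ≤ ∑ _i : Fin m, L ^ 2 / α :=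
          Finset.sum_le_sum fun i _ => hle i
      _ = m * L ^ 2 / α := by simp [mul_div_assoc]
  · set f : (Fin m → ℝ) → ℝ := fun x => ∑ i, u i * x i
    have hf : ContDiff ℝ 1 f := by fun_prop
    have hpd : ∀ k x, pderiv f k x = u k := fun k x => by
      have hd : HasDerivAt (fun t => f (Function.update x k t)) (u k) (x k) := by
        have := HasDerivAt.fun_sum (u := Finset.univ) fun i _ =>
          (hasDerivAt_pi.1 (hasDerivAt_update x k (x k)) i).const_mul (u i)
        simpa [Pi.single_apply] using this
      exact hd.deriv
    have hb : ∀ x i, |pderiv f i x| ≤ ∑ k, |u k| := fun x i => by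
      rw [hpd]
      exact Finset.single_le_sum (f := fun k => |u k|) (fun _ _ => abs_nonneg _)
        (Finset.mem_univ i)
    obtain ⟨K, hK⟩ := exists_lipschitzWith_of_pderiv_bound (hf.differentiable one_ne_zero) hb
    have hf2 : MemLp f 2 qstar := memLp_two_of_lipschitzWith hq2 hK
    rw [← ofReal_variance hf2, variance_eq_sub hf2]
    refine ENNReal.ofReal_le_ofReal ?_
    simpa [hpd] using hpoincare f _ hf hb hf2

end
end
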